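/- arXiv:1610.05558 — 3 statements merged into one kernel-verified Lean document; each statement's English description precedes it below -/
import Mathlib

section
/- Let n ≥ 1, s ∈ (0,1), and let u, v : ℝⁿ → ℝ be smooth functions with compact support. Then for every x the principal value (−Δ)^s u(x) = C(n,s) lim_{ε→0⁺} ∫_{{y : |x−y|>ε}} (u(x)−u(y))/|x−y|^{n+2s} dy exists, the function x ↦ (−Δ)^s u(x) · v(x) is integrable, and ∫_{ℝⁿ} (−Δ)^s u(x) v(x) dx = (C(n,s)/2) ∬_{ℝⁿ×ℝⁿ} (u(x)−u(y))(v(x)−v(y))/|x−y|^{n+2s} dx dy. -/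
open MeasureTheory Real Filter Set

/-- The normalization constant `C(n,s) = 2^{2s} s Γ(s+n/2) / (π^{n/2} Γ(1−s))` of the
fractional Laplacian. -/
noncomputable def fracLapConst (n : ℕ) (s : ℝ) : ℝ :=
  2 ^ (2 * s) * s * Real.Gamma (s + n / 2) / (Real.pi ^ ((n : ℝ) / 2) * Real.Gamma (1 - s))

namespace FracIBP

/-- radial majorant -/
noncomputable def g (p r : ℝ) : ℝ := min (r ^ 2) 1 / r ^ p

lemma g_nonneg {p r : ℝ} (hr : 0 ≤ r) : 0 ≤ g p r := by
  unfold g; positivity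

lemma g_measurable (p : ℝ) : Measurable (g p) := by
  unfold g; fun_prop

lemma g_integrable (n : ℕ) (hn : 1 ≤ n) (s : ℝ) (hs : s ∈ Set.Ioo (0:ℝ) 1) :
    Integrable (fun z : EuclideanSpace ℝ (Fin n) => g ((n : ℝ) + 2 * s) ‖z‖) := by
  obtain ⟨hs0, hs1⟩ := hs
  have : Nonempty (Fin n) := ⟨⟨0, hn⟩⟩
  have : Nontrivial (EuclideanSpace ℝ (Fin n)) := inferInstance
  rw [integrable_fun_norm_addHaar (volume : Measure (EuclideanSpace ℝ (Fin n)))]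
  simp only [finrank_euclideanSpace, Fintype.card_fin, smul_eq_mul]
  have hU : Ioi (0:ℝ) = Ioc 0 1 ∪ Ioi 1 := (Ioc_union_Ioi_eq_Ioi zero_le_one).symm
  rw [hU]
  have key : ∀ y : ℝ, 0 < y → y ^ (n - 1) / y ^ ((n : ℝ) + 2 * s) = y ^ (-1 - 2 * s) := by
    intro y hy
    rw [← Real.rpow_natCast, ← Real.rpow_sub hy, Nat.cast_sub hn]
    congr 1; push_cast; ring
  refine IntegrableOn.union ?_ ?_
  · have h1 : IntegrableOn (fun y : ℝ => y ^ (1 - 2 * s)) (Ioc 0 1) := by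
      rw [← intervalIntegrable_iff_integrableOn_Ioc_of_le zero_le_one]
      exact intervalIntegral.intervalIntegrable_rpow' (by linarith)
    refine h1.congr_fun ?_ measurableSet_Ioc
    intro y hy
    have hy0 : 0 < y := hy.1
    have hm : min (y ^ 2) 1 = y ^ 2 := min_eq_left (pow_le_one₀ hy0.le hy.2)
    simp only [g, hm]
    have : y ^ (n - 1) * (y ^ 2 / y ^ ((n : ℝ) + 2 * s))
        = y ^ 2 * (y ^ (n - 1) / y ^ ((n : ℝ) + 2 * s)) := by ring
    rw [this, key y hy0, ← Real.rpow_natCast, ← Real.rpow_add hy0]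
    congr 1; push_cast; ring
  · have h1 : IntegrableOn (fun y : ℝ => y ^ (-1 - 2 * s)) (Ioi 1) :=
      integrableOn_Ioi_rpow_of_lt (by linarith) one_pos
    refine h1.congr_fun ?_ measurableSet_Ioi
    intro y hy
    have hy1 : 1 < y := hy
    have hy0 : 0 < y := by linarith
    have hm : min (y ^ 2) 1 = 1 := min_eq_right (one_le_pow₀ hy1.le)
    simp only [g, hm]
    rw [← key y hy0]; ring

/-- turning a bound on the numerator to a bound by `g` -/
lemma bound_g {p r a C : ℝ} (hr : 0 ≤ r) (h1 : |a| ≤ C * r ^ 2) (h2 : |a| ≤ C) :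
    ‖a / r ^ p‖ ≤ C * g p r := by
  have hC : 0 ≤ C := (abs_nonneg a).trans h2
  have hrp : 0 ≤ r ^ p := Real.rpow_nonneg hr p
  rw [Real.norm_eq_abs, abs_div, abs_of_nonneg hrp, g, ← mul_div_assoc]
  gcongr
  rw [mul_min_of_nonneg _ _ hC]
  exact le_min h1 (by linarith)

section
variable {E : Type*} [NormedAddCommGroup E] [NormedSpace ℝ E]

lemma second_diff {u : E → ℝ} (hu : ContDiff ℝ (⊤ : ℕ∞) u) (hcu : HasCompactSupport u) :
    ∃ C : ℝ, ∀ x z : E, |2 * u x - u (x + z) - u (x - z)| ≤ C * ‖z‖ ^ 2 ∧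
      |2 * u x - u (x + z) - u (x - z)| ≤ C := by
  obtain ⟨M, hM⟩ := hcu.exists_bound_of_continuous hu.continuous
  have hd : ContDiff ℝ (⊤ : ℕ∞) (fderiv ℝ u) := hu.fderiv_right (by simp)
  obtain ⟨A, hA⟩ := ContDiff.lipschitzWith_of_hasCompactSupport (hcu.fderiv ℝ) hd (by simp)
  have hdiff : Differentiable ℝ u := hu.differentiable (by simp)
  refine ⟨max (2 * A) (4 * M), fun x z => ⟨?_, ?_⟩⟩
  · refine le_trans ?_ (mul_le_mul_of_nonneg_right (le_max_left _ _) (by positivity))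
    have h := Convex.norm_image_sub_le_of_norm_hasFDerivWithin_le (𝕜 := ℝ)
      (f := fun w => u (x + w) + u (x - w))
      (f' := fun w => fderiv ℝ u (x + w) - fderiv ℝ u (x - w))
      (s := Metric.closedBall (0:E) ‖z‖) (C := 2 * A * ‖z‖) (x := 0) (y := z) ?_ ?_
      (convex_closedBall _ _) (by simp) (by simp)
    · simp only [add_zero, sub_zero, Real.norm_eq_abs] at h
      rw [abs_sub_comm] at h
      calc _ = |u x + u x - (u (x + z) + u (x - z))| := by congr 1; ring
        _ ≤ _ := h
        _ = _ := by ring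
    · intro w _
      apply HasFDerivAt.hasFDerivWithinAt
      have h1 : HasFDerivAt (fun w => u (x + w)) (fderiv ℝ u (x + w)) w := by
        have := (hdiff (x + w)).hasFDerivAt.comp w ((hasFDerivAt_id w).const_add x)
        convert! this using 1
      have h2 : HasFDerivAt (fun w => u (x - w)) (-fderiv ℝ u (x - w)) w := by
        have := (hdiff (x - w)).hasFDerivAt.comp w ((hasFDerivAt_id w).const_sub x)
        convert! this using 1
        ext; simp
      have h3 := h1.add h2
      rw [← sub_eq_add_neg] at h3
      exact h3
    · intro w hw
      have hw' : ‖w‖ ≤ ‖z‖ := by simpa using hw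
      have := hA.dist_le_mul (x + w) (x - w)
      rw [dist_eq_norm, dist_eq_norm] at this
      have h3 : ‖x + w - (x - w)‖ ≤ 2 * ‖w‖ := by
        rw [show x + w - (x - w) = w + w by abel, two_mul]
        exact norm_add_le _ _
      have hA0 : (0:ℝ) ≤ A := A.2
      calc _ ≤ _ := this
        _ ≤ A * (2 * ‖z‖) := by gcongr; linarith
        _ = _ := by ring
  · refine le_trans ?_ (le_max_right _ _)
    have h1 := abs_le.1 (hM x)
    have h2 := abs_le.1 (hM (x + z))
    have h3 := abs_le.1 (hM (x - z))
    rw [abs_le]; constructor <;> linarith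

lemma prod_diff {u v : E → ℝ} (hu : ContDiff ℝ (⊤ : ℕ∞) u) (hcu : HasCompactSupport u)
    (hv : ContDiff ℝ (⊤ : ℕ∞) v) (hcv : HasCompactSupport v) :
    ∃ C : ℝ, ∀ x z : E, |(u x - u (x + z)) * (v x - v (x + z))| ≤ C * ‖z‖ ^ 2 ∧
      |(u x - u (x + z)) * (v x - v (x + z))| ≤ C := by
  obtain ⟨M, hM⟩ := hcu.exists_bound_of_continuous hu.continuous
  obtain ⟨N, hN⟩ := hcv.exists_bound_of_continuous hv.continuous
  obtain ⟨A, hA⟩ := ContDiff.lipschitzWith_of_hasCompactSupport hcu hu (by simp)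
  obtain ⟨B, hB⟩ := ContDiff.lipschitzWith_of_hasCompactSupport hcv hv (by simp)
  refine ⟨max (A * B) ((2 * M) * (2 * N)), fun x z => ⟨?_, ?_⟩⟩
  · refine le_trans ?_ (mul_le_mul_of_nonneg_right (le_max_left _ _) (by positivity))
    have h1 := hA.dist_le_mul x (x + z)
    have h2 := hB.dist_le_mul x (x + z)
    rw [Real.dist_eq, dist_self_add_right] at h1 h2
    rw [abs_mul]
    calc _ ≤ (A * ‖z‖) * (B * ‖z‖) := by gcongr
      _ = _ := by ring
  · refine le_trans ?_ (le_max_right _ _)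
    have h1 := abs_le.1 (hM x)
    have h2 := abs_le.1 (hM (x + z))
    have h3 := abs_le.1 (hN x)
    have h4 := abs_le.1 (hN (x + z))
    have h5 : |u x - u (x + z)| ≤ 2 * M := by rw [abs_le]; constructor <;> linarith
    have h6 : |v x - v (x + z)| ≤ 2 * N := by rw [abs_le]; constructor <;> linarith
    rw [abs_mul]
    exact mul_le_mul h5 h6 (abs_nonneg _) ((abs_nonneg _).trans h5)
end

section
variable (n : ℕ) (s : ℝ) (u v : EuclideanSpace ℝ (Fin n) → ℝ)

/-- symmetrized integrand -/
noncomputable def D (x z : EuclideanSpace ℝ (Fin n)) : ℝ :=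
  (2 * u x - u (x + z) - u (x - z)) / ‖z‖ ^ ((n : ℝ) + 2 * s)

/-- the limit -/
noncomputable def L (x : EuclideanSpace ℝ (Fin n)) : ℝ := (1 / 2) * ∫ z, D n s u x z

variable {n s u v}

lemma D_bound (hu : ContDiff ℝ (⊤ : ℕ∞) u) (hcu : HasCompactSupport u) :
    ∃ C : ℝ, ∀ x z, ‖D n s u x z‖ ≤ C * g ((n : ℝ) + 2 * s) ‖z‖ := by
  obtain ⟨C, hC⟩ := second_diff hu hcu
  exact ⟨C, fun x z => bound_g (norm_nonneg z) (hC x z).1 (hC x z).2⟩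

lemma D_meas (hu : Continuous u) :
    Measurable (fun q : EuclideanSpace ℝ (Fin n) × EuclideanSpace ℝ (Fin n) =>
      D n s u q.1 q.2) := by
  unfold D
  have := hu.measurable
  fun_prop

lemma F_eq (hn : 1 ≤ n) (hs : s ∈ Set.Ioo (0:ℝ) 1) (hu : ContDiff ℝ (⊤ : ℕ∞) u)
    (hcu : HasCompactSupport u) (x : EuclideanSpace ℝ (Fin n)) {ε : ℝ} (hε : 0 < ε) :
    ∫ y in {y | ε < ‖x - y‖}, (u x - u y) / ‖x - y‖ ^ ((n : ℝ) + 2 * s)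
      = (1 / 2) * ∫ z, {z | ε < ‖z‖}.indicator (D n s u x) z := by
  have hum := hu.continuous.measurable
  have hS : MeasurableSet {z : EuclideanSpace ℝ (Fin n) | ε < ‖z‖} :=
    measurableSet_lt measurable_const measurable_norm
  have hS' : MeasurableSet {y : EuclideanSpace ℝ (Fin n) | ε < ‖x - y‖} :=
    measurableSet_lt measurable_const (by fun_prop)
  set h : EuclideanSpace ℝ (Fin n) → ℝ := {z | ε < ‖z‖}.indicator
    (fun z => (u x - u (x + z)) / ‖z‖ ^ ((n : ℝ) + 2 * s)) with hh
  have e1 : ∫ y in {y | ε < ‖x - y‖}, (u x - u y) / ‖x - y‖ ^ ((n : ℝ) + 2 * s) = ∫ z, h z := by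
    rw [← integral_indicator hS', ← integral_add_left_eq_self _ x]
    congr 1; ext z
    simp [hh, indicator]
  have hint : Integrable h := by
    obtain ⟨M, hM⟩ := hcu.exists_bound_of_continuous hu.continuous
    refine ((g_integrable n hn s hs).const_mul (max (2 * M) (2 * M / ε ^ 2))).mono' ?_ ?_
    · exact (Measurable.indicator (by fun_prop) hS).aestronglyMeasurable
    · refine Eventually.of_forall fun z => ?_
      have h1 := abs_le.1 (hM x)
      have h2 := abs_le.1 (hM (x + z))
      have h5 : |u x - u (x + z)| ≤ 2 * M := by rw [abs_le]; constructor <;> linarith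
      have hM0 : 0 ≤ 2 * M := (abs_nonneg _).trans h5
      by_cases hz : ε < ‖z‖
      · have : h z = (u x - u (x + z)) / ‖z‖ ^ ((n : ℝ) + 2 * s) := by simp [hh, hz]
        rw [this]
        refine bound_g (norm_nonneg z) ?_ (h5.trans (le_max_left _ _))
        refine h5.trans ?_
        calc 2 * M = 2 * M / ε ^ 2 * ε ^ 2 := by field_simp
          _ ≤ _ := by gcongr; exact le_max_right _ _
      · have : h z = 0 := by simp [hh, hz]
        rw [this, norm_zero]
        exact mul_nonneg (hM0.trans (le_max_left _ _)) (g_nonneg (norm_nonneg z))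
  have e2 : ∫ z, {z | ε < ‖z‖}.indicator (D n s u x) z = (∫ z, h z) + ∫ z, h (-z) := by
    rw [← integral_add hint hint.comp_neg]
    congr 1; ext z
    by_cases hz : ε < ‖z‖
    · simp only [hh, indicator, mem_ofPred_eq, hz, norm_neg, if_true, D]
      rw [← add_div, ← sub_eq_add_neg]; congr 1; ring
    · simp [hh, indicator, hz]
  rw [e1, e2, integral_neg_eq_self]; ring

lemma F_tendsto (hn : 1 ≤ n) (hs : s ∈ Set.Ioo (0:ℝ) 1) (hu : ContDiff ℝ (⊤ : ℕ∞) u)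
    (hcu : HasCompactSupport u) (x : EuclideanSpace ℝ (Fin n)) :
    Tendsto
          (fun ε : ℝ => ∫ y in {y | ε < ‖x - y‖}, (u x - u y) / ‖x - y‖ ^ ((n : ℝ) + 2 * s))
          (nhdsWithin 0 (Set.Ioi 0)) (nhds (L n s u x)) := by
  obtain ⟨C, hC⟩ := D_bound (s := s) hu hcu
  have hDm : Measurable (D n s u x) := (D_meas hu.continuous).comp measurable_prodMk_left
  have key : Tendsto (fun ε : ℝ => (1 / 2) * ∫ z, {z | ε < ‖z‖}.indicator (D n s u x) z)
      (nhdsWithin 0 (Set.Ioi 0)) (nhds (L n s u x)) := by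
    refine Tendsto.const_mul _ ?_
    refine tendsto_integral_filter_of_dominated_convergence
      (fun z => C * g ((n : ℝ) + 2 * s) ‖z‖) ?_ ?_ ((g_integrable n hn s hs).const_mul C) ?_
    · refine Eventually.of_forall fun ε => ?_
      exact (hDm.indicator (measurableSet_lt measurable_const measurable_norm)).aestronglyMeasurable
    · refine Eventually.of_forall fun ε => Eventually.of_forall fun z => ?_
      exact (norm_indicator_le_norm_self _ _).trans (hC x z)
    · refine Eventually.of_forall fun z => ?_
      rcases eq_or_ne z 0 with rfl | hz
      · have : D n s u x 0 = 0 := by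
          simp only [D, add_zero, sub_zero]; rw [show 2 * u x - u x - u x = 0 by ring, zero_div]
        rw [this]
        refine tendsto_const_nhds.congr fun ε => ?_
        simp [indicator, this]
      · refine tendsto_const_nhds.congr' ?_
        have : ∀ᶠ ε : ℝ in nhdsWithin 0 (Ioi 0), ε < ‖z‖ :=
          nhdsWithin_le_nhds (eventually_lt_nhds (norm_pos_iff.2 hz))
        filter_upwards [this] with ε hε
        simp [indicator, hε]
  refine key.congr' ?_
  filter_upwards [self_mem_nhdsWithin] with ε hε
  exact (F_eq hn hs hu hcu x hε).symm

lemma int1 (hn : 1 ≤ n) (hs : s ∈ Set.Ioo (0:ℝ) 1) (hu : ContDiff ℝ (⊤ : ℕ∞) u)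
    (hcu : HasCompactSupport u) (hv : ContDiff ℝ (⊤ : ℕ∞) v) (hcv : HasCompactSupport v) :
    Integrable (fun q : EuclideanSpace ℝ (Fin n) × EuclideanSpace ℝ (Fin n) =>
      D n s u q.1 q.2 * v q.1) (volume.prod volume) := by
  obtain ⟨C, hC⟩ := D_bound (s := s) hu hcu
  have hvi : Integrable v := hv.continuous.integrable_of_hasCompactSupport hcv
  refine (hvi.norm.mul_prod ((g_integrable n hn s hs).const_mul C)).mono' ?_ ?_
  · exact ((D_meas hu.continuous).mul
      (hv.continuous.measurable.comp measurable_fst)).aestronglyMeasurable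
  · refine Eventually.of_forall fun q => ?_
    rw [norm_mul, mul_comm]
    exact mul_le_mul_of_nonneg_left (hC _ _) (norm_nonneg _)

lemma int2 (hn : 1 ≤ n) (hs : s ∈ Set.Ioo (0:ℝ) 1) (hu : ContDiff ℝ (⊤ : ℕ∞) u)
    (hcu : HasCompactSupport u) (hv : ContDiff ℝ (⊤ : ℕ∞) v) (hcv : HasCompactSupport v) :
    Integrable (fun q : EuclideanSpace ℝ (Fin n) × EuclideanSpace ℝ (Fin n) =>
      (u q.1 - u (q.1 + q.2)) * (v q.1 - v (q.1 + q.2)) / ‖q.2‖ ^ ((n : ℝ) + 2 * s))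
      (volume.prod volume) := by
  obtain ⟨C, hC⟩ := prod_diff hu hcu hv hcv
  have hum := hu.continuous.measurable
  have hvm := hv.continuous.measurable
  have hSm : MeasurableSet (tsupport v) := (isClosed_tsupport v).measurableSet
  have hvi : Integrable ((tsupport v).indicator (fun _ => (1:ℝ))) (volume) := by
    rw [integrable_indicator_iff hSm]
    exact integrableOn_const (hcv.measure_lt_top.ne)
  have h1 := hvi.mul_prod ((g_integrable n hn s hs).const_mul C)
  have h2 := (measurePreserving_add_prod (volume : Measure (EuclideanSpace ℝ (Fin n)))
    (volume : Measure (EuclideanSpace ℝ (Fin n)))).integrable_comp_of_integrable h1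
  refine (h1.add h2).mono' (Measurable.aestronglyMeasurable (by fun_prop)) ?_
  refine Eventually.of_forall fun q => ?_
  obtain ⟨x, z⟩ := q
  have hb := bound_g (p := (n : ℝ) + 2 * s) (norm_nonneg z) (hC x z).1 (hC x z).2
  have h0 := (norm_nonneg _).trans hb
  simp only [Pi.add_apply, Function.comp]
  by_cases hx : x ∈ tsupport v
  · rw [indicator_of_mem hx]
    by_cases hxz : x + z ∈ tsupport v
    · rw [indicator_of_mem hxz]; linarith
    · rw [indicator_of_notMem hxz]; linarith
  · by_cases hxz : x + z ∈ tsupport v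
    · rw [indicator_of_mem hxz, indicator_of_notMem hx]; linarith
    · rw [indicator_of_notMem hxz, indicator_of_notMem hx, image_eq_zero_of_notMem_tsupport hx,
        image_eq_zero_of_notMem_tsupport hxz]
      simp

lemma swap_z (hu : ContDiff ℝ (⊤ : ℕ∞) u)
    (hv : ContDiff ℝ (⊤ : ℕ∞) v) (hcv : HasCompactSupport v) (z : EuclideanSpace ℝ (Fin n)) :
    ∫ x, D n s u x z * v x =
      ∫ x, (u x - u (x + z)) * (v x - v (x + z)) / ‖z‖ ^ ((n : ℝ) + 2 * s) := by
  have huc := hu.continuous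
  have hvc := hv.continuous
  set c := ‖z‖ ^ ((n : ℝ) + 2 * s)
  have i1 : Integrable (fun x => (u x - u (x + z)) / c * v x) :=
    Continuous.integrable_of_hasCompactSupport (by fun_prop) (hcv.mul_left)
  have i2 : Integrable (fun x => (u x - u (x - z)) / c * v x) :=
    Continuous.integrable_of_hasCompactSupport (by fun_prop) (hcv.mul_left)
  have i3 : Integrable (fun x => (u (x + z) - u x) / c * v (x + z)) := by
    simpa using i2.comp_add_right z
  have e2 : ∫ x, (u x - u (x - z)) / c * v x = ∫ x, (u (x + z) - u x) / c * v (x + z) := by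
    rw [← integral_add_right_eq_self _ z]; simp
  calc ∫ x, D n s u x z * v x
      = ∫ x, ((u x - u (x + z)) / c * v x + (u x - u (x - z)) / c * v x) := by
        congr 1; ext x; simp only [D]; ring
    _ = ∫ x, ((u x - u (x + z)) / c * v x + (u (x + z) - u x) / c * v (x + z)) := by
        rw [integral_add i1 i2, e2, integral_add i1 i3]
    _ = _ := by congr 1; ext x; ring
end

end FracIBP

/-- **Integration by parts for the fractional Laplacian.** For smooth, compactly supported
`u, v : ℝⁿ → ℝ`, the principal value defining `(−Δ)^s u(x)` exists for every `x`, the function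
`x ↦ (−Δ)^s u(x) v(x)` is integrable, and
`∫ (−Δ)^s u · v = (C(n,s)/2) ∬ (u(x)−u(y))(v(x)−v(y))/|x−y|^{n+2s}`. -/
theorem fractional_integration_by_parts (n : ℕ) (hn : 1 ≤ n) (s : ℝ) (hs : s ∈ Set.Ioo (0:ℝ) 1)
    (u v : EuclideanSpace ℝ (Fin n) → ℝ)
    (hu : ContDiff ℝ (⊤ : ℕ∞) u) (hcu : HasCompactSupport u)
    (hv : ContDiff ℝ (⊤ : ℕ∞) v) (hcv : HasCompactSupport v) :
    ∃ L : EuclideanSpace ℝ (Fin n) → ℝ,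
      (∀ x, Tendsto
          (fun ε : ℝ => ∫ y in {y | ε < ‖x - y‖}, (u x - u y) / ‖x - y‖ ^ ((n : ℝ) + 2 * s))
          (nhdsWithin 0 (Set.Ioi 0)) (nhds (L x))) ∧
      Integrable (fun x => (fracLapConst n s * L x) * v x) volume ∧
      ∫ x, (fracLapConst n s * L x) * v x =
        (fracLapConst n s / 2) *
          ∫ x, ∫ y, (u x - u y) * (v x - v y) / ‖x - y‖ ^ ((n : ℝ) + 2 * s) := by
  have hi := FracIBP.int1 hn hs hu hcu hv hcv
  have hi2 := FracIBP.int2 hn hs hu hcu hv hcv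
  have hL : ∀ x, FracIBP.L n s u x * v x = (1 / 2) * ∫ z, FracIBP.D n s u x z * v x := by
    intro x
    rw [integral_mul_const, FracIBP.L, mul_assoc]
  have hLi : Integrable (fun x => FracIBP.L n s u x * v x) := by
    simp_rw [hL]
    exact hi.integral_prod_left.const_mul _
  have hLe : ∫ x, FracIBP.L n s u x * v x = (1 / 2) *
      ∫ x, ∫ y, (u x - u y) * (v x - v y) / ‖x - y‖ ^ ((n : ℝ) + 2 * s) := by
    simp_rw [hL]
    have e1 : ∫ x, ∫ z, FracIBP.D n s u x z * v x = ∫ z, ∫ x, FracIBP.D n s u x z * v x :=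
      integral_integral_swap hi
    have e2 : ∫ x, ∫ z, (u x - u (x + z)) * (v x - v (x + z)) / ‖z‖ ^ ((n : ℝ) + 2 * s)
        = ∫ z, ∫ x, (u x - u (x + z)) * (v x - v (x + z)) / ‖z‖ ^ ((n : ℝ) + 2 * s) :=
      integral_integral_swap hi2
    rw [integral_const_mul, e1]
    simp_rw [FracIBP.swap_z hu hv hcv]
    rw [← e2]
    congr 2
    ext x
    symm
    rw [← integral_add_left_eq_self _ x]
    simp
  refine ⟨FracIBP.L n s u, FracIBP.F_tendsto hn hs hu hcu, ?_, ?_⟩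
  · simp_rw [mul_assoc]
    exact hLi.const_mul _
  · simp_rw [mul_assoc]
    rw [integral_const_mul, hLe]
    ring
end

section
/- Let n ≥ 1, s ∈ (0,1), k ∈ ℕ. Define λ_{k,s} = 2^{2s} Γ(1+s+k) Γ(n/2+s+k) / (k! Γ(n/2+k)), the weight ω^s(x) = (1 − ‖x‖²)₊^s for x ∈ ℝⁿ, and p_k^{(s)}(x) = P_k^{(s, n/2−1)}(2‖x‖² − 1) · χ_{B(0,1)}(x), where P_k^{(α,β)} is the Jacobi polynomial. Set u = ω^s · p_k^{(s)}. Then for every x in the open unit ball B(0,1) ⊂ ℝⁿ, the principal value C(n,s) lim_{ε→0⁺} ∫_{{y : |x−y|>ε}} (u(x)−u(y))/|x−y|^{n+2s} dy exists and equals λ_{k,s} p_k^{(s)}(x); that is, (−Δ)^s (ω^s p_k^{(s)}) = λ_{k,s} p_k^{(s)} in B(0,1). -/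
open MeasureTheory Real Filter Set

/-- The Jacobi polynomial
`P_k^{(α,β)}(z) = (Γ(α+k+1)/(k! Γ(α+β+k+1))) Σ_{m=0}^{k} C(k,m) (Γ(α+β+k+m+1)/Γ(α+m+1)) ((z−1)/2)^m`. -/
noncomputable def jacobiP (k : ℕ) (α β : ℝ) (z : ℝ) : ℝ :=
  (Real.Gamma (α + k + 1) / (k.factorial * Real.Gamma (α + β + k + 1))) *
    ∑ m ∈ Finset.range (k + 1),
      (k.choose m : ℝ) * (Real.Gamma (α + β + k + m + 1) / Real.Gamma (α + m + 1)) *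
        ((z - 1) / 2) ^ m

/-- The eigenvalue `λ_{k,s} = 2^{2s} Γ(1+s+k) Γ(n/2+s+k) / (k! Γ(n/2+k))`. -/
noncomputable def jacobiEigenvalue (n k : ℕ) (s : ℝ) : ℝ :=
  2 ^ (2 * s) * Real.Gamma (1 + s + k) * Real.Gamma (n / 2 + s + k) /
    (k.factorial * Real.Gamma (n / 2 + k))

open Topology

noncomputable def pch (a : ℝ) (n : ℕ) : ℝ := ∏ i ∈ Finset.range n, (a + i)

lemma pch_zero (a : ℝ) : pch a 0 = 1 := by simp [pch]

lemma pch_succ (a : ℝ) (n : ℕ) : pch a (n+1) = pch a n * (a + n) := by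
  simp [pch, Finset.prod_range_succ]

lemma pch_succ' (a : ℝ) (n : ℕ) : pch a (n+1) = a * pch (a+1) n := by
  simp only [pch, Finset.prod_range_succ']
  rw [mul_comm]
  congr 1
  · simp
  · apply Finset.prod_congr rfl; intro i _; push_cast; ring

lemma pch_add (a : ℝ) (m n : ℕ) : pch a (m+n) = pch a m * pch (a+m) n := by
  induction n with
  | zero => simp [pch_zero]
  | succ n ih => rw [← add_assoc, pch_succ, ih, pch_succ]; push_cast; ring

lemma pch_pos {a : ℝ} (ha : 0 < a) (n : ℕ) : 0 < pch a n := by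
  unfold pch; exact Finset.prod_pos (fun i _ => by positivity)

lemma pch_neg (a : ℝ) (N : ℕ) : pch (1 - a - N) N = (-1)^N * pch a N := by
  induction N with
  | zero => simp [pch_zero]
  | succ n ih =>
    rw [pch_succ', pch_succ]
    have : (1 - a - ((n+1 : ℕ) : ℝ) + 1) = 1 - a - n := by push_cast; ring
    rw [this, ih]; push_cast; ring

lemma Gamma_pch {a : ℝ} (ha : ∀ i : ℕ, a + i ≠ 0) (n : ℕ) : Real.Gamma (a + n) = Real.Gamma a * pch a n := by
  induction n with
  | zero => simp [pch_zero]
  | succ n ih =>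
    rw [pch_succ]; push_cast
    rw [← add_assoc, Real.Gamma_add_one (ha n), ih]; ring

lemma pch_one (n : ℕ) : pch 1 n = n.factorial := by
  induction n with
  | zero => simp [pch_zero]
  | succ n ih => rw [pch_succ, ih, Nat.factorial_succ]; push_cast; ring

lemma chuV (N : ℕ) : ∀ (a c : ℝ), 0 < c →
    ∑ i ∈ Finset.range (N+1), (N.choose i : ℝ) * (-1)^i * (pch a i / pch c i) = pch (c - a) N / pch c N := by
  induction N with
  | zero => intro a c _; simp [pch_zero]
  | succ N ih =>
    intro a c hc
    have h1 := ih a c hc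
    have h2 := ih (a+1) (c+1) (by linarith)
    have e : ∑ i ∈ Finset.range (N+1+1), ((N+1).choose i : ℝ) * (-1)^i * (pch a i / pch c i)
       = ∑ i ∈ Finset.range (N+1), (N.choose i : ℝ) * (-1)^i * (pch a i / pch c i)
        - (a/c) * ∑ i ∈ Finset.range (N+1), (N.choose i : ℝ) * (-1)^i * (pch (a+1) i / pch (c+1) i) := by
      rw [Finset.sum_range_succ']
      have : ∑ i ∈ Finset.range (N+1), (N.choose i : ℝ) * (-1)^i * (pch a i / pch c i)
        = ∑ i ∈ Finset.range (N+1), (N.choose (i+1) : ℝ) * (-1)^(i+1) * (pch a (i+1) / pch c (i+1)) + 1 := by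
        have t := Finset.sum_range_succ' (fun i => (N.choose i : ℝ) * (-1)^i * (pch a i / pch c i)) (N+1)
        rw [Finset.sum_range_succ _ (N+1)] at t
        simpa [pch_zero] using t
      rw [this, Finset.mul_sum]
      have : ∀ i, ((N+1).choose (i+1) : ℝ) * (-1)^(i+1) * (pch a (i+1) / pch c (i+1)) = 
        (N.choose (i+1) : ℝ) * (-1)^(i+1) * (pch a (i+1) / pch c (i+1)) - (a/c) * ((N.choose i : ℝ) * (-1)^i * (pch (a+1) i / pch (c+1) i)) := by
        intro i
        rw [Nat.choose_succ_succ, pch_succ', pch_succ']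
        push_cast
        rw [mul_div_mul_comm]
        ring
      simp_rw [this, Finset.sum_sub_distrib]
      simp [pch_zero]; ring
    rw [e, h1, h2]
    have p1 := pch_pos hc N
    have p2 := pch_pos (show 0 < c+1 by linarith) N
    have p3 : pch c N * (c+N) = c * pch (c+1) N := by rw [← pch_succ, pch_succ']
    have p4 : pch (c+1) N = pch c N * (c+N) / c := by field_simp; linarith
    have h5 : c + 1 - (a+1) = c - a := by ring
    have : 0 < c + N := by positivity
    rw [h5, pch_succ, pch_succ, p4]
    field_simp
    ring

lemma chuX (k j : ℕ) (hj : j ≤ k) (a c : ℝ) (hc : 0 < c) :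
    ∑ m ∈ Finset.range (k+1), (k.choose m : ℝ) * (m.choose j) * (-1)^m * (pch a m / pch c m)
      = k.choose j * (-1)^j * pch a j * pch (c - a) (k-j) / pch c k := by
  obtain ⟨N, rfl⟩ := Nat.exists_eq_add_of_le hj
  have : j + N + 1 = j + (N+1) := by ring
  rw [this, Finset.sum_range_add]
  rw [Finset.sum_eq_zero (s := Finset.range j)]
  · have e : ∀ i ∈ Finset.range (N+1), ((j+N).choose (j+i) : ℝ) * ((j+i).choose j) * (-1)^(j+i) * (pch a (j+i) / pch c (j+i))
       = ((j+N).choose j) * (-1)^j * (pch a j / pch c j) * ((N.choose i : ℝ) * (-1)^i * (pch (a+j) i / pch (c+j) i)) := by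
      intro i hi
      have hi' : i ≤ N := by simpa [Nat.lt_succ_iff] using hi
      have hh : (j+N).choose (j+i) * (j+i).choose j = (j+N).choose j * N.choose i := by
        rw [Nat.choose_mul (by omega)]; simp
      have hh' : ((j+N).choose (j+i) : ℝ) * (j+i).choose j = (j+N).choose j * N.choose i := by exact_mod_cast hh
      rw [hh', pch_add, pch_add, mul_div_mul_comm]
      ring
    rw [Finset.sum_congr rfl e, ← Finset.mul_sum, chuV N _ _ (by positivity), zero_add]
    have : c + j - (a + j) = c - a := by ring
    rw [this, Nat.add_sub_cancel_left, pch_add c]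
    have := pch_pos hc j
    have := pch_pos (show 0 < c + j by positivity) N
    field_simp
  · intro i hi
    rw [Nat.choose_eq_zero_of_lt (Finset.mem_range.1 hi : i < j)]; simp

lemma pow_sub_exp (ρ : ℝ) (N : ℕ) : (1-ρ)^N = ∑ j ∈ Finset.range (N+1), (N.choose j : ℝ) * (-1)^j * ρ^j := by
  rw [sub_eq_add_neg, add_comm, add_pow]
  apply Finset.sum_congr rfl
  intro i _
  rw [neg_pow]; simp; ring

lemma convQ (m : ℕ) (a b ρ : ℝ) (hb : 0 < b) :
    ∑ l ∈ Finset.range (m+1), (m.choose l : ℝ) * (pch a l / pch b l) * (1-ρ)^(m-l) * ρ^l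
     = ∑ j ∈ Finset.range (m+1), (m.choose j : ℝ) * (-1)^j * (pch (b - a) j / pch b j) * ρ^j := by
  have e1 : ∀ l ∈ Finset.range (m+1), (m.choose l : ℝ) * (pch a l / pch b l) * (1-ρ)^(m-l) * ρ^l
     = ∑ j ∈ Finset.range (m+1), if l ≤ j then ((m.choose j : ℝ) * (-1)^j * ρ^j) * ((j.choose l) * (-1)^l * (pch a l / pch b l)) else 0 := by
    intro l hl
    have hl' : l ≤ m := by simpa [Nat.lt_succ_iff] using hl
    obtain ⟨N, rfl⟩ := Nat.exists_eq_add_of_le hl'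
    rw [Nat.add_sub_cancel_left, pow_sub_exp]
    rw [show l + N + 1 = l + (N+1) by ring, Finset.sum_range_add _ l (N+1), Finset.sum_eq_zero (s := Finset.range l), zero_add,
      Finset.mul_sum, Finset.sum_mul]
    · apply Finset.sum_congr rfl
      intro i hi
      have hi' : i ≤ N := by simpa [Nat.lt_succ_iff] using hi
      rw [if_pos (by omega)]
      have hh : (l+N).choose (l+i) * (l+i).choose l = (l+N).choose l * N.choose i := by
        rw [Nat.choose_mul (by omega)]; simp
      have hh' : ((l+N).choose (l+i) : ℝ) * (l+i).choose l = (l+N).choose l * N.choose i := by exact_mod_cast hh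
      have h1 : ((-1:ℝ))^l * (-1)^l = 1 := by rw [← mul_pow]; simp
      calc _ = ((l+N).choose l * N.choose i : ℝ) * (pch a l / pch b l) * (-1)^i * ρ^i * ρ^l := by ring
        _ = _ := by 
          rw [← hh', pow_add, pow_add]
          linear_combination (-((l+N).choose (l+i) * (l+i).choose l * (pch a l / pch b l) * (-1)^i * ρ^i * ρ^l : ℝ)) * h1
    · intro i hi
      rw [if_neg (by simpa using hi)]
  rw [Finset.sum_congr rfl e1, Finset.sum_comm]
  apply Finset.sum_congr rfl
  intro j hj
  have hj' : j ≤ m := by simpa [Nat.lt_succ_iff] using hj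
  rw [← Finset.sum_filter, ← Finset.mul_sum]
  have : Finset.filter (fun l => l ≤ j) (Finset.range (m+1)) = Finset.range (j+1) := by
    ext l; simp; omega
  rw [this, chuV j a b hb]; ring

lemma swapE (k : ℕ) (f : ℕ → ℝ) (g : ℕ → ℝ) (ρ : ℝ) :
    ∑ m ∈ Finset.range (k+1), f m * ∑ j ∈ Finset.range (m+1), (m.choose j : ℝ) * g j * ρ^j
    = ∑ j ∈ Finset.range (k+1), (∑ m ∈ Finset.range (k+1), f m * m.choose j) * (g j * ρ^j) := by
  have : ∀ m ∈ Finset.range (k+1), f m * ∑ j ∈ Finset.range (m+1), (m.choose j : ℝ) * g j * ρ^j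
     = ∑ j ∈ Finset.range (k+1), (f m * m.choose j) * (g j * ρ^j) := by
    intro m hm
    have hm' : m + 1 ≤ k + 1 := by simpa using hm
    rw [Finset.mul_sum, ← Finset.sum_subset (Finset.range_mono hm')]
    · apply Finset.sum_congr rfl; intros; ring
    · intro j _ hj
      rw [Nat.choose_eq_zero_of_lt (by simpa using hj)]; simp
  rw [Finset.sum_congr rfl this, Finset.sum_comm]
  simp_rw [Finset.sum_mul]

/-- pure combinatorial identity -/
lemma comb (k : ℕ) (s b σ : ℝ) (hs : 0 < s) (hb : 0 < b) :
    ∑ m ∈ Finset.range (k+1), (k.choose m : ℝ) * (-1)^m * pch (s+b+k) m / m.factorial *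
      ∑ l ∈ Finset.range (m+1), (m.choose l : ℝ) * (pch (-s) l / pch b l) * σ^(m-l) * (1-σ)^l
    = pch (s+b) k * pch (s+1) k / (k.factorial * pch b k) *
      ∑ m ∈ Finset.range (k+1), (k.choose m : ℝ) * (-1)^m * (pch (s+b+k) m / pch (s+1) m) * σ^m := by
  obtain ⟨ρ, rfl⟩ : ∃ ρ, σ = 1 - ρ := ⟨1 - σ, by ring⟩
  simp only [sub_sub_cancel]
  simp_rw [convQ _ (-s) b ρ hb]
  have h2 : ∀ m, (1-ρ)^m = ∑ j ∈ Finset.range (m+1), (m.choose j : ℝ) * (-1)^j * ρ^j := pow_sub_exp ρ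
  simp_rw [h2]
  have e1 : ∀ m j : ℕ, (m.choose j : ℝ) * (-1)^j * (pch (b - -s) j / pch b j) * ρ^j
    = (m.choose j : ℝ) * ((-1)^j * (pch (b - -s) j / pch b j)) * ρ^j := by intros; ring
  simp_rw [e1] 
  rw [swapE, swapE, Finset.mul_sum]
  apply Finset.sum_congr rfl
  intro j hj
  have hj' : j ≤ k := by simpa [Nat.lt_succ_iff] using hj
  have c1 := chuX k j hj' (s+b+k) 1 one_pos
  have c2 := chuX k j hj' (s+b+k) (s+1) (by linarith)
  have d1 : ∑ m ∈ Finset.range (k+1), (k.choose m : ℝ) * (-1)^m * pch (s+b+k) m / m.factorial * m.choose j = 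
     k.choose j * (-1)^j * pch (s+b+k) j * pch (1 - (s+b+k)) (k-j) / pch 1 k := by
    rw [← c1]; apply Finset.sum_congr rfl; intros; rw [pch_one]; ring
  have d2 : ∑ m ∈ Finset.range (k+1), (k.choose m : ℝ) * ((-1)^m * (pch (s+b+k) m / pch (s+1) m)) * m.choose j = 
     k.choose j * (-1)^j * pch (s+b+k) j * pch (s + 1 - (s+b+k)) (k-j) / pch (s+1) k := by
    rw [← c2]; apply Finset.sum_congr rfl; intros; ring
  have d1' : ∑ m ∈ Finset.range (k+1), (k.choose m : ℝ) * (-1)^m * (pch (s+b+k) m / m.factorial) * m.choose j = 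
     k.choose j * (-1)^j * pch (s+b+k) j * pch (1 - (s+b+k)) (k-j) / pch 1 k := by
    rw [← d1]; apply Finset.sum_congr rfl; intros; ring
  have d2' : ∑ m ∈ Finset.range (k+1), (k.choose m : ℝ) * (-1)^m * (pch (s+b+k) m / pch (s+1) m) * m.choose j = 
     k.choose j * (-1)^j * pch (s+b+k) j * pch (s + 1 - (s+b+k)) (k-j) / pch (s+1) k := by
    rw [← d2]; apply Finset.sum_congr rfl; intros; ring
  first | rw [d1] | rw [d1']
  first | rw [d2] | rw [d2']
  obtain ⟨N, rfl⟩ := Nat.exists_eq_add_of_le hj'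
  rw [Nat.add_sub_cancel_left, pch_one]
  have f1 : 1 - (s+b+((j+N:ℕ):ℝ)) = 1 - (s+b+j) - N := by push_cast; ring
  have f2 : s + 1 - (s+b+((j+N:ℕ):ℝ)) = 1 - (b+j) - N := by push_cast; ring
  rw [f1, f2, pch_neg, pch_neg, pch_add (s+b) j N, pch_add b j N]
  have f3 : b - -s = s + b := by ring
  rw [f3]
  have := pch_pos hb j
  have := pch_pos (show 0 < b + j by positivity) N
  have := pch_pos (show 0 < s + 1 by positivity) (j+N)
  field_simp

/-- odd power identity -/
lemma chebS (m : ℕ) (z c : ℝ) (x y : ℝ) (hc : x + y = 2 + z) 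
   (p q : ℝ) (hp : p * p = x) (hq : q * q = y) (hpq : p * q = 1) (hpc : p + q = c) :
    p^(2*m+1) + q^(2*m+1) = c * ∑ l ∈ Finset.range (m+1), ((m+l).choose (2*l) : ℝ) * z^l := by
  induction m using Nat.twoStepInduction with
  | zero => simp [hpc]
  | one =>
    simp [Finset.sum_range_succ]
    have : p^3+q^3 = (p+q)*(p*p+q*q - p*q) := by ring
    rw [this, hp, hq, hpc, hc, hpq]; ring
  | more m h1 h2 =>
    have e : p^(2*(m+2)+1) + q^(2*(m+2)+1) = (2+z) * (p^(2*(m+1)+1) + q^(2*(m+1)+1)) - (p^(2*m+1) + q^(2*m+1)) := by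
      rw [← hc, ← hp, ← hq]
      have h4 : (p*q)^2 = 1 := by rw [hpq]; ring
      calc _ = (p * p + q * q) * (p ^ (2 * (m + 1) + 1) + q ^ (2 * (m + 1) + 1)) - (p*q)^2 *(p ^ (2 * m + 1) + q ^ (2 * m + 1)) := by ring
        _ = _ := by rw [h4]; ring
    rw [e, h1, h2]
    have s1 : ∑ l ∈ Finset.range (m+1), ((m+l).choose (2*l) : ℝ) * z^l = ∑ l ∈ Finset.range (m+3), ((m+l).choose (2*l) : ℝ) * z^l := by
      apply Finset.sum_subset (Finset.range_mono (by omega))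
      intro l _ hl
      rw [Nat.choose_eq_zero_of_lt (by simp at hl; omega)]; simp
    have s2 : ∑ l ∈ Finset.range (m+1+1), ((m+1+l).choose (2*l) : ℝ) * z^l = ∑ l ∈ Finset.range (m+3), ((m+1+l).choose (2*l) : ℝ) * z^l := by
      apply Finset.sum_subset (Finset.range_mono (by omega))
      intro l _ hl
      rw [Nat.choose_eq_zero_of_lt (by simp at hl; omega)]; simp
    have s3 : z * ∑ l ∈ Finset.range (m+1+1), ((m+1+l).choose (2*l) : ℝ) * z^l = ∑ l ∈ Finset.range (m+3), (if l = 0 then 0 else ((m+l).choose (2*l-2) : ℝ)) * z^l := by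
      rw [Finset.sum_range_succ' _ (m+2), Finset.mul_sum]
      simp
      apply Finset.sum_congr rfl
      intro i _
      have : 2 * (i+1) - 2 = 2 * i := by omega
      rw [this, show m + (i+1) = m+1+i by ring]; ring
    have : (2+z) * (c * ∑ l ∈ Finset.range (m+1+1), ((m+1+l).choose (2*l) : ℝ) * z^l) - c * ∑ l ∈ Finset.range (m+1), ((m+l).choose (2*l) : ℝ) * z^l
      = c * (2 * ∑ l ∈ Finset.range (m+3), ((m+1+l).choose (2*l) : ℝ) * z^l + ∑ l ∈ Finset.range (m+3), (if l = 0 then 0 else ((m+l).choose (2*l-2) : ℝ)) * z^l - ∑ l ∈ Finset.range (m+3), ((m+l).choose (2*l) : ℝ) * z^l) := by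
      rw [← s3, ← s2, s1]; ring
    rw [this]
    congr 1
    rw [Finset.mul_sum, ← Finset.sum_add_distrib, ← Finset.sum_sub_distrib]
    apply Finset.sum_congr rfl
    intro l _
    rcases l with _ | l
    · simp; norm_num
    · simp only [Nat.add_eq_zero_iff, one_ne_zero, and_false, if_false]
      have : 2 * (l+1) - 2 = 2 * l := by omega
      rw [this]
      have g1 : (m+2+(l+1)).choose (2*(l+1)) = (m+2+l).choose (2*l+1) + (m+2+l).choose (2*l+2) := by
        rw [show m+2+(l+1) = (m+2+l)+1 by ring, show 2*(l+1) = (2*l+1)+1 by ring, Nat.choose_succ_succ]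
      have g2 : (m+2+l).choose (2*l+1) = (m+1+l).choose (2*l) + (m+1+l).choose (2*l+1) := by
        rw [show m+2+l = (m+1+l)+1 by ring,  Nat.choose_succ_succ]
      have g3 : (m+2+l).choose (2*l+2) = (m+1+l).choose (2*l+1) + (m+1+l).choose (2*l+2) := by
        rw [show m+2+l = (m+1+l)+1 by ring,  Nat.choose_succ_succ]
      have r1 : m+1+(l+1) = m+2+l := by ring
      have r2 : m+(l+1) = m+1+l := by ring
      have r3 : 2*(l+1) = 2*l+2 := by ring
      rw [r1, r2, g1, r3, g3, g2]
      push_cast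
      ring

lemma oddpow (m : ℕ) (V τ : ℝ) (hV : 0 < V - τ) (hV' : 0 < V + τ) :
    (V+τ)^(2*m+1) + (V-τ)^(2*m+1) = 2 * V * ∑ l ∈ Finset.range (m+1), ((m+l).choose (2*l) : ℝ) * 4^l * (V^2-τ^2)^(m-l) * τ^(2*l) := by
  set y := V^2 - τ^2 with hy
  have hypos : 0 < y := by rw [hy]; nlinarith [mul_pos hV hV']
  set w := √y with hw
  have hwpos : 0 < w := Real.sqrt_pos.2 hypos
  have hw2 : w * w = y := Real.mul_self_sqrt hypos.le
  have hww : w^2 = y := by rw [sq, hw2]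
  have := chebS m (4*τ^2/y) (2*V/w) ((V+τ)^2/y) ((V-τ)^2/y) (by field_simp; rw [hy]; ring)
    ((V+τ)/w) ((V-τ)/w)
    (by rw [← hww]; ring) (by rw [← hww]; ring) (by field_simp; rw [hww, hy]; ring) (by ring)
  rw [div_pow, div_pow, ← add_div, div_eq_iff (by positivity)] at this
  rw [this, mul_assoc, mul_comm _ (w^(2*m+1)), pow_succ, pow_mul, hww]
  rw [mul_assoc, mul_assoc, div_mul_eq_mul_div, mul_div_assoc]
  have : (2:ℝ) * V * (∑ l ∈ Finset.range (m + 1), ((m + l).choose (2 * l) : ℝ) * 4^l * y ^ (m - l) * τ ^ (2 * l)) = 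
    2 * V * (y^m * (∑ l ∈ Finset.range (m + 1), ((m + l).choose (2 * l) : ℝ) * (4 * τ^2/y)^l)) := by
    congr 1
    rw [Finset.mul_sum]
    apply Finset.sum_congr rfl
    intro l hl
    have hl' : l ≤ m := by simpa [Nat.lt_succ_iff] using hl
    obtain ⟨N, rfl⟩ := Nat.exists_eq_add_of_le hl'
    rw [Nat.add_sub_cancel_left, div_pow, mul_pow, pow_mul, pow_add]
    field_simp
  rw [mul_assoc] at this
  simp only [mul_assoc] at *
  rw [this]
  field_simp


lemma polarInt (n : ℕ) (hn : 1 ≤ n) (f : EuclideanSpace ℝ (Fin n) → ℝ) (hf : Integrable f) :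
    ∫ z, f z = ∫ h : Metric.sphere (0 : EuclideanSpace ℝ (Fin n)) 1, 
      (∫ t in Ioi (0:ℝ), t^(n-1) * f (t • (h : EuclideanSpace ℝ (Fin n)))) ∂((volume : Measure (EuclideanSpace ℝ (Fin n))).toSphere) := by
  have : Nonempty (Fin n) := ⟨⟨0, hn⟩⟩
  let E := EuclideanSpace ℝ (Fin n)
  let μ : Measure E := volume
  have mp := μ.measurePreserving_homeomorphUnitSphereProd
  let g : (Metric.sphere (0:E) 1) × (Ioi (0:ℝ)) → ℝ := fun p => f (p.2.1 • (p.1 : E))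
  have hg : ∀ z : ({(0:E)}ᶜ : Set E), g (homeomorphUnitSphereProd E z) = f z := by
    intro z
    simp only [g]
    congr 1
    have hz : ‖(z:E)‖ ≠ 0 := norm_ne_zero_iff.2 z.2
    simp [smul_smul, hz]
  have h1 : ∫ z, f z = ∫ p, g p ∂(μ.toSphere.prod (.volumeIoiPow (Module.finrank ℝ E - 1))) := by
    rw [← mp.integral_comp (Homeomorph.measurableEmbedding _) g]
    simp_rw [hg]
    rw [integral_subtype_comap (measurableSet_singleton _).compl f, restrict_compl_singleton]
  have h2 : Integrable g (μ.toSphere.prod (.volumeIoiPow (Module.finrank ℝ E - 1))) := by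
    rw [← mp.integrable_comp_emb (Homeomorph.measurableEmbedding _)]
    have : g ∘ (homeomorphUnitSphereProd E) = f ∘ Subtype.val := by ext z; exact hg z
    rw [this, ← integrableOn_iff_comap_subtypeVal (by measurability)]
    exact hf.integrableOn
  rw [h1, integral_prod _ h2]
  have hd : Module.finrank ℝ E = n := by simp [E]
  rw [hd]
  congr 1
  ext h
  simp only [Measure.volumeIoiPow, ENNReal.ofReal]
  rw [integral_withDensity_eq_integral_smul, integral_subtype_comap measurableSet_Ioi fun a ↦ Real.toNNReal (a ^ (n - 1)) • f (a • (h:E))]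
  · apply setIntegral_congr_fun measurableSet_Ioi
    intro x hx
    simp only [NNReal.smul_def, smul_eq_mul]
    rw [Real.coe_toNNReal _ (pow_nonneg hx.out.le _)]
  · exact (measurable_subtype_coe.pow_const _).real_toNNReal

lemma gauss_half (l : ℕ) : ∫ t in Ioi (0:ℝ), t^(l:ℕ) * Real.exp (-t^2) = Real.Gamma ((l+1)/2) / 2 := by
  have := integral_rpow_mul_exp_neg_rpow (p := 2) (q := l) (by norm_num) (by have : (0:ℝ) ≤ l := by positivity
                                                                             linarith)
  simp only [rpow_natCast] at this
  have e : ∀ t : ℝ, t ^ (2:ℝ) = t^2 := by intro t; exact_mod_cast Real.rpow_natCast t 2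
  simp_rw [e] at this
  rw [this]; ring

lemma gauss_full (l : ℕ) : ∫ t : ℝ, t^(2*l) * Real.exp (-t^2) = Real.Gamma (l+1/2) := by
  have := integral_comp_abs (f := fun t => t^(2*l) * Real.exp (-t^2))
  simp only [sq_abs, pow_mul] at this
  simp only [pow_mul]
  rw [this]
  have h := gauss_half (2*l)
  simp only [pow_mul] at h
  rw [h]; push_cast
  rw [show (2 * (l:ℝ) + 1)/2 = l + 1/2 by ring]; ring

lemma gauss_int (l : ℕ) : Integrable (fun t : ℝ => t^l * Real.exp (-t^2)) := by
  have := integrable_rpow_mul_exp_neg_mul_sq (b := 1) one_pos (s := l) (by have : (0:ℝ) ≤ l := by positivity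
                                                                           linarith)
  simpa using this

lemma gaussE0 (n : ℕ) (i0 : Fin n) (l : ℕ) :
    ∫ z : EuclideanSpace ℝ (Fin n), (z i0)^(2*l) * Real.exp (-‖z‖^2) = Real.Gamma (l+1/2) * π ^ (((n:ℝ)-1)/2) := by
  have mp := EuclideanSpace.volume_preserving_symm_measurableEquiv_toLp (Fin n)
  rw [← mp.symm.integral_comp (MeasurableEquiv.measurableEmbedding _)]
  have e : ∀ y : Fin n → ℝ, ((MeasurableEquiv.toLp 2 (Fin n → ℝ)).symm.symm y i0)^(2*l) * Real.exp (-‖(MeasurableEquiv.toLp 2 (Fin n → ℝ)).symm.symm y‖^2)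
     = ∏ i, ((if i = i0 then (y i)^(2*l) else 1) * Real.exp (-(y i)^2)) := by
    intro y
    rw [Finset.prod_mul_distrib, Finset.prod_ite_eq' Finset.univ i0 (fun i => (y i)^(2*l)), if_pos (Finset.mem_univ _), EuclideanSpace.norm_sq_eq, ← Real.exp_sum]
    simp [Finset.sum_neg_distrib]
  simp_rw [e]
  rw [integral_fintype_prod_volume_eq_prod (fun i (t:ℝ) => (if i = i0 then t^(2*l) else 1) * Real.exp (-t^2))]
  rw [← Finset.mul_prod_erase _ _ (Finset.mem_univ i0)]
  simp only [if_true]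
  rw [gauss_full, Finset.prod_congr rfl (g := fun _ => √π)]
  · rw [Finset.prod_const, Finset.card_erase_of_mem (Finset.mem_univ _), Finset.card_univ, Fintype.card_fin, Real.sqrt_eq_rpow, ← Real.rpow_natCast, ← Real.rpow_mul pi_pos.le, Nat.cast_sub (by have := i0.2; omega)]
    congr 2; push_cast; ring
  · intro i hi
    simp only [if_neg (Finset.ne_of_mem_erase hi)]
    have := integral_gaussian 1
    simpa using this

lemma gaussE (n : ℕ) (hn : 1 ≤ n) (x : EuclideanSpace ℝ (Fin n)) (l : ℕ) :
    ∫ z : EuclideanSpace ℝ (Fin n), (inner ℝ x z)^(2*l) * Real.exp (-‖z‖^2) = ‖x‖^(2*l) * Real.Gamma (l+1/2) * π ^ (((n:ℝ)-1)/2) := by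
  let i0 : Fin n := ⟨0, hn⟩
  let w : EuclideanSpace ℝ (Fin n) := ‖x‖ • EuclideanSpace.single i0 (1:ℝ)
  have hw : ‖x‖ = ‖w‖ := by simp [w, norm_smul]
  let L := (Submodule.reflection (ℝ ∙ (x - w))ᗮ)
  have hL : L x = w := Submodule.reflection_sub hw
  have : ∀ z, (inner ℝ x z)^(2*l) * Real.exp (-‖z‖^2) = (fun y => ‖x‖^(2*l) * ((y i0)^(2*l) * Real.exp (-‖y‖^2))) (L z) := by
    intro z
    rw [← L.inner_map_map x z, hL]
    simp only [w, LinearIsometryEquiv.norm_map]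
    rw [inner_smul_left, EuclideanSpace.inner_single_left]
    simp; ring
  simp_rw [this]
  rw [(LinearIsometryEquiv.measurePreserving L).integral_comp L.toHomeomorph.measurableEmbedding (fun y => ‖x‖^(2*l) * ((y i0)^(2*l) * Real.exp (-‖y‖^2)))]
  rw [integral_const_mul, gaussE0]; ring

lemma gaussE_int (n : ℕ) (hn : 1 ≤ n) (x : EuclideanSpace ℝ (Fin n)) (l : ℕ) :
    Integrable (fun z : EuclideanSpace ℝ (Fin n) => (inner ℝ x z)^(2*l) * Real.exp (-‖z‖^2)) := by
  have : Nonempty (Fin n) := ⟨⟨0, hn⟩⟩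
  have hh : Integrable (fun z : EuclideanSpace ℝ (Fin n) => (fun t => ‖x‖^(2*l) * (t^(2*l) * Real.exp (-t^2))) ‖z‖) := by
    rw [integrable_fun_norm_addHaar (volume : Measure (EuclideanSpace ℝ (Fin n))) (f := fun t => ‖x‖^(2*l) * (t^(2*l) * Real.exp (-t^2)))]
    have := ((gauss_int (Module.finrank ℝ (EuclideanSpace ℝ (Fin n)) - 1 + 2*l)).const_mul (‖x‖^(2*l))).integrableOn (s := Ioi 0)
    refine this.congr_fun ?_ measurableSet_Ioi
    intro t _
    simp only [smul_eq_mul, pow_add]; ring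
  refine hh.mono' (by fun_prop) ?_
  filter_upwards with z
  rw [norm_mul, norm_pow, Real.norm_of_nonneg (Real.exp_pos _).le, ← mul_assoc, ← mul_pow]
  gcongr
  exact norm_inner_le_norm x z

lemma sphereMoment (n : ℕ) (hn : 1 ≤ n) (x : EuclideanSpace ℝ (Fin n)) (l : ℕ) :
    ∫ h : Metric.sphere (0 : EuclideanSpace ℝ (Fin n)) 1, (inner ℝ x (h : EuclideanSpace ℝ (Fin n)))^(2*l)
      ∂((volume : Measure (EuclideanSpace ℝ (Fin n))).toSphere)
     = ‖x‖^(2*l) * (2 * Real.Gamma (l+1/2) * π ^ (((n:ℝ)-1)/2) / Real.Gamma (l + (n:ℝ)/2)) := by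
  have h1 := gaussE n hn x l
  rw [polarInt n hn _ (gaussE_int n hn x l)] at h1
  have h2 : ∀ h : Metric.sphere (0 : EuclideanSpace ℝ (Fin n)) 1, 
     ∫ t in Ioi (0:ℝ), t^(n-1) * ((inner ℝ x (t • (h : EuclideanSpace ℝ (Fin n))))^(2*l) * Real.exp (-‖t • (h : EuclideanSpace ℝ (Fin n))‖^2))
      = (inner ℝ x (h : EuclideanSpace ℝ (Fin n)))^(2*l) * (Real.Gamma (l + (n:ℝ)/2) / 2) := by
    intro h
    have hg := gauss_half (n-1+2*l)
    have : (((n - 1 + 2*l : ℕ):ℝ) + 1)/2 = l + (n:ℝ)/2 := by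
      push_cast [Nat.cast_sub hn]; ring
    rw [this] at hg
    rw [← hg, ← integral_const_mul]
    apply setIntegral_congr_fun measurableSet_Ioi
    intro t ht
    have hh : ‖(h : EuclideanSpace ℝ (Fin n))‖ = 1 := by simpa using h.2
    simp only
    rw [norm_smul, hh, mul_one, inner_smul_right, mul_pow, norm_eq_abs, sq_abs, pow_add]
    ring
  simp_rw [h2] at h1
  rw [integral_mul_const] at h1
  have : 0 < Real.Gamma (l + (n:ℝ)/2) := Real.Gamma_pos_of_pos (by have : (1:ℝ) ≤ n := by exact_mod_cast hn
                                                                   positivity)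
  rw [← mul_div_assoc, eq_div_iff this.ne']
  linarith

lemma betaLim (a b : ℝ) (N : ℕ) (ha : 0 < a) (hb : 0 < b) (hN : (N:ℝ) = a + 1 + b) :
    Tendsto (fun Q : ℝ => ∫ q in (0:ℝ)..Q, q^a * ((1+q)^N)⁻¹) atTop (𝓝 (Real.Gamma (a+1) * Real.Gamma b / Real.Gamma (a+1+b))) := by
  have h1 : ∀ᶠ Q in atTop, (∫ z in (0:ℝ)..(Q/(1+Q)), z^a * (1-z)^(b-1)) = ∫ q in (0:ℝ)..Q, q^a * ((1+q)^N)⁻¹ := by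
    filter_upwards [eventually_gt_atTop 0] with Q hQ
    have key := intervalIntegral.integral_comp_mul_deriv' (a := 0) (b := Q) (f := fun q => q/(1+q)) (f' := fun q => 1/(1+q)^2) (g := fun z => z^a * (1-z)^(b-1)) ?_ ?_ ?_
    · simp only [zero_div] at key
      rw [← key]
      apply intervalIntegral.integral_congr
      intro q hq
      rw [uIcc_of_le hQ.le] at hq
      have hq1 : 0 < 1 + q := by linarith [hq.1]
      simp only [Function.comp]
      have : 1 - q/(1+q) = (1+q)⁻¹ := by field_simp; ring
      rw [this, Real.div_rpow hq.1 hq1.le, Real.inv_rpow hq1.le]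
      have e : (1+q)^N = (1+q)^a * (1+q)^(b-1) * (1+q)^2 := by
        rw [← Real.rpow_natCast, hN, ← Real.rpow_natCast, ← Real.rpow_add hq1, ← Real.rpow_add hq1]
        congr 1; push_cast; ring
      rw [e]
      have := Real.rpow_pos_of_pos hq1 a
      have := Real.rpow_pos_of_pos hq1 (b-1)
      field_simp
    · intro q hq
      rw [uIcc_of_le hQ.le] at hq
      have hq1 : 1 + q ≠ 0 := by linarith [hq.1]
      have := (hasDerivAt_id q).div ((hasDerivAt_id q).const_add 1) hq1
      refine this.congr_deriv ?_
      simp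
    · apply ContinuousOn.div continuousOn_const (by fun_prop)
      intro q hq
      rw [uIcc_of_le hQ.le] at hq
      have hq1 : 0 < 1 + q := by linarith [hq.1]
      positivity
    · rintro _ ⟨q, hq, rfl⟩
      rw [uIcc_of_le hQ.le] at hq
      have hq1 : 0 < 1 + q := by linarith [hq.1]
      apply ContinuousAt.continuousWithinAt
      apply ContinuousAt.mul
      · exact continuousAt_id.rpow_const (Or.inr ha.le)
      · apply ContinuousAt.rpow_const (by fun_prop)
        left
        have : 1 - q/(1+q) = (1+q)⁻¹ := by field_simp; ring
        simp only [this]; positivity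
  refine Tendsto.congr' h1 ?_
  have hzint : IntervalIntegrable (fun z:ℝ => z^a * (1-z)^(b-1)) volume 0 1 := by
    have := (Complex.betaIntegral_convergent (u := (a+1:ℝ)) (v := (b:ℝ)) (by simpa using by linarith) (by simpa using hb))
    have h2 := this.norm
    refine h2.congr_uIoo ?_
    intro z hz
    rw [uIoo_of_le zero_le_one] at hz
    simp only
    rw [norm_mul]
    have e1 : ((1:ℂ) - (z:ℂ)) = ((1 - z : ℝ) : ℂ) := by push_cast; ring
    rw [e1, Complex.norm_cpow_eq_rpow_re_of_pos hz.1, Complex.norm_cpow_eq_rpow_re_of_pos (by linarith [hz.2])]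
    simp
  have hval : ∫ z in (0:ℝ)..1, z^a * (1-z)^(b-1) = Real.Gamma (a+1) * Real.Gamma b / Real.Gamma (a+1+b) := by
    have e := ProbabilityTheory.beta_eq_betaIntegralReal (a+1) b (by linarith) hb
    rw [ProbabilityTheory.beta] at e
    rw [e, Complex.betaIntegral]
    have : ∀ z ∈ uIcc (0:ℝ) 1, (z:ℂ)^(((a+1:ℝ):ℂ) - 1) * ((1:ℂ) - z)^((b:ℂ)-1) = ((z^a * (1-z)^(b-1) : ℝ) : ℂ) := by
      intro z hz
      rw [uIcc_of_le zero_le_one] at hz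
      push_cast
      rw [Complex.ofReal_cpow hz.1, Complex.ofReal_cpow (by linarith [hz.2])]
      push_cast
      simp
    rw [intervalIntegral.integral_congr this, intervalIntegral.integral_ofReal, Complex.ofReal_re]
  rw [← hval]
  have hc := intervalIntegral.continuousOn_primitive_interval (μ := volume) (f := fun z:ℝ => z^a * (1-z)^(b-1)) (a := 0) (b := 1) 
     (by rw [uIcc_of_le zero_le_one]; exact (intervalIntegrable_iff_integrableOn_Icc_of_le zero_le_one).1 hzint)
  have hc1 := hc 1 (by simp)
  refine hc1.tendsto.comp ?_
  rw [tendsto_nhdsWithin_iff]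
  constructor
  · have : Tendsto (fun Q:ℝ => 1 - (1+Q)⁻¹) atTop (𝓝 (1 - 0)) := 
      tendsto_const_nhds.sub (tendsto_inv_atTop_zero.comp (tendsto_atTop_add_const_left _ 1 tendsto_id))
    rw [sub_zero] at this
    refine this.congr' ?_
    filter_upwards [eventually_gt_atTop 0] with Q hQ
    field_simp; ring
  · filter_upwards [eventually_gt_atTop 0] with Q hQ
    rw [uIcc_of_le zero_le_one]
    refine ⟨by positivity, ?_⟩
    rw [div_le_one (by positivity)]; linarith


noncomputable def phi (p σ τ t : ℝ) : ℝ := (max (σ - 2*τ*t - t^2) 0)^p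

lemma taylor2 (σ p : ℝ) (hσ : 0 < σ) : ∃ K > 0, ∃ r > 0, ∀ v, |v - σ| ≤ r →
    |v^p - σ^p - p*σ^(p-1)*(v-σ)| ≤ K*(v-σ)^2 := by
  have hA : AnalyticAt ℝ (fun v : ℝ => v^p) σ := (Real.contDiffAt_rpow_const_of_ne (n := ⊤) hσ.ne').analyticAt
  obtain ⟨P, hP⟩ := hA
  have hO := hP.isBigO_sub_partialSum_pow 2
  have hd : HasDerivAt (fun v : ℝ => v^p) (p*σ^(p-1)) σ := Real.hasDerivAt_rpow_const (Or.inl hσ.ne')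
  have hd' := hP.hasDerivAt
  have hu := hd.unique hd'
  have h0 : P 0 ![] = σ^p := by simpa using hP.coeff_zero ![]
  obtain ⟨K, hK, hb⟩ := hO.exists_pos
  rw [Asymptotics.IsBigOWith, Metric.eventually_nhds_iff] at hb
  obtain ⟨r, hr, hb⟩ := hb
  refine ⟨K, hK, r/2, by positivity, ?_⟩
  intro v hv
  have := @hb (v - σ) (by rw [dist_zero_right, norm_eq_abs]; linarith)
  rw [FormalMultilinearSeries.partialSum, Finset.sum_range_succ, Finset.sum_range_one] at this
  have e0 : (P 0) (fun _ => v - σ) = σ^p := hP.coeff_zero _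
  have e1 : (P 1) (fun _ => v - σ) = p*σ^(p-1)*(v-σ) := by
    rw [hu]
    simp [mul_comm]
  rw [e0, e1, add_sub_cancel, norm_pow, norm_norm, norm_eq_abs, norm_eq_abs, sq_abs, ← sub_sub] at this
  exact this

lemma phi_nonneg (p σ τ t : ℝ) : 0 ≤ phi p σ τ t := by unfold phi; positivity

lemma phi_le (p σ τ t : ℝ) (hp : 0 < p) (hσ : 0 < σ) (hτ : |τ| ≤ 1) : phi p σ τ t ≤ (σ+1)^p := by
  unfold phi
  apply Real.rpow_le_rpow (by positivity) _ hp.le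
  apply max_le _ (by linarith)
  have : τ^2 ≤ 1 := by rw [← sq_abs]; nlinarith [abs_nonneg τ]
  nlinarith [sq_nonneg (t+τ)]

lemma diff_bounds (p σ : ℝ) (hp : 0 < p) (hσ : 0 < σ) : ∃ C > 0, ∀ τ, |τ| ≤ 1 → ∀ t, 0 < t →
    |2*σ^p - phi p σ τ t - phi p σ (-τ) t| ≤ C * min (t^2) 1 ∧ |σ^p - phi p σ τ t| ≤ C * t := by
  obtain ⟨K, hK, r, hr, hT⟩ := taylor2 σ p hσ
  set d := p*σ^(p-1) with hd
  have hdpos : 0 < d := by positivity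
  set t0 := min (min (r/3) (σ/3)) 1 with ht0
  have ht0pos : 0 < t0 := by positivity
  have ht01 : t0 ≤ 1 := min_le_right _ _
  have ht0r : t0 ≤ r/3 := (min_le_left _ _).trans (min_le_left _ _)
  have ht0s : t0 ≤ σ/3 := (min_le_left _ _).trans (min_le_right _ _)
  set M := 2*σ^p + 2*(σ+1)^p with hM
  have hMpos : 0 < M := by positivity
  refine ⟨2*d + 18*K + 3*d + 9*K + M/t0^2, by positivity, ?_⟩
  intro τ hτ t ht
  have small : ∀ τ', |τ'| ≤ 1 → t ≤ t0 → ∃ e, phi p σ τ' t = σ^p + d*(-2*τ'*t - t^2) + e ∧ |e| ≤ 9*K*t^2 := by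
    intro τ' hτ' htt
    have h1 : |(-2*τ'*t - t^2)| ≤ 3*t := by
      have := abs_le.1 hτ'
      rw [abs_le]; constructor <;> nlinarith
    have h2 := hT (σ - 2*τ'*t - t^2) (by
      have : σ - 2*τ'*t - t^2 - σ = -2*τ'*t - t^2 := by ring
      rw [this]; linarith)
    have h3 : σ - 2*τ'*t - t^2 - σ = -2*τ'*t - t^2 := by ring
    rw [h3] at h2
    have h4 : 0 ≤ σ - 2*τ'*t - t^2 := by have := (abs_le.1 h1).1; linarith
    refine ⟨_, (by unfold phi; rw [max_eq_left h4]; ring : phi p σ τ' t = σ^p + d*(-2*τ'*t - t^2) + ((σ - 2*τ'*t - t^2)^p - σ^p - d*(-2*τ'*t - t^2))), ?_⟩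
    refine h2.trans ?_
    have : (-2*τ'*t - t^2)^2 ≤ (3*t)^2 := sq_le_sq' (abs_le.1 h1).1 (abs_le.1 h1).2
    nlinarith
  have hb1 := phi_le p σ τ t hp hσ hτ
  have hb2 := phi_le p σ (-τ) t hp hσ (by rwa [abs_neg])
  have hn1 := phi_nonneg p σ τ t
  have hn2 := phi_nonneg p σ (-τ) t
  have hsp : 0 < σ^p := by positivity
  have hsp1 : 0 < (σ+1)^p := by positivity
  rcases le_total t t0 with htt | htt
  · obtain ⟨e1, h1, b1⟩ := small τ hτ htt
    obtain ⟨e2, h2, b2⟩ := small (-τ) (by rwa [abs_neg]) htt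
    have ht1 : t^2 ≤ 1 := by nlinarith
    have hMM : 0 ≤ M/t0^2 := by positivity
    have b1' := abs_le.1 b1
    have b2' := abs_le.1 b2
    have hτ' := abs_le.1 hτ
    have t2 : 0 ≤ t^2 := by positivity
    have q1 : 0 ≤ d * t^2 := by positivity
    have q2 : 0 ≤ K * t^2 := by positivity
    have q3 : 0 ≤ M/t0^2 * t^2 := by positivity
    have q4 : 0 ≤ d * t := by positivity
    have q5 : 0 ≤ K * t := by positivity
    have q6 : 0 ≤ M/t0^2 * t := by positivity
    constructor
    · have g1 : 2*σ^p - phi p σ τ t - phi p σ (-τ) t = 2*(d*t^2) - e1 - e2 := by rw [h1, h2]; ring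
      have g2 : (2*d + 18*K + 3*d + 9*K + M/t0^2) * t^2 = 5*(d*t^2) + 27*(K*t^2) + M/t0^2*t^2 := by ring
      have g3 : 9*K*t^2 = 9*(K*t^2) := by ring
      rw [g3] at b1' b2'
      rw [min_eq_left ht1, g1, g2, abs_le]
      constructor <;> linarith [b1'.1, b1'.2, b2'.1, b2'.2]
    · have g1 : σ^p - phi p σ τ t = 2*(d*(τ*t)) + d*t^2 - e1 := by rw [h1]; ring
      have g2 : (2*d + 18*K + 3*d + 9*K + M/t0^2) * t = 5*(d*t) + 27*(K*t) + M/t0^2*t := by ring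
      have g3 : 9*K*t^2 = 9*(K*t^2) := by ring
      rw [g3] at b1'
      rw [g1, g2, abs_le]
      have t3 : t^2 ≤ t := by nlinarith
      have q7 : K*t^2 ≤ K*t := by gcongr
      have q8 : d*t^2 ≤ d*t := by gcongr
      have q9 : |d*(τ*t)| ≤ d*t := by
        rw [abs_mul, abs_of_pos hdpos, abs_mul, abs_of_pos ht]
        have : |τ| * t ≤ 1 * t := by gcongr
        rw [one_mul] at this
        gcongr
      have q9' := abs_le.1 q9
      constructor <;> linarith [b1'.1, b1'.2, q9'.1, q9'.2]
  · have hr1 : t0^2 ≤ min (t^2) 1 := le_min (by gcongr) (by nlinarith)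
    have hr2 : t0^2 ≤ t := by nlinarith
    have hMM : 0 ≤ 2*d + 18*K + 3*d + 9*K := by positivity
    have key : ∀ y, t0^2 ≤ y → M ≤ (2*d + 18*K + 3*d + 9*K + M/t0^2) * y := by
      intro y hy
      have h1 : M/t0^2 * t0^2 = M := by field_simp
      have h2 : M/t0^2 * t0^2 ≤ M/t0^2 * y := by gcongr
      have h3 : 0 ≤ (2*d + 18*K + 3*d + 9*K) * y := mul_nonneg hMM (by nlinarith [sq_nonneg t0])
      nlinarith
    constructor
    · refine le_trans ?_ (key _ hr1)
      rw [abs_le]; constructor <;> linarith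
    · refine le_trans ?_ (key _ hr2)
      rw [abs_le]; constructor <;> linarith

lemma phi_cont (p σ τ : ℝ) (hp : 0 < p) : Continuous (phi p σ τ) := by
  unfold phi
  exact Continuous.rpow_const (by fun_prop) (fun _ => Or.inr hp.le)

lemma int_min (s : ℝ) (hs : s ∈ Ioo (0:ℝ) 1) : IntegrableOn (fun t : ℝ => min (t^2) 1 * t^(-1-2*s)) (Ioi 0) := by
  have : Ioi (0:ℝ) = Ioc 0 1 ∪ Ioi 1 := (Ioc_union_Ioi_eq_Ioi zero_le_one).symm
  rw [this]
  apply IntegrableOn.union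
  · have h := (intervalIntegral.intervalIntegrable_rpow' (a := 0) (b := 1) (r := 1-2*s) (by linarith [hs.2]))
    rw [intervalIntegrable_iff_integrableOn_Ioc_of_le zero_le_one] at h
    refine h.congr_fun ?_ measurableSet_Ioc
    intro t ht
    simp only
    rw [min_eq_left (by nlinarith [ht.1, ht.2]), ← Real.rpow_natCast, ← Real.rpow_add ht.1]
    congr 1; push_cast; ring
  · have h := integrableOn_Ioi_rpow_of_lt (a := -1-2*s) (c := 1) (by linarith [hs.1]) one_pos
    refine h.congr_fun ?_ measurableSet_Ioi
    intro t ht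
    have ht' : (1:ℝ) < t := ht
    simp only
    rw [min_eq_right (by nlinarith), one_mul]

/-- substitution for one branch -/
lemma subst1 (s : ℝ) (hs : s ∈ Ioo (0:ℝ) 1) (m : ℕ) (σ τ : ℝ) (hσ : 0 < σ) (V : ℝ) (hV : √(τ^2+σ) < V) :
    IntegrableOn (fun t => phi (s+m) σ τ t * t^(-1-2*s)) (Ioi (σ/(V+τ))) ∧ 
    ∫ t in Ioi (σ/(V+τ)), phi (s+m) σ τ t * t^(-1-2*s) = 
      ∫ v in (√(τ^2+σ))..V, ((v^2-τ^2)/σ - 1)^(s+m) * ((σ/(v+τ))^(2*m+1)/σ) := by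
  set c := √(τ^2+σ) with hc
  have hc2 : c^2 = τ^2+σ := Real.sq_sqrt (by positivity)
  have hcpos : 0 < c := Real.sqrt_pos.2 (by positivity)
  have hcτ : |τ| < c := by
    apply abs_lt_of_sq_lt_sq _ hcpos.le
    rw [hc2]; linarith
  have hcτ1 := (abs_lt.1 hcτ).1
  have hcτ2 := (abs_lt.1 hcτ).2
  set g : ℝ → ℝ := fun t => phi (s+m) σ τ t * t^(-1-2*s) with hg
  have hp : 0 < s + m := by have := hs.1; positivity
  have hδ : 0 < σ/(V+τ) := by apply div_pos hσ; linarith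
  have hδc : σ/(V+τ) < c - τ := by
    rw [div_lt_iff₀ (by linarith)]
    nlinarith
  have gcont : ContinuousOn g (Ioi 0) := by
    apply ContinuousOn.mul (phi_cont _ _ _ hp).continuousOn
    intro t ht
    exact (Real.continuousAt_rpow_const _ _ (Or.inl (ne_of_gt ht))).continuousWithinAt
  have gz : ∀ t ∈ Ioi (c-τ), g t = 0 := by
    intro t ht
    have ht' : c - τ < t := ht
    simp only [hg, phi]
    rw [max_eq_right (by nlinarith), Real.zero_rpow hp.ne', zero_mul]
  have hI1 : IntegrableOn g (Ioc (σ/(V+τ)) (c-τ)) := by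
    have : IntegrableOn g (Icc (σ/(V+τ)) (c-τ)) := 
      (gcont.mono (fun t ht => lt_of_lt_of_le hδ ht.1)).integrableOn_Icc
    exact this.mono_set Ioc_subset_Icc_self
  have hI2 : IntegrableOn g (Ioi (c-τ)) := 
    integrableOn_zero.congr_fun (fun t ht => (gz t ht).symm) measurableSet_Ioi
  have hU : Ioi (σ/(V+τ)) = Ioc (σ/(V+τ)) (c-τ) ∪ Ioi (c-τ) := (Ioc_union_Ioi_eq_Ioi hδc.le).symm
  refine ⟨by rw [hU]; exact hI1.union hI2, ?_⟩
  rw [hU, setIntegral_union (Ioc_disjoint_Ioi le_rfl) measurableSet_Ioi hI1 hI2, setIntegral_congr_fun measurableSet_Ioi gz]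
  simp only [integral_zero, add_zero]
  rw [← intervalIntegral.integral_of_le hδc.le, intervalIntegral.integral_symm]
  have key := intervalIntegral.integral_comp_mul_deriv' (a := c) (b := V) (f := fun v => σ/(v+τ)) (f' := fun v => -σ/(v+τ)^2) (g := g) ?_ ?_ ?_
  · have : σ/(c+τ) = c - τ := by
      rw [div_eq_iff (by linarith)]; nlinarith
    simp only [this] at key
    rw [← key, ← intervalIntegral.integral_neg]
    apply intervalIntegral.integral_congr
    intro v hv
    rw [uIcc_of_le hV.le] at hv
    have hv1 : 0 < v + τ := by linarith [hv.1]
    have hq : 0 ≤ (v^2-τ^2)/σ - 1 := by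
      rw [sub_nonneg, le_div_iff₀ hσ]; nlinarith [hv.1]
    simp only [Function.comp, hg, phi]
    set t := σ/(v+τ) with ht
    have htp : 0 < t := by positivity
    have e : σ - 2*τ*t - t^2 = t^2 * ((v^2-τ^2)/σ - 1) := by
      rw [ht]; field_simp; ring
    rw [e, max_eq_left (by positivity), Real.mul_rpow (by positivity) hq]
    have e2 : -σ/(v+τ)^2 = -(t^2/σ) := by rw [ht]; field_simp
    rw [e2]
    have e3 : (t^2)^(s+m) * t^(-1-2*s) * t^2 = t^(2*m+1) := by
      rw [← Real.rpow_natCast t 2, ← Real.rpow_mul htp.le, ← Real.rpow_add htp, ← Real.rpow_add htp, ← Real.rpow_natCast]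
      congr 1; push_cast; ring
    rw [← e3]; ring
  · intro v hv
    rw [uIcc_of_le hV.le] at hv
    have hv1 : v + τ ≠ 0 := by linarith [hv.1]
    have := ((hasDerivAt_const v σ)).div ((hasDerivAt_id v).add_const τ) hv1
    refine this.congr_deriv ?_
    simp
  · apply ContinuousOn.div continuousOn_const (by fun_prop)
    intro v hv
    rw [uIcc_of_le hV.le] at hv
    have hv1 : v + τ ≠ 0 := by linarith [hv.1]
    positivity
  · apply gcont.mono
    rintro _ ⟨v, hv, rfl⟩
    rw [uIcc_of_le hV.le] at hv
    have hv1 : 0 < v + τ := by linarith [hv.1]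
    exact div_pos hσ hv1

/-- sum over both branches -/
lemma subst2 (s : ℝ) (hs : s ∈ Ioo (0:ℝ) 1) (m : ℕ) (σ τ : ℝ) (hσ : 0 < σ) (V : ℝ) (hV : √(τ^2+σ) < V) :
    (∫ t in Ioi (σ/(V+τ)), phi (s+m) σ τ t * t^(-1-2*s)) + (∫ t in Ioi (σ/(V-τ)), phi (s+m) σ (-τ) t * t^(-1-2*s))
     = ∑ l ∈ Finset.range (m+1), ((m+l).choose (2*l) : ℝ) * 4^l * σ^(m-l) * τ^(2*l) * ∫ q in (0:ℝ)..((V^2-τ^2)/σ - 1), q^(s+m) * ((1+q)^(m+1+l))⁻¹ := by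
  have h1 := (subst1 s hs m σ τ hσ V hV).2
  have h2 := (subst1 s hs m σ (-τ) hσ V (by simpa using hV)).2
  simp only [even_two, Even.neg_pow, ← sub_eq_add_neg] at h2
  rw [h1, h2]
  set c := √(τ^2+σ) with hc
  have hc2 : c^2 = τ^2+σ := Real.sq_sqrt (by positivity)
  have hcpos : 0 < c := Real.sqrt_pos.2 (by positivity)
  have hcτ : |τ| < c := by
    apply abs_lt_of_sq_lt_sq _ hcpos.le
    rw [hc2]; linarith
  have hcτ1 := (abs_lt.1 hcτ).1
  have hcτ2 := (abs_lt.1 hcτ).2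
  have hp : 0 < s + m := by have := hs.1; positivity
  have qnn : ∀ v ∈ Icc c V, 0 ≤ (v^2-τ^2)/σ - 1 := by
    intro v hv
    rw [sub_nonneg, le_div_iff₀ hσ]; nlinarith [hv.1]
  have cont1 : ∀ τ', |τ'| < c → ContinuousOn (fun v => ((v^2-τ^2)/σ - 1)^(s+m) * ((σ/(v+τ'))^(2*m+1)/σ)) (uIcc c V) := by
    intro τ' h
    rw [uIcc_of_le hV.le]
    apply ContinuousOn.mul
    · apply ContinuousOn.rpow_const (by fun_prop)
      intro v _; exact Or.inr hp.le
    · apply ContinuousOn.div_const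
      apply ContinuousOn.pow
      apply ContinuousOn.div continuousOn_const (by fun_prop)
      intro v hv
      have := (abs_lt.1 h).1
      linarith [hv.1]
  rw [← intervalIntegral.integral_add (cont1 τ hcτ).intervalIntegrable]
  swap
  · have := (cont1 (-τ) (by rwa [abs_neg])).intervalIntegrable (μ := volume)
    simpa only [← sub_eq_add_neg] using this
  have hI : ∀ l : ℕ, ∀ Q : ℝ, 0 ≤ Q → ContinuousOn (fun q:ℝ => q^(s+m) * ((1+q)^(m+1+l))⁻¹) (Icc 0 Q) := by
    intro l Q _
    apply ContinuousOn.mul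
    · exact ContinuousOn.rpow_const continuousOn_id (fun _ _ => Or.inr hp.le)
    · apply ContinuousOn.inv₀ (by fun_prop)
      intro q hq
      have : 0 < 1 + q := by linarith [hq.1]
      positivity
  have hQ0 : 0 ≤ (V^2-τ^2)/σ - 1 := qnn V ⟨hV.le, le_rfl⟩
  simp_rw [← intervalIntegral.integral_const_mul]
  rw [← intervalIntegral.integral_finsetSum]
  swap
  · intro l _
    apply IntervalIntegrable.const_mul
    apply ContinuousOn.intervalIntegrable
    rw [uIcc_of_le hQ0]
    exact hI l _ hQ0
  have key := intervalIntegral.integral_comp_mul_deriv' (a := c) (b := V) (f := fun v => (v^2-τ^2)/σ - 1) (f' := fun v => 2*v/σ) 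
     (g := fun q => ∑ l ∈ Finset.range (m+1), ((m+l).choose (2*l) : ℝ) * 4^l * σ^(m-l) * τ^(2*l) * (q^(s+m) * ((1+q)^(m+1+l))⁻¹)) ?_ ?_ ?_
  · have e0 : (c^2-τ^2)/σ - 1 = 0 := by rw [hc2]; field_simp; ring
    simp only [e0] at key
    rw [← key]
    apply intervalIntegral.integral_congr
    intro v hv
    rw [uIcc_of_le hV.le] at hv
    have hv1 : 0 < v + τ := by linarith [hv.1]
    have hv2 : 0 < v - τ := by linarith [hv.1]
    simp only [Function.comp]
    set q := (v^2-τ^2)/σ - 1 with hq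
    have hqn : 0 ≤ q := qnn v hv
    have hvq : v^2 - τ^2 = σ*(1+q) := by rw [hq]; field_simp; ring
    have h1q : 0 < 1 + q := by linarith
    have e1 : (σ/(v+τ))^(2*m+1)/σ + (σ/(v-τ))^(2*m+1)/σ = ((v+τ)^(2*m+1) + (v-τ)^(2*m+1)) / ((1+q)^(2*m+1) * σ) := by
      have a1 : σ/(v+τ) = (v-τ)/(1+q) := by
        rw [div_eq_div_iff hv1.ne' h1q.ne']; linarith [hvq]
      have a2 : σ/(v-τ) = (v+τ)/(1+q) := by
        rw [div_eq_div_iff hv2.ne' h1q.ne']; linarith [hvq]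
      rw [a1, a2, div_pow, div_pow]
      field_simp
      ring
    rw [← mul_add, e1, oddpow m v τ hv2 hv1, hvq, Finset.mul_sum, Finset.sum_mul, Finset.sum_div, Finset.mul_sum]
    apply Finset.sum_congr rfl
    intro l hl
    have hl' : l ≤ m := by simpa [Nat.lt_succ_iff] using hl
    obtain ⟨N, rfl⟩ := Nat.exists_eq_add_of_le hl'
    rw [Nat.add_sub_cancel_left, mul_pow]
    have e2 : (1+q)^(2*(l+N)+1) = (1+q)^N * (1+q)^(l+N+1+l) := by rw [← pow_add]; congr 1; ring
    rw [e2]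
    field_simp
  · intro v hv
    have := (((hasDerivAt_pow 2 v).sub_const (τ^2)).div_const σ).sub_const 1
    refine this.congr_deriv ?_
    simp
  · fun_prop
  · have : (fun v => (v^2-τ^2)/σ - 1) '' (uIcc c V) ⊆ Icc 0 ((V^2-τ^2)/σ - 1) := by
      rintro _ ⟨v, hv, rfl⟩
      rw [uIcc_of_le hV.le] at hv
      refine ⟨qnn v hv, ?_⟩
      simp only
      have : v^2 ≤ V^2 := by nlinarith [hv.1, hv.2]
      gcongr
    refine ContinuousOn.mono ?_ this
    apply continuousOn_finsetSum
    intro l _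
    exact continuousOn_const.mul (hI l _ hQ0)


lemma zeroLim (s : ℝ) (hs : s ∈ Ioo (0:ℝ) 1) (m : ℕ) :
    Tendsto (fun Q : ℝ => Q^s/s - ∫ q in (0:ℝ)..Q, q^(s+m) * ((1+q)^(m+1))⁻¹) atTop
      (𝓝 (Gamma (s+m+1) * Gamma (1-s) / (s * m.factorial))) := by
  have hs0 := hs.1
  have hs1 := hs.2
  have hb := betaLim (s+m) (1-s) (m+2) (by positivity) (by linarith) (by push_cast; ring)
  have hF : ∀ Q : ℝ, 0 ≤ Q → s * (∫ q in (0:ℝ)..Q, q^(s+m) * ((1+q)^(m+1))⁻¹) = Q^(s+m+1) * ((1+Q)^(m+1))⁻¹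
      - (m+1) * ∫ q in (0:ℝ)..Q, q^(s+m) * ((1+q)^(m+2))⁻¹ := by
    intro Q hQ
    have hI : ∀ l : ℕ, IntervalIntegrable (fun q:ℝ => q^(s+m) * ((1+q)^l)⁻¹) volume 0 Q := by
      intro l
      apply ContinuousOn.intervalIntegrable
      rw [uIcc_of_le hQ]
      apply ContinuousOn.mul
      · exact ContinuousOn.rpow_const continuousOn_id (fun _ _ => Or.inr (by positivity))
      · apply ContinuousOn.inv₀ (by fun_prop)
        intro q hq
        have : 0 < 1 + q := by linarith [hq.1]
        positivity
    have h := intervalIntegral.integral_eq_sub_of_hasDerivAt (a := 0) (b := Q)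
      (f := fun q : ℝ => q^(s+m+1) * ((1+q)^(m+1))⁻¹)
      (f' := fun q : ℝ => s * (q^(s+m) * ((1+q)^(m+1))⁻¹) + (m+1) * (q^(s+m) * ((1+q)^(m+2))⁻¹)) ?_
      (((hI _).const_mul _).add ((hI _).const_mul _))
    · rw [intervalIntegral.integral_add ((hI _).const_mul _) ((hI _).const_mul _),
        intervalIntegral.integral_const_mul, intervalIntegral.integral_const_mul] at h
      rw [Real.zero_rpow (by positivity), zero_mul, sub_zero] at h
      linarith
    · intro q hq
      rw [uIcc_of_le hQ] at hq
      have hq1 : 0 < 1 + q := by linarith [hq.1]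
      have d1 : HasDerivAt (fun q : ℝ => q^(s+m+1)) ((s+m+1)*q^(s+m+1-1)) q :=
        Real.hasDerivAt_rpow_const (Or.inr (by have : (0:ℝ) ≤ m := by positivity
                                               linarith))
      have d2 : HasDerivAt (fun q : ℝ => (1+q)^(m+1)) ((m+1:ℕ)*(1+q)^m) q := by
        have := ((hasDerivAt_id q).const_add 1).fun_pow (m+1)
        refine this.congr_deriv ?_
        simp
      have d3 := d1.mul (d2.inv (by positivity))
      refine d3.congr_deriv ?_
      have e : q^(s+m+1) = q^(s+m)*q := Real.rpow_add_one' hq.1 (by positivity)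
      have e' : s+m+1-1 = s+m := by ring
      simp only [Pi.inv_apply]
      rw [e, e']
      push_cast
      field_simp
      ring
  have hE : Tendsto (fun Q : ℝ => Q^s - Q^(s+m+1) * ((1+Q)^(m+1))⁻¹) atTop (𝓝 0) := by
    have hz : Tendsto (fun Q : ℝ => (m+1) * Q^(-(1-s))) atTop (𝓝 0) := by
      simpa using (tendsto_rpow_neg_atTop (by linarith : 0 < 1-s)).const_mul ((m:ℝ)+1)
    apply squeeze_zero_norm' _ hz
    filter_upwards [eventually_gt_atTop 0] with Q hQ
    have e1 : Q^(s+m+1) * ((1+Q)^(m+1))⁻¹ = Q^s * (1 + -1/(1+Q))^(m+1) := by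
      have : 1 + -1/(1+Q) = Q/(1+Q) := by field_simp; ring
      rw [this, div_pow, add_assoc, Real.rpow_add hQ]
      have : (Q:ℝ)^((m:ℝ)+1) = Q^(m+1) := by exact_mod_cast Real.rpow_natCast Q (m+1)
      rw [this]; ring
    have b1 := one_add_mul_le_pow (a := -1/(1+Q)) (by
      rw [le_div_iff₀ (by positivity)]; linarith) (m+1)
    have b2 : (1 + -1/(1+Q))^(m+1) ≤ 1 := by
      have : 1 + -1/(1+Q) = Q/(1+Q) := by field_simp; ring
      rw [this]
      apply pow_le_one₀ (by positivity)
      rw [div_le_one (by positivity)]; linarith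
    have e2 : Q^(-(1-s)) = Q^s/Q := by
      rw [neg_sub, Real.rpow_sub_one hQ.ne']
    have hQs : 0 < Q^s := by positivity
    rw [e1, e2, norm_eq_abs, abs_of_nonneg (by nlinarith)]
    have : Q^s - Q^s * (1 + -1/(1+Q))^(m+1) ≤ Q^s * ((m+1)/(1+Q)) := by
      have : 1 - (1 + -1/(1+Q))^(m+1) ≤ (m+1)/(1+Q) := by
        have : (((m+1:ℕ):ℝ)) * (-1/(1+Q)) = -((m+1)/(1+Q)) := by push_cast; ring
        rw [this] at b1; linarith
      calc _ = Q^s * (1 - (1 + -1/(1+Q))^(m+1)) := by ring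
        _ ≤ _ := by gcongr
    refine this.trans ?_
    have : ((m:ℝ)+1)/(1+Q) ≤ (m+1)/Q := by gcongr; linarith
    calc _ ≤ Q^s * ((m+1)/Q) := by gcongr
      _ = _ := by ring
  have := (hE.div_const s).add (hb.const_mul (((m:ℝ)+1)/s))
  have e : 0/s + ((m:ℝ)+1)/s * (Gamma (s+m+1) * Gamma (1-s) / Gamma (s+m+1+(1-s))) = Gamma (s+m+1) * Gamma (1-s) / (s * m.factorial) := by
    have : s + m + 1 + (1-s) = ((m+1:ℕ):ℝ)+1 := by push_cast; ring
    rw [this, Real.Gamma_nat_eq_factorial, Nat.factorial_succ]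
    have : (m.factorial : ℝ) ≠ 0 := by positivity
    push_cast
    field_simp
    ring
  rw [e] at this
  refine this.congr' ?_
  filter_upwards [eventually_ge_atTop 0] with Q hQ
  have := hF Q hQ
  generalize (∫ q in (0:ℝ)..Q, q^(s+m) * ((1+q)^(m+1))⁻¹) = I1 at this ⊢
  generalize (∫ q in (0:ℝ)..Q, q^(s+m) * ((1+q)^(m+2))⁻¹) = I2 at this ⊢
  have e : I1 = s*I1/s := by field_simp
  rw [e, this]
  ring

lemma powdiff (s a : ℝ) (hs : s < 1) : Tendsto (fun y : ℝ => (y+a)^s - y^s) atTop (𝓝 0) := by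
  obtain ⟨K, hK, r, hr, hT⟩ := taylor2 1 s one_pos
  have hz : Tendsto (fun y : ℝ => |s*a| * y^(-(1-s)) + K*a^2*y^(-(2-s))) atTop (𝓝 0) := by
    simpa using ((tendsto_rpow_neg_atTop (by linarith : 0 < 1-s)).const_mul |s*a|).add 
      ((tendsto_rpow_neg_atTop (by linarith : 0 < 2-s)).const_mul (K*a^2))
  apply squeeze_zero_norm' _ hz
  filter_upwards [eventually_gt_atTop 0, eventually_ge_atTop (|a|/r), eventually_ge_atTop (2*|a|)] with y h0 h1 h2
  have h3 : |a/y| ≤ r := by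
    rw [abs_div, abs_of_pos h0, div_le_iff₀ h0]; rw [div_le_iff₀ hr] at h1; linarith
  have ha := neg_abs_le a
  have haa := abs_nonneg a
  have h4 := hT (1+a/y) (by simpa using h3)
  simp only [Real.one_rpow, mul_one, add_sub_cancel_left] at h4
  have h5 : (y+a)^s = y^s * (1+a/y)^s := by
    rw [← Real.mul_rpow h0.le]
    · congr 1; field_simp
    · have : 1 + a/y = (y+a)/y := by field_simp
      rw [this]; apply div_nonneg _ h0.le; linarith
  have e1 : y^(-(1-s)) = y^s/y := by rw [neg_sub, Real.rpow_sub_one h0.ne']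
  have e2 : y^(-(2-s)) = y^s/y^2 := by
    rw [neg_sub, Real.rpow_sub h0]; norm_num
  rw [h5, norm_eq_abs, e1, e2]
  have : y^s * (1+a/y)^s - y^s = y^s * (s*a/y + ((1+a/y)^s - 1 - s*(a/y))) := by ring
  rw [this, abs_mul, abs_of_pos (by positivity : 0 < y^s)]
  calc _ ≤ y^s * (|s*a/y| + K*(a/y)^2) := by gcongr; exact (abs_add_le _ _).trans (by gcongr)
    _ = _ := by rw [abs_div, abs_of_pos h0]; ring

lemma powdiff2 (p a : ℝ) (hs : p < 2) : Tendsto (fun y : ℝ => (y+a)^p + (y-a)^p - 2*y^p) atTop (𝓝 0) := by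
  obtain ⟨K, hK, r, hr, hT⟩ := taylor2 1 p one_pos
  have hz : Tendsto (fun y : ℝ => 2*K*a^2*y^(-(2-p))) atTop (𝓝 0) := by
    simpa using ((tendsto_rpow_neg_atTop (by linarith : 0 < 2-p)).const_mul (2*K*a^2))
  apply squeeze_zero_norm' _ hz
  filter_upwards [eventually_gt_atTop 0, eventually_ge_atTop (|a|/r), eventually_ge_atTop (2*|a|)] with y h0 h1 h2
  have haa := abs_nonneg a
  have key : ∀ b, |b| = |a| → (y+b)^p = y^p * (1+b/y)^p ∧ |(1+b/y)^p - 1 - p*(b/y)| ≤ K*(b/y)^2 := by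
    intro b hb
    rw [← hb] at h1 h2
    have h3 : |b/y| ≤ r := by
      rw [abs_div, abs_of_pos h0, div_le_iff₀ h0]; rw [div_le_iff₀ hr] at h1; linarith
    have ha := neg_abs_le b
    have hbb := abs_nonneg b
    have h4 := hT (1+b/y) (by simpa using h3)
    simp only [Real.one_rpow, mul_one, add_sub_cancel_left] at h4
    refine ⟨?_, h4⟩
    rw [← Real.mul_rpow h0.le]
    · congr 1; field_simp
    · have : 1 + b/y = (y+b)/y := by field_simp
      rw [this]; apply div_nonneg _ h0.le; linarith
  obtain ⟨k1, k2⟩ := key a rfl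
  obtain ⟨k3, k4⟩ := key (-a) (abs_neg a)
  have e2 : y^(-(2-p)) = y^p/y^2 := by
    rw [neg_sub, Real.rpow_sub h0]; norm_num
  rw [sub_eq_add_neg y a, k1, k3, norm_eq_abs, e2]
  have : y^p * (1+a/y)^p + y^p * (1+ -a/y)^p - 2*y^p = y^p * (((1+a/y)^p - 1 - p*(a/y)) + ((1+ -a/y)^p - 1 - p*(-a/y))) := by ring
  rw [this, abs_mul, abs_of_pos (by positivity : 0 < y^p)]
  calc _ ≤ y^p * (K*(a/y)^2 + K*(-a/y)^2) := by gcongr; exact (abs_add_le _ _).trans (by gcongr)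
    _ = _ := by ring

lemma mainTerm (s : ℝ) (hs : s ∈ Ioo (0:ℝ) 1) (m : ℕ) (σ τ : ℝ) (hσ : 0 < σ) :
   Tendsto (fun V : ℝ => σ^(s+m)*((σ/(V+τ))^(-2*s)+(σ/(V-τ))^(-2*s))/(2*s) - σ^m * (((V^2-τ^2)/σ-1)^s/s)) atTop (𝓝 0) := by
  have hs0 := hs.1
  have h1 := (powdiff2 (2*s) τ (by linarith [hs.2])).const_mul (σ^(m-s)/(2*s))
  have h2 := ((powdiff s (-(τ^2+σ)) hs.2).comp (tendsto_pow_atTop two_ne_zero)).const_mul (σ^(m-s)/s)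
  have h := h1.sub h2
  simp only [mul_zero, sub_zero] at h
  refine h.congr' ?_
  filter_upwards [eventually_gt_atTop (|τ|), eventually_gt_atTop (√(τ^2+σ))] with V hV hV2
  have hV' := abs_lt.1 hV
  have v0 : 0 < V := lt_of_le_of_lt (abs_nonneg _) hV
  have v1 : 0 < V + τ := by linarith
  have v2 : 0 < V - τ := by linarith
  have v3 : τ^2+σ < V^2 := by
    have := Real.sq_sqrt (by positivity : 0 ≤ τ^2+σ)
    have := Real.sqrt_nonneg (τ^2+σ)
    nlinarith
  have e1 : ∀ y, 0 < y → σ^(s+m) * (σ/y)^(-2*s) = σ^(m-s) * y^(2*s) := by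
    intro y hy
    rw [Real.div_rpow hσ.le hy.le, neg_mul, Real.rpow_neg hy.le, div_inv_eq_mul, ← mul_assoc, ← Real.rpow_add hσ]
    congr 2; ring
  have e2 : σ^m * (((V^2-τ^2)/σ-1)^s/s) = σ^(m-s) * (V^2 + -(τ^2+σ))^s/s := by
    have : (V^2-τ^2)/σ-1 = (V^2 + -(τ^2+σ))/σ := by field_simp; ring
    rw [this, Real.div_rpow (by linarith) hσ.le, Real.rpow_sub hσ, Real.rpow_natCast]
    ring
  have e3 : (V^2)^s = V^(2*s) := by rw [← Real.rpow_natCast V 2, ← Real.rpow_mul v0.le]; norm_num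
  rw [mul_add, e1 _ v1, e1 _ v2, e2]
  simp only [Function.comp]
  rw [e3]
  field_simp
  ring

lemma edge (s : ℝ) (hs : s ∈ Ioo (0:ℝ) 1) (p σ τ : ℝ) (hp : 0 < p) (hσ : 0 < σ) (hτ : |τ| ≤ 1) :
   Tendsto (fun V : ℝ => ∫ t in (σ/(V+τ))..(σ/V), (σ^p - phi p σ τ t) * t^(-1-2*s)) atTop (𝓝 0) := by
  obtain ⟨C, hC, hb⟩ := diff_bounds p σ hp hσ
  have hs0 := hs.1
  have hz : Tendsto (fun V : ℝ => C * (σ/2)^(-2*s) * (2*σ) * V^(-(2-2*s))) atTop (𝓝 0) := by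
    simpa using (tendsto_rpow_neg_atTop (by linarith [hs.2] : 0 < 2-2*s)).const_mul (C * (σ/2)^(-2*s) * (2*σ))
  apply squeeze_zero_norm' _ hz
  filter_upwards [eventually_ge_atTop 2] with V hV
  have hτ' := abs_le.1 hτ
  have v0 : 0 < V := by linarith
  have v1 : 0 < V + τ := by linarith
  have hm : σ/2/V ≤ min (σ/(V+τ)) (σ/V) := by
    apply le_min
    · rw [div_div]; gcongr; linarith
    · gcongr; linarith
  have h1 : ∀ t ∈ uIoc (σ/(V+τ)) (σ/V), ‖(σ^p - phi p σ τ t) * t^(-1-2*s)‖ ≤ C * (σ/2/V)^(-2*s) := by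
    intro t ht
    have ht1 : σ/2/V < t := lt_of_le_of_lt hm ht.1
    have hc : 0 < σ/2/V := by positivity
    have ht0 : 0 < t := hc.trans ht1
    rw [norm_mul, norm_eq_abs, norm_eq_abs, abs_of_pos (by positivity : 0 < t^(-1-2*s))]
    calc _ ≤ C * t * t^(-1-2*s) := by gcongr; exact (hb τ hτ t ht0).2
      _ = C * t^(-2*s) := by
        have : t^(-2*s) = t^(1:ℝ) * t^(-1-2*s) := by rw [← Real.rpow_add ht0]; congr 1; ring
        rw [this, Real.rpow_one]; ring
      _ ≤ _ := by
        have := Real.rpow_le_rpow_of_nonpos hc ht1.le (by linarith : -2*s ≤ 0)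
        gcongr
  refine (intervalIntegral.norm_integral_le_of_norm_le_const h1).trans ?_
  have h2 : |σ/V - σ/(V+τ)| ≤ 2*σ/V^2 := by
    have : σ/V - σ/(V+τ) = σ*τ/(V*(V+τ)) := by field_simp; ring
    rw [this, abs_div, abs_mul, abs_of_pos hσ, abs_of_pos (by positivity : 0 < V*(V+τ)), div_le_div_iff₀ (by positivity) (by positivity)]
    have : σ * |τ| ≤ σ * 1 := by gcongr
    calc σ * |τ| * V^2 ≤ σ * 1 * V^2 := by gcongr
      _ ≤ _ := by
        have : V^2 ≤ 2*(V*(V+τ)) := by nlinarith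
        nlinarith
  calc _ ≤ C * (σ/2/V)^(-2*s) * (2*σ/V^2) := by gcongr
    _ = _ := by
      rw [Real.div_rpow (by positivity) v0.le, neg_sub, Real.rpow_sub v0, neg_mul, Real.rpow_neg v0.le, div_inv_eq_mul]
      norm_num
      ring

lemma line_int (s : ℝ) (hs : s ∈ Ioo (0:ℝ) 1) (p σ τ : ℝ) (hp : 0 < p) (hσ : 0 < σ) (hτ : |τ| ≤ 1) :
    IntegrableOn (fun t => (2*σ^p - phi p σ τ t - phi p σ (-τ) t) * t^(-1-2*s)) (Ioi 0) := by
  obtain ⟨C, hC, hb⟩ := diff_bounds p σ hp hσ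
  refine ((int_min s hs).const_mul C).mono' ?_ ?_
  · apply ContinuousOn.aestronglyMeasurable _ measurableSet_Ioi
    apply ContinuousOn.mul
    · exact ((continuous_const.sub (phi_cont _ _ _ hp)).sub (phi_cont _ _ _ hp)).continuousOn
    · intro t ht
      exact (Real.continuousAt_rpow_const _ _ (Or.inl (ne_of_gt ht))).continuousWithinAt
  · filter_upwards [ae_restrict_mem measurableSet_Ioi] with t ht
    have ht' : 0 < t := ht
    rw [norm_mul, norm_eq_abs, norm_eq_abs, abs_of_pos (by positivity : 0 < t^(-1-2*s)), ← mul_assoc]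
    gcongr
    exact (hb τ hτ t ht').1

lemma branch_int (s : ℝ) (hs : s ∈ Ioo (0:ℝ) 1) (p σ τ : ℝ) (hp : 0 < p) (hσ : 0 < σ) (hτ : |τ| ≤ 1) (a : ℝ) (ha : 0 < a) :
    IntegrableOn (fun t => (σ^p - phi p σ τ t) * t^(-1-2*s)) (Ioi a) := by
  have h := integrableOn_Ioi_rpow_of_lt (a := -1-2*s) (c := a) (by linarith [hs.1]) ha
  refine (h.const_mul (σ^p + (σ+1)^p)).mono' ?_ ?_
  · apply ContinuousOn.aestronglyMeasurable _ measurableSet_Ioi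
    apply ContinuousOn.mul
    · exact (continuous_const.sub (phi_cont _ _ _ hp)).continuousOn
    · intro t ht
      exact (Real.continuousAt_rpow_const _ _ (Or.inl (ne_of_gt (ha.trans ht)))).continuousWithinAt
  · filter_upwards [ae_restrict_mem measurableSet_Ioi] with t ht
    have ht' : 0 < t := ha.trans ht
    rw [norm_mul, norm_eq_abs, norm_eq_abs, abs_of_pos (by positivity : 0 < t^(-1-2*s))]
    gcongr
    have h1 := phi_le p σ τ t hp hσ hτ
    have h2 := phi_nonneg p σ τ t
    have h3 : 0 ≤ σ^p := by positivity
    have h4 : 0 ≤ (σ+1)^p := by positivity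
    rw [abs_le]; constructor <;> linarith

lemma line_value (s : ℝ) (hs : s ∈ Ioo (0:ℝ) 1) (m : ℕ) (σ τ : ℝ) (hσ : 0 < σ) (hτ : |τ| ≤ 1) :
    ∫ t in Ioi 0, (2*σ^(s+m) - phi (s+m) σ τ t - phi (s+m) σ (-τ) t) * t^(-1-2*s) = 
     -∑ l ∈ Finset.range (m+1), ((m+l).choose (2*l) : ℝ) * 4^l * σ^(m-l) * τ^(2*l) * (Gamma (s+m+1) * Gamma (l-s) / Gamma (m+l+1)) := by
  have hs0 := hs.1
  have hp : 0 < s + m := by positivity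
  have hτn : |(-τ)| ≤ 1 := by rwa [abs_neg]
  set D : ℝ → ℝ := fun t => (2*σ^(s+m) - phi (s+m) σ τ t - phi (s+m) σ (-τ) t) * t^(-1-2*s) with hD
  have hDi : IntegrableOn D (Ioi 0) := line_int s hs (s+m) σ τ hp hσ hτ
  have hlim1 : Tendsto (fun V : ℝ => ∫ t in Ioi (σ/V), D t) atTop (𝓝 (∫ t in Ioi 0, D t)) := by
    have h1 : Tendsto (fun V : ℝ => σ/V) atTop (𝓝 0) := tendsto_const_nhds.div_atTop tendsto_id
    have h2 : ContinuousOn (fun x => ∫ t in (0:ℝ)..x, D t) (Icc 0 1) := by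
      have hu : uIcc (0:ℝ) 1 = Icc 0 1 := uIcc_of_le zero_le_one
      rw [← hu]
      apply intervalIntegral.continuousOn_primitive_interval
      rw [hu, integrableOn_Icc_iff_integrableOn_Ioc]
      exact hDi.mono_set Ioc_subset_Ioi_self
    have h3 : Tendsto (fun V : ℝ => ∫ t in (0:ℝ)..(σ/V), D t) atTop (𝓝 0) := by
      have := (h2 0 (by simp)).tendsto.comp (tendsto_nhdsWithin_iff.2 ⟨h1, ?_⟩)
      · simpa [Function.comp_def] using this
      · filter_upwards [eventually_gt_atTop 0, eventually_ge_atTop σ] with V h h'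
        exact ⟨by positivity, by rw [div_le_one h]; exact h'⟩
    have h4 := (tendsto_const_nhds (x := ∫ t in Ioi 0, D t)).sub h3
    rw [sub_zero] at h4
    refine h4.congr' ?_
    filter_upwards [eventually_gt_atTop 0] with V hV
    rw [← intervalIntegral.integral_Ioi_sub_Ioi hDi (by positivity : 0 ≤ σ/V)]
    ring
  have hQ : Tendsto (fun V : ℝ => (V^2-τ^2)/σ - 1) atTop atTop := by
    apply tendsto_atTop_add_const_right
    apply Tendsto.atTop_div_const hσ
    apply tendsto_atTop_add_const_right
    exact tendsto_pow_atTop two_ne_zero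
  have hz := ((zeroLim s hs m).comp hQ).const_mul (σ^m)
  have hl : Tendsto (fun V : ℝ => ∑ l ∈ Finset.range m, ((m+(l+1)).choose (2*(l+1)) : ℝ) * 4^(l+1) * σ^(m-(l+1)) * τ^(2*(l+1)) * ∫ q in (0:ℝ)..((V^2-τ^2)/σ - 1), q^(s+m) * ((1+q)^(m+1+(l+1)))⁻¹) atTop
     (𝓝 (∑ l ∈ Finset.range m, ((m+(l+1)).choose (2*(l+1)) : ℝ) * 4^(l+1) * σ^(m-(l+1)) * τ^(2*(l+1)) * (Gamma (s+m+1) * Gamma ((l+1:ℕ)-s) / Gamma (m+(l+1:ℕ)+1)))) := by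
    apply tendsto_finsetSum
    intro l _
    apply Tendsto.const_mul
    have := (betaLim (s+m) ((l+1:ℕ)-s) (m+1+(l+1)) (by positivity) (by push_cast; have : (0:ℝ) ≤ l := by positivity
                                                                       linarith [hs.2]) (by push_cast; ring)).comp hQ
    have e : s + m + 1 + ((l+1:ℕ)-s) = m + (l+1:ℕ) + 1 := by ring
    rw [e] at this
    exact this
  have hT := (((mainTerm s hs m σ τ hσ).add hz).sub hl).sub ((edge s hs (s+m) σ τ hp hσ hτ).add (edge s hs (s+m) σ (-τ) hp hσ hτn))
  have hfin := hlim1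
  refine tendsto_nhds_unique hfin ?_
  have hval : 0 + σ^m * (Gamma (s+m+1) * Gamma (1-s) / (s * m.factorial)) - (∑ l ∈ Finset.range m, ((m+(l+1)).choose (2*(l+1)) : ℝ) * 4^(l+1) * σ^(m-(l+1)) * τ^(2*(l+1)) * (Gamma (s+m+1) * Gamma ((l+1:ℕ)-s) / Gamma (m+(l+1:ℕ)+1))) - (0+0) = 
     -∑ l ∈ Finset.range (m+1), ((m+l).choose (2*l) : ℝ) * 4^l * σ^(m-l) * τ^(2*l) * (Gamma (s+m+1) * Gamma (l-s) / Gamma (m+l+1)) := by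
    rw [Finset.sum_range_succ' _ m]
    have g : Gamma (1-s) = -s * Gamma (-s) := by
      rw [← Real.Gamma_add_one (by linarith : -s ≠ 0)]; congr 1; ring
    rw [g]
    simp only [CharP.cast_eq_zero, add_zero, zero_sub, mul_zero, Nat.choose_zero_right, pow_zero, Nat.sub_zero, Real.Gamma_nat_eq_factorial]
    have : (m.factorial : ℝ) ≠ 0 := by positivity
    field_simp
    ring
  rw [hval] at hT
  refine hT.congr' ?_
  filter_upwards [eventually_gt_atTop (√(τ^2+σ)), eventually_ge_atTop 2] with V hV hV2
  have hτ' := abs_le.1 hτ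
  have v0 : 0 < V := by linarith
  have v1 : 0 < V + τ := by linarith
  have v2 : 0 < V - τ := by linarith
  have hsub := subst2 s hs m σ τ hσ V hV
  rw [Finset.sum_range_succ' _ m] at hsub
  have i1 := branch_int s hs (s+m) σ τ hp hσ hτ
  have i2 := branch_int s hs (s+m) σ (-τ) hp hσ hτn
  have ew := fun (a : ℝ) (ha : 0 < a) => integral_Ioi_rpow_of_lt (a := -1-2*s) (by linarith) ha
  have iw := fun (a : ℝ) (ha : 0 < a) => integrableOn_Ioi_rpow_of_lt (a := -1-2*s) (c := a) (by linarith [hs.1]) ha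
  have s1 := (subst1 s hs m σ τ hσ V hV).1
  have s2 := (subst1 s hs m σ (-τ) hσ V (by simpa using hV)).1
  rw [← sub_eq_add_neg] at s2
  have hDs : ∫ t in Ioi (σ/V), D t = (∫ t in Ioi (σ/V), (σ^(s+m) - phi (s+m) σ τ t) * t^(-1-2*s)) + ∫ t in Ioi (σ/V), (σ^(s+m) - phi (s+m) σ (-τ) t) * t^(-1-2*s) := by
    rw [← integral_add (i1 _ (by positivity)) (i2 _ (by positivity))]
    congr 1; ext t; simp only [hD]; ring
  have b1 := intervalIntegral.integral_Ioi_sub_Ioi' (i1 (σ/(V+τ)) (by positivity)) (i1 (σ/V) (by positivity))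
  have b2 := intervalIntegral.integral_Ioi_sub_Ioi' (i2 (σ/(V-τ)) (by positivity)) (i2 (σ/V) (by positivity))
  have c1 : ∫ t in Ioi (σ/(V+τ)), (σ^(s+m) - phi (s+m) σ τ t) * t^(-1-2*s) = σ^(s+m) * ((σ/(V+τ))^(-2*s)/(2*s)) - ∫ t in Ioi (σ/(V+τ)), phi (s+m) σ τ t * t^(-1-2*s) := by
    simp_rw [sub_mul]
    rw [integral_sub ((iw _ (by positivity)).const_mul _) s1, integral_const_mul, ew _ (by positivity)]
    have : -1-2*s+1 = -2*s := by ring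
    rw [this, neg_mul, neg_div_neg_eq]
  have c2 : ∫ t in Ioi (σ/(V-τ)), (σ^(s+m) - phi (s+m) σ (-τ) t) * t^(-1-2*s) = σ^(s+m) * ((σ/(V-τ))^(-2*s)/(2*s)) - ∫ t in Ioi (σ/(V-τ)), phi (s+m) σ (-τ) t * t^(-1-2*s) := by
    simp_rw [sub_mul]
    rw [integral_sub ((iw _ (by positivity)).const_mul _) s2, integral_const_mul, ew _ (by positivity)]
    have : -1-2*s+1 = -2*s := by ring
    rw [this, neg_mul, neg_div_neg_eq]
  rw [hDs]
  simp only [Function.comp, ← sub_eq_add_neg]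
  simp only [add_zero, mul_zero, Nat.choose_zero_right, pow_zero, Nat.sub_zero, Nat.cast_one, one_mul, mul_one] at hsub
  rw [← b1, ← b2, c1, c2]
  have hsub' : ∀ a b c d : ℝ, a + b = c + d → b = c + d - a := by intros; linarith
  rw [hsub' _ _ _ _ hsub]
  ring


lemma half_fact (l : ℕ) : 4^l * (l.factorial : ℝ) * Gamma (l+1/2) = ((2*l).factorial : ℝ) * √π := by
  induction l with
  | zero => simp only [CharP.cast_eq_zero, zero_add, Real.Gamma_one_half_eq]; simp
  | succ l ih =>
    have e : (((l+1:ℕ):ℝ)+1/2) = (l+1/2)+1 := by push_cast; ring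
    rw [e, Real.Gamma_add_one (by positivity), show 2*(l+1) = (2*l+1)+1 by ring, Nat.factorial_succ, Nat.factorial_succ, Nat.factorial_succ]
    push_cast
    linear_combination (4*(l+1)*(l+1/2)) * ih

/-- truncated power -/
noncomputable def gpow {n : ℕ} (p : ℝ) (y : EuclideanSpace ℝ (Fin n)) : ℝ := (max (1 - ‖y‖^2) 0)^p

lemma gpow_cont {n : ℕ} (p : ℝ) (hp : 0 < p) : Continuous (gpow (n := n) p) := by
  unfold gpow
  exact Continuous.rpow_const (by fun_prop) (fun _ => Or.inr hp.le)

lemma gpow_bd {n : ℕ} (p : ℝ) (hp : 0 < p) (y : EuclideanSpace ℝ (Fin n)) : 0 ≤ gpow p y ∧ gpow p y ≤ 1 := by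
  unfold gpow
  refine ⟨by positivity, ?_⟩
  apply Real.rpow_le_one (by positivity) _ hp.le
  apply max_le _ zero_le_one
  nlinarith [sq_nonneg ‖y‖]

lemma gpow_line {n : ℕ} (p : ℝ) (x h : EuclideanSpace ℝ (Fin n)) (hh : ‖h‖ = 1) (t : ℝ) :
    gpow p (x + t • h) = phi p (1-‖x‖^2) (inner ℝ x h) t := by
  unfold gpow phi
  congr 2
  rw [norm_add_sq_real, inner_smul_right, norm_smul, hh, mul_one, norm_eq_abs, sq_abs]
  ring

lemma gpow_line' {n : ℕ} (p : ℝ) (x h : EuclideanSpace ℝ (Fin n)) (hh : ‖h‖ = 1) (t : ℝ) :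
    gpow p (x - t • h) = phi p (1-‖x‖^2) (-inner ℝ x h) t := by
  unfold gpow phi
  congr 2
  rw [norm_sub_sq_real, inner_smul_right, norm_smul, hh, mul_one, norm_eq_abs, sq_abs]
  ring

lemma meas_kernel {n : ℕ} (r : ℝ) (f : EuclideanSpace ℝ (Fin n) → ℝ) (hf : Continuous f) :
    AEStronglyMeasurable (fun z => f z / ‖z‖^r) volume := by
  have : Measurable (fun z => f z / ‖z‖^r) := by
    have := hf.measurable
    fun_prop
  exact this.aestronglyMeasurable

lemma rad_far (n : ℕ) (hn : 1 ≤ n) (s : ℝ) (hs : s ∈ Ioo (0:ℝ) 1) (ε : ℝ) (hε : 0 < ε) :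
    IntegrableOn (fun z : EuclideanSpace ℝ (Fin n) => 1 / ‖z‖^((n:ℝ)+2*s)) {z | ε < ‖z‖} := by
  have : Nonempty (Fin n) := ⟨⟨0, hn⟩⟩
  have hm : MeasurableSet {z : EuclideanSpace ℝ (Fin n) | ε < ‖z‖} := measurableSet_lt measurable_const measurable_norm
  rw [← integrable_indicator_iff hm]
  have := (integrable_fun_norm_addHaar (volume : Measure (EuclideanSpace ℝ (Fin n))) (f := (Ioi ε).indicator (fun t : ℝ => 1 / t^((n:ℝ)+2*s)))).2 ?_
  · refine this.congr (Eventually.of_forall ?_)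
    intro z
    simp only [indicator, mem_Ioi, mem_ofPred_eq]
  · have h := integrableOn_Ioi_rpow_of_lt (a := -1-2*s) (c := ε) (by linarith [hs.1]) hε
    have h2 : IntegrableOn ((Ioi ε).indicator (fun t : ℝ => t^(-1-2*s))) (Ioi 0) :=
      ((integrable_indicator_iff measurableSet_Ioi).2 h).integrableOn
    refine h2.congr_fun ?_ measurableSet_Ioi
    intro t ht
    have ht' : 0 < t := ht
    simp only [indicator, finrank_euclideanSpace, Fintype.card_fin, smul_eq_mul]
    split_ifs
    · rw [one_div, ← Real.rpow_neg ht'.le, ← Real.rpow_natCast, ← Real.rpow_add ht', Nat.cast_sub hn]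
      congr 1; push_cast; ring
    · simp

lemma rad_min (n : ℕ) (hn : 1 ≤ n) (s : ℝ) (hs : s ∈ Ioo (0:ℝ) 1) :
    Integrable (fun z : EuclideanSpace ℝ (Fin n) => min (‖z‖^2) 1 / ‖z‖^((n:ℝ)+2*s)) := by
  have : Nonempty (Fin n) := ⟨⟨0, hn⟩⟩
  refine (integrable_fun_norm_addHaar (volume : Measure (EuclideanSpace ℝ (Fin n))) (f := (fun t : ℝ => min (t^2) 1 / t^((n:ℝ)+2*s)))).2 ?_
  refine (int_min s hs).congr_fun ?_ measurableSet_Ioi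
  intro t ht
  have ht' : 0 < t := ht
  simp only [finrank_euclideanSpace, Fintype.card_fin, smul_eq_mul]
  have : t^(-1-2*s) = t^(n-1) / t^((n:ℝ)+2*s) := by
    rw [div_eq_mul_inv, ← Real.rpow_neg ht'.le, ← Real.rpow_natCast, ← Real.rpow_add ht', Nat.cast_sub hn]
    congr 1; push_cast; ring
  rw [this]; ring

lemma far_int (n : ℕ) (hn : 1 ≤ n) (s : ℝ) (hs : s ∈ Ioo (0:ℝ) 1) (f : EuclideanSpace ℝ (Fin n) → ℝ) (hf : Continuous f)
    (C : ℝ) (hC : ∀ z, |f z| ≤ C) (ε : ℝ) (hε : 0 < ε) :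
    IntegrableOn (fun z => f z / ‖z‖^((n:ℝ)+2*s)) {z | ε < ‖z‖} := by
  refine ((rad_far n hn s hs ε hε).const_mul C).mono' (meas_kernel _ _ hf).restrict ?_
  refine Eventually.of_forall fun z => ?_
  rw [norm_div, norm_eq_abs, norm_eq_abs, abs_of_nonneg (by positivity : 0 ≤ ‖z‖^((n:ℝ)+2*s)), ← mul_div_assoc, mul_one]
  gcongr
  exact hC z

lemma F_bound {n : ℕ} (p : ℝ) (hp : 0 < p) (x : EuclideanSpace ℝ (Fin n)) (hx : ‖x‖ < 1) : ∃ C > 0, ∀ z,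
    |2 * gpow p x - gpow p (x+z) - gpow p (x-z)| ≤ C * min (‖z‖^2) 1 := by
  have hσ : 0 < 1 - ‖x‖^2 := by nlinarith [norm_nonneg x]
  obtain ⟨C, hC, hb⟩ := diff_bounds p (1-‖x‖^2) hp hσ
  refine ⟨C, hC, fun z => ?_⟩
  by_cases hz : z = 0
  · subst hz; simp; ring_nf
  have hz' : 0 < ‖z‖ := norm_pos_iff.2 hz
  have hh : ‖(‖z‖⁻¹ • z)‖ = 1 := by rw [norm_smul, norm_inv, norm_norm]; field_simp
  have e : z = ‖z‖ • (‖z‖⁻¹ • z) := by rw [smul_smul, mul_inv_cancel₀ hz'.ne', one_smul]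
  have hτ : |inner ℝ x (‖z‖⁻¹ • z)| ≤ 1 := by
    refine (abs_real_inner_le_norm _ _).trans ?_
    rw [hh]; linarith
  have := (hb _ hτ ‖z‖ hz').1
  rw [← gpow_line p x _ hh, ← gpow_line' p x _ hh, ← e] at this
  have e2 : gpow p x = (1-‖x‖^2)^p := by unfold gpow; rw [max_eq_left hσ.le]
  rw [e2]; exact this

lemma F_int (n : ℕ) (hn : 1 ≤ n) (s : ℝ) (hs : s ∈ Ioo (0:ℝ) 1) (p : ℝ) (hp : 0 < p) (x : EuclideanSpace ℝ (Fin n)) (hx : ‖x‖ < 1) :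
    Integrable (fun z => (2 * gpow p x - gpow p (x+z) - gpow p (x-z)) / ‖z‖^((n:ℝ)+2*s)) := by
  obtain ⟨C, hC, hb⟩ := F_bound p hp x hx
  have hc := gpow_cont (n := n) p hp
  refine ((rad_min n hn s hs).const_mul C).mono' (meas_kernel _ _ (by fun_prop)) ?_
  refine Eventually.of_forall fun z => ?_
  rw [norm_div, norm_eq_abs, norm_eq_abs, abs_of_nonneg (by positivity : 0 ≤ ‖z‖^((n:ℝ)+2*s)), ← mul_div_assoc]
  gcongr
  exact hb z

lemma pv_sym (n : ℕ) (hn : 1 ≤ n) (s : ℝ) (hs : s ∈ Ioo (0:ℝ) 1) (p : ℝ) (hp : 0 < p) (x : EuclideanSpace ℝ (Fin n)) (ε : ℝ) (hε : 0 < ε) :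
    ∫ y in {y | ε < ‖x - y‖}, (gpow p x - gpow p y) / ‖x - y‖^((n:ℝ)+2*s) = 
     (1/2) * ∫ z in {z | ε < ‖z‖}, (2 * gpow p x - gpow p (x+z) - gpow p (x-z)) / ‖z‖^((n:ℝ)+2*s) := by
  have hc := gpow_cont (n := n) p hp
  have hm : MeasurableSet {z : EuclideanSpace ℝ (Fin n) | ε < ‖z‖} := measurableSet_lt measurable_const measurable_norm
  have hm' : MeasurableSet {y : EuclideanSpace ℝ (Fin n) | ε < ‖x - y‖} := measurableSet_lt measurable_const (by fun_prop)
  have e1 : ∫ y in {y | ε < ‖x - y‖}, (gpow p x - gpow p y) / ‖x - y‖^((n:ℝ)+2*s) = 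
     ∫ z in {z | ε < ‖z‖}, (gpow p x - gpow p (x-z)) / ‖z‖^((n:ℝ)+2*s) := by
    rw [← integral_indicator hm, ← integral_indicator hm', ← integral_sub_left_eq_self _ _ x]
    congr 1; ext z
    simp only [indicator, mem_ofPred_eq, sub_sub_cancel]
  have e2 : ∫ z in {z : EuclideanSpace ℝ (Fin n) | ε < ‖z‖}, (gpow p x - gpow p (x-z)) / ‖z‖^((n:ℝ)+2*s) = 
     ∫ z in {z | ε < ‖z‖}, (gpow p x - gpow p (x+z)) / ‖z‖^((n:ℝ)+2*s) := by
    rw [← integral_indicator hm, ← integral_indicator hm, ← integral_neg_eq_self]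
    congr 1; ext z
    simp only [indicator, mem_ofPred_eq, norm_neg, sub_neg_eq_add]
  have bd : ∀ w : EuclideanSpace ℝ (Fin n), |gpow p x - gpow p w| ≤ 1 := by
    intro w
    have h1 := gpow_bd p hp x
    have h2 := gpow_bd p hp w
    rw [abs_le]; constructor <;> linarith
  have i1 := far_int n hn s hs (fun z => gpow p x - gpow p (x-z)) (by fun_prop) 1 (fun z => bd _) ε hε
  have i2 := far_int n hn s hs (fun z => gpow p x - gpow p (x+z)) (by fun_prop) 1 (fun z => bd _) ε hε
  have e3 : ∫ z in {z | ε < ‖z‖}, (2 * gpow p x - gpow p (x+z) - gpow p (x-z)) / ‖z‖^((n:ℝ)+2*s) = 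
     (∫ z in {z : EuclideanSpace ℝ (Fin n) | ε < ‖z‖}, (gpow p x - gpow p (x-z)) / ‖z‖^((n:ℝ)+2*s)) + 
     ∫ z in {z | ε < ‖z‖}, (gpow p x - gpow p (x+z)) / ‖z‖^((n:ℝ)+2*s) := by
    rw [← integral_add i1 i2]
    congr 1; ext z; ring
  rw [e3, ← e2, e1]; ring

lemma pv_lim (n : ℕ) (hn : 1 ≤ n) (s : ℝ) (hs : s ∈ Ioo (0:ℝ) 1) (p : ℝ) (hp : 0 < p) (x : EuclideanSpace ℝ (Fin n)) (hx : ‖x‖ < 1) :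
    Tendsto (fun ε : ℝ => ∫ y in {y | ε < ‖x - y‖}, (gpow p x - gpow p y) / ‖x - y‖^((n:ℝ)+2*s)) (𝓝[>] 0)
     (𝓝 ((1/2) * ∫ z, (2 * gpow p x - gpow p (x+z) - gpow p (x-z)) / ‖z‖^((n:ℝ)+2*s))) := by
  have hF := F_int n hn s hs p hp x hx
  set F := fun z => (2 * gpow p x - gpow p (x+z) - gpow p (x-z)) / ‖z‖^((n:ℝ)+2*s) with hFd
  have hm : ∀ ε : ℝ, MeasurableSet {z : EuclideanSpace ℝ (Fin n) | ε < ‖z‖} := fun ε => measurableSet_lt measurable_const measurable_norm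
  have h : Tendsto (fun ε : ℝ => ∫ z, ({z | ε < ‖z‖} : Set (EuclideanSpace ℝ (Fin n))).indicator F z) (𝓝[>] 0) (𝓝 (∫ z, F z)) := by
    apply tendsto_integral_filter_of_dominated_convergence (fun z => ‖F z‖)
    · exact Eventually.of_forall fun ε => hF.aestronglyMeasurable.indicator (hm ε)
    · exact Eventually.of_forall fun ε => Eventually.of_forall fun z => norm_indicator_le_norm_self _ _
    · exact hF.norm
    · refine Eventually.of_forall fun z => ?_
      by_cases hz : z = 0
      · have : F z = 0 := by simp only [hFd, hz, add_zero, sub_zero]; ring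
        refine tendsto_const_nhds.congr ?_
        intro ε
        simp [indicator, this]
      · refine tendsto_const_nhds.congr' ?_
        filter_upwards [nhdsWithin_le_nhds (Iio_mem_nhds (norm_pos_iff.2 hz))] with ε hε
        rw [indicator_of_mem]; exact hε
  refine (h.const_mul (1/2)).congr' ?_
  filter_upwards [self_mem_nhdsWithin] with ε hε
  rw [pv_sym n hn s hs p hp x ε hε, integral_indicator (hm ε)]

lemma ball_value (n : ℕ) (hn : 1 ≤ n) (s : ℝ) (hs : s ∈ Ioo (0:ℝ) 1) (m : ℕ) (x : EuclideanSpace ℝ (Fin n)) (hx : ‖x‖ < 1) :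
    (1/2) * ∫ z, (2 * gpow (s+m) x - gpow (s+m) (x+z) - gpow (s+m) (x-z)) / ‖z‖^((n:ℝ)+2*s) = 
     -(π^((n:ℝ)/2) * Gamma (s+m+1)) * ∑ l ∈ Finset.range (m+1), 
        Gamma (l-s) / ((m-l).factorial * l.factorial * Gamma (l+(n:ℝ)/2)) * (1-‖x‖^2)^(m-l) * (‖x‖^2)^l := by
  have hs0 := hs.1
  have hp : 0 < s + m := by positivity
  have hσ : 0 < 1 - ‖x‖^2 := by nlinarith [norm_nonneg x]
  rw [polarInt n hn _ (F_int n hn s hs (s+m) hp x hx)]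
  have e1 : ∀ h : Metric.sphere (0 : EuclideanSpace ℝ (Fin n)) 1, 
     (∫ t in Ioi (0:ℝ), t^(n-1) * ((2 * gpow (s+m) x - gpow (s+m) (x+t • (h : EuclideanSpace ℝ (Fin n))) - gpow (s+m) (x-t • (h : EuclideanSpace ℝ (Fin n)))) / ‖t • (h : EuclideanSpace ℝ (Fin n))‖^((n:ℝ)+2*s)))
      = -∑ l ∈ Finset.range (m+1), ((m+l).choose (2*l) : ℝ) * 4^l * (1-‖x‖^2)^(m-l) * (inner ℝ x (h : EuclideanSpace ℝ (Fin n)))^(2*l) * (Gamma (s+m+1) * Gamma (l-s) / Gamma (m+l+1)) := by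
    intro h
    have hh : ‖(h : EuclideanSpace ℝ (Fin n))‖ = 1 := by simp
    rw [← line_value s hs m (1-‖x‖^2) _ hσ]
    · apply setIntegral_congr_fun measurableSet_Ioi
      intro t ht
      have ht' : 0 < t := ht
      have e2 : gpow (s+m) x = (1-‖x‖^2)^(s+m) := by unfold gpow; rw [max_eq_left hσ.le]
      simp only
      rw [gpow_line _ _ _ hh, gpow_line' _ _ _ hh, norm_smul, hh, mul_one, norm_eq_abs, abs_of_pos ht', e2]
      have : t^(-1-2*s) = t^(n-1) / t^((n:ℝ)+2*s) := by
        rw [div_eq_mul_inv, ← Real.rpow_neg ht'.le, ← Real.rpow_natCast, ← Real.rpow_add ht', Nat.cast_sub hn]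
        congr 1; push_cast; ring
      rw [this]; ring
    · refine (abs_real_inner_le_norm _ _).trans ?_
      rw [hh]; linarith
  simp_rw [e1]
  rw [integral_neg, integral_finsetSum]
  swap
  · intro l _
    apply Continuous.integrable_of_hasCompactSupport
    · fun_prop
    · exact HasCompactSupport.of_compactSpace _
  simp_rw [mul_assoc _ _ (Gamma (s+m+1) * Gamma _ / Gamma _), mul_comm (_ ^ _) (Gamma (s+m+1) * Gamma _ / Gamma _)]
  simp_rw [← mul_assoc _ (Gamma (s+m+1) * Gamma _ / Gamma _) _, integral_const_mul, sphereMoment n hn]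
  rw [mul_neg, neg_mul, Finset.mul_sum, Finset.mul_sum]
  congr 1
  apply Finset.sum_congr rfl
  intro l hl
  have hl' : l ≤ m := by simpa [Nat.lt_succ_iff] using hl
  obtain ⟨N, rfl⟩ := Nat.exists_eq_add_of_le hl'
  have hf := half_fact l
  have hpi : π^((n:ℝ)/2) = π^(((n:ℝ)-1)/2) * √π := by
    rw [Real.sqrt_eq_rpow, ← Real.rpow_add Real.pi_pos]; congr 1; ring
  have hG : Gamma (((l+N:ℕ):ℝ) + l + 1) = ((l+N+l).factorial : ℝ) := by
    rw [← Real.Gamma_nat_eq_factorial]; congr 1; push_cast; ring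
  have hch : ((l+N+l).choose (2*l) : ℝ) * ((2*l).factorial : ℝ) * (N.factorial : ℝ) = ((l+N+l).factorial : ℝ) := by
    have := Nat.choose_mul_factorial_mul_factorial (by omega : 2*l ≤ l+N+l)
    rw [show l+N+l-2*l = N by omega] at this
    exact_mod_cast this
  have h1 : (0:ℝ) < ((l+N+l).factorial : ℝ) := by positivity
  have h2 : (0:ℝ) < (l.factorial : ℝ) := by positivity
  have h3 : (0:ℝ) < (N.factorial : ℝ) := by positivity
  have h5 : (0:ℝ) < ((2*l).factorial : ℝ) := by positivity
  have h4 : 0 < Gamma ((l:ℝ) + (n:ℝ)/2) := by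
    apply Real.Gamma_pos_of_pos
    have : (1:ℝ) ≤ n := by exact_mod_cast hn
    positivity
  rw [hG, hpi, Nat.add_sub_cancel_left, ← pow_mul]
  have hf' : Gamma ((l:ℝ)+1/2) = ((2*l).factorial : ℝ) * √π / (4^l * l.factorial) := by
    rw [eq_div_iff (by positivity)]; linarith
  have hch' : ((l+N+l).choose (2*l) : ℝ) = ((l+N+l).factorial : ℝ) / (((2*l).factorial : ℝ) * (N.factorial : ℝ)) := by
    field_simp; linarith
  rw [hf', hch']
  field_simp

/-- coefficients of the Jacobi polynomial in powers of `1 - ‖x‖^2` -/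
noncomputable def acoef (n k : ℕ) (s : ℝ) (m : ℕ) : ℝ :=
  (Real.Gamma (s + k + 1) / (k.factorial * Real.Gamma (s + ((n:ℝ)/2-1) + k + 1))) *
   ((k.choose m : ℝ) * (Real.Gamma (s + ((n:ℝ)/2-1) + k + m + 1) / Real.Gamma (s + m + 1)) * (-1)^m)

lemma jacobi_eq (n k : ℕ) (s r : ℝ) : jacobiP k s ((n:ℝ)/2-1) (2*r-1) = 
    ∑ m ∈ Finset.range (k+1), acoef n k s m * (1-r)^m := by
  unfold jacobiP acoef
  rw [Finset.mul_sum]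
  apply Finset.sum_congr rfl
  intro m _
  have : (2*r-1-1)/2 = -1*(1-r) := by ring
  rw [this, mul_pow]; ring

lemma final_alg (n : ℕ) (hn : 1 ≤ n) (s : ℝ) (hs : s ∈ Ioo (0:ℝ) 1) (k : ℕ) (σ : ℝ) :
    fracLapConst n s * ∑ m ∈ Finset.range (k+1), acoef n k s m * (-(π^((n:ℝ)/2) * Gamma (s+m+1)) * ∑ l ∈ Finset.range (m+1), 
        Gamma (l-s) / ((m-l).factorial * l.factorial * Gamma (l+(n:ℝ)/2)) * σ^(m-l) * (1-σ)^l)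
     = jacobiEigenvalue n k s * ∑ m ∈ Finset.range (k+1), acoef n k s m * σ^m := by
  have hs0 := hs.1
  have hs1 := hs.2
  have hn' : (1:ℝ) ≤ n := by exact_mod_cast hn
  obtain ⟨b, hb⟩ : ∃ b : ℝ, b = (n:ℝ)/2 := ⟨_, rfl⟩
  have hbp : 0 < b := by rw [hb]; positivity
  have pos : ∀ {a : ℝ}, 0 < a → ∀ i : ℕ, a + i ≠ 0 := fun {a} ha i => by positivity
  have gA : ∀ m : ℕ, Gamma (s + (b-1) + k + m + 1) = Gamma (s+b) * pch (s+b) k * pch (s+b+k) m := by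
    intro m
    rw [← Gamma_pch (pos (by positivity)), ← Gamma_pch (pos (by positivity))]
    congr 1; ring
  have gs : ∀ m : ℕ, Gamma (s+m+1) = Gamma (s+1) * pch (s+1) m := by
    intro m
    rw [← Gamma_pch (pos (by positivity))]
    congr 1; ring
  have gl : ∀ l : ℕ, Gamma (l-s) = Gamma (-s) * pch (-s) l := by
    intro l
    rw [← Gamma_pch]
    · congr 1; ring
    · intro i h
      have : (i:ℝ) = s := by linarith
      rw [← this] at hs0 hs1
      have h1 : 0 < i := by exact_mod_cast hs0
      have h2 : i < 1 := by exact_mod_cast hs1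
      omega
  have gb : ∀ l : ℕ, Gamma (l+b) = Gamma b * pch b l := by
    intro l
    rw [← Gamma_pch (pos hbp)]
    congr 1; ring
  have g1 : Gamma (1-s) = -s * Gamma (-s) := by
    rw [← Real.Gamma_add_one (by linarith : -s ≠ 0)]; congr 1; ring
  have g1p : 0 < Gamma (1-s) := Real.Gamma_pos_of_pos (by linarith)
  have gms : Gamma (-s) ≠ 0 := by
    intro h; rw [g1, h] at g1p; simp at g1p
  have p1 : ∀ m, 0 < pch (s+1) m := fun m => pch_pos (by positivity) m
  have p2 : ∀ m, 0 < pch b m := fun m => pch_pos hbp m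
  have p3 : ∀ m, 0 < pch (s+b) m := fun m => pch_pos (by positivity) m
  have q1 : 0 < Gamma (s+1) := Real.Gamma_pos_of_pos (by positivity)
  have q2 : 0 < Gamma (s+b) := Real.Gamma_pos_of_pos (by positivity)
  have q3 : 0 < Gamma b := Real.Gamma_pos_of_pos hbp
  have q4 : 0 < π^b := by positivity
  have hcomb := comb k s b σ hs0 hbp
  unfold fracLapConst jacobiEigenvalue acoef
  rw [← hb]
  have hk := gA 0
  simp only [CharP.cast_eq_zero, add_zero, pch_zero, mul_one] at hk
  simp only [gA, gl, gb, g1, gs, hk]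
  have e1 : Gamma (1+s+k) = Gamma (s+1) * pch (s+1) k := by rw [← gs]; congr 1; ring
  have e2 : Gamma (b+s+k) = Gamma (s+b) * pch (s+b) k := by rw [← hk]; congr 1; ring
  have e3 : Gamma (b+k) = Gamma b * pch b k := by rw [← gb]; congr 1; ring
  rw [e1, e2, e3]
  set c := Gamma (s+1) * pch (s+1) k / (k.factorial * (Gamma (s+b) * pch (s+b) k)) with hc
  have L : ∑ m ∈ Finset.range (k+1), c * ((k.choose m : ℝ) * (Gamma (s+b) * pch (s+b) k * pch (s+b+k) m / (Gamma (s+1) * pch (s+1) m)) * (-1)^m) * (-(π^b * (Gamma (s+1) * pch (s+1) m)) * ∑ l ∈ Finset.range (m+1), 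
        Gamma (-s) * pch (-s) l / ((m-l).factorial * l.factorial * (Gamma b * pch b l)) * σ^(m-l) * (1-σ)^l) = 
      (-c * Gamma (s+b) * pch (s+b) k * π^b * Gamma (-s) / Gamma b) * ∑ m ∈ Finset.range (k+1), (k.choose m : ℝ) * (-1)^m * pch (s+b+k) m / m.factorial *
      ∑ l ∈ Finset.range (m+1), (m.choose l : ℝ) * (pch (-s) l / pch b l) * σ^(m-l) * (1-σ)^l := by
    rw [Finset.mul_sum]
    apply Finset.sum_congr rfl
    intro m _
    have : ∑ l ∈ Finset.range (m+1), Gamma (-s) * pch (-s) l / ((m-l).factorial * l.factorial * (Gamma b * pch b l)) * σ^(m-l) * (1-σ)^l = 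
      Gamma (-s) / (Gamma b * m.factorial) * ∑ l ∈ Finset.range (m+1), (m.choose l : ℝ) * (pch (-s) l / pch b l) * σ^(m-l) * (1-σ)^l := by
      rw [Finset.mul_sum]
      apply Finset.sum_congr rfl
      intro l hl
      have hl' : l ≤ m := by simpa [Nat.lt_succ_iff] using hl
      rw [Nat.cast_choose ℝ hl']
      have := p2 l
      have f1 : (0:ℝ) < m.factorial := by positivity
      field_simp
    rw [this]
    generalize ∑ l ∈ Finset.range (m+1), (m.choose l : ℝ) * (pch (-s) l / pch b l) * σ^(m-l) * (1-σ)^l = S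
    have := p1 m
    have f1 : (0:ℝ) < m.factorial := by positivity
    field_simp
  have R : ∑ m ∈ Finset.range (k+1), c * ((k.choose m : ℝ) * (Gamma (s+b) * pch (s+b) k * pch (s+b+k) m / (Gamma (s+1) * pch (s+1) m)) * (-1)^m) * σ^m = 
     c * Gamma (s+b) * pch (s+b) k / Gamma (s+1) * ∑ m ∈ Finset.range (k+1), (k.choose m : ℝ) * (-1)^m * (pch (s+b+k) m / pch (s+1) m) * σ^m := by
    rw [Finset.mul_sum]
    apply Finset.sum_congr rfl
    intro m _
    have := p1 m
    field_simp
  rw [L, R, hcomb]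
  generalize ∑ m ∈ Finset.range (k+1), (k.choose m : ℝ) * (-1)^m * (pch (s+b+k) m / pch (s+1) m) * σ^m = S
  have := p2 k
  have := p3 k
  have f1 : (0:ℝ) < k.factorial := by positivity
  field_simp

/-- **Explicit eigenfunctions of the fractional Laplacian on the unit ball
(Dyda–Kuznetsov–Kwaśnicki).** With `ω^s(x) = (1−‖x‖²)₊^s` and
`p_k^{(s)}(x) = P_k^{(s,n/2−1)}(2‖x‖²−1) χ_{B(0,1)}(x)`, the function `u = ω^s p_k^{(s)}`
satisfies `(−Δ)^s u = λ_{k,s} p_k^{(s)}` in `B(0,1)`, in the principal-value sense. -/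
theorem fracLap_jacobi_eigenfunction (n : ℕ) (hn : 1 ≤ n) (s : ℝ) (hs : s ∈ Set.Ioo (0:ℝ) 1)
    (k : ℕ)
    (ω : EuclideanSpace ℝ (Fin n) → ℝ)
    (hω : ω = fun x => max (1 - ‖x‖ ^ 2) 0 ^ s)
    (p : EuclideanSpace ℝ (Fin n) → ℝ)
    (hp : p = Set.indicator (Metric.ball (0 : EuclideanSpace ℝ (Fin n)) 1)
        (fun x => jacobiP k s ((n : ℝ) / 2 - 1) (2 * ‖x‖ ^ 2 - 1)))
    (u : EuclideanSpace ℝ (Fin n) → ℝ) (hu : u = fun x => ω x * p x) :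
    ∀ x ∈ Metric.ball (0 : EuclideanSpace ℝ (Fin n)) 1,
      Tendsto
        (fun ε : ℝ => fracLapConst n s *
          ∫ y in {y | ε < ‖x - y‖}, (u x - u y) / ‖x - y‖ ^ ((n : ℝ) + 2 * s))
        (nhdsWithin 0 (Set.Ioi 0))
        (nhds (jacobiEigenvalue n k s * p x)) := by
  intro x hx
  have hx1 : ‖x‖ < 1 := by simpa using hx
  have hs0 := hs.1
  have hpm : ∀ m : ℕ, 0 < s + m := fun m => by positivity
  have huE : ∀ y, u y = ∑ m ∈ Finset.range (k+1), acoef n k s m * gpow (s+m) y := by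
    intro y
    rw [hu, hω, hp]
    simp only
    by_cases hy : y ∈ Metric.ball (0 : EuclideanSpace ℝ (Fin n)) 1
    · have hy1 : ‖y‖ < 1 := by simpa using hy
      have hσ : 0 < 1 - ‖y‖^2 := by nlinarith [norm_nonneg y]
      rw [indicator_of_mem hy, jacobi_eq, Finset.mul_sum]
      apply Finset.sum_congr rfl
      intro m _
      unfold gpow
      rw [max_eq_left hσ.le, Real.rpow_add hσ, Real.rpow_natCast]; ring
    · have hy1 : 1 ≤ ‖y‖ := by simpa using hy
      rw [indicator_of_notMem hy, mul_zero]
      symm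
      apply Finset.sum_eq_zero
      intro m _
      unfold gpow
      rw [max_eq_right (by nlinarith), Real.zero_rpow (hpm m).ne', mul_zero]
  have hpx : p x = ∑ m ∈ Finset.range (k+1), acoef n k s m * (1-‖x‖^2)^m := by
    rw [hp, indicator_of_mem hx, jacobi_eq]
  have hlim : Tendsto (fun ε : ℝ => fracLapConst n s * ∑ m ∈ Finset.range (k+1), acoef n k s m * ∫ y in {y | ε < ‖x - y‖}, (gpow (s+m) x - gpow (s+m) y) / ‖x - y‖^((n:ℝ)+2*s)) (𝓝[>] 0)
     (𝓝 (fracLapConst n s * ∑ m ∈ Finset.range (k+1), acoef n k s m * (-(π^((n:ℝ)/2) * Gamma (s+m+1)) * ∑ l ∈ Finset.range (m+1), 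
        Gamma (l-s) / ((m-l).factorial * l.factorial * Gamma (l+(n:ℝ)/2)) * (1-‖x‖^2)^(m-l) * (1-(1-‖x‖^2))^l))) := by
    apply Tendsto.const_mul
    apply tendsto_finsetSum
    intro m _
    apply Tendsto.const_mul
    have := pv_lim n hn s hs (s+m) (hpm m) x hx1
    rw [ball_value n hn s hs m x hx1] at this
    simpa only [sub_sub_cancel] using this
  rw [final_alg n hn s hs, ← hpx] at hlim
  refine hlim.congr' ?_
  filter_upwards [self_mem_nhdsWithin] with ε hε
  have hε' : 0 < ε := hε
  congr 1
  simp_rw [← integral_const_mul]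
  rw [← integral_finsetSum]
  · congr 1; ext y
    rw [huE x, huE y, ← Finset.sum_sub_distrib, Finset.sum_div]
    apply Finset.sum_congr rfl
    intro m _; ring
  · intro m _
    apply Integrable.const_mul
    have hc := gpow_cont (n := n) (s+m) (hpm m)
    have bd : ∀ w : EuclideanSpace ℝ (Fin n), |gpow (s+m) x - gpow (s+m) w| ≤ 1 := by
      intro w
      have h1 := gpow_bd (s+m) (hpm m) x
      have h2 := gpow_bd (s+m) (hpm m) w
      rw [abs_le]; constructor <;> linarith
    have i1 := far_int n hn s hs (fun z => gpow (s+m) x - gpow (s+m) (x-z)) (by fun_prop) 1 (fun z => bd _) ε hε'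
    have hm : MeasurableSet {z : EuclideanSpace ℝ (Fin n) | ε < ‖z‖} := measurableSet_lt measurable_const measurable_norm
    have hm' : MeasurableSet {y : EuclideanSpace ℝ (Fin n) | ε < ‖x - y‖} := measurableSet_lt measurable_const (by fun_prop)
    have i2 := (integrable_indicator_iff hm).2 i1
    have i3 := i2.comp_sub_left x
    refine (integrable_indicator_iff hm').1 ?_
    refine i3.congr (Eventually.of_forall fun y => ?_)
    simp only [indicator, mem_ofPred_eq, sub_sub_cancel]
end

section
/- Let s ∈ (0,1) and define u : ℝ² → ℝ by u(x) = (1 − ‖x‖²)₊^s / (2^{2s} Γ(1+s)²). Then for every x in the open unit ball B(0,1) ⊂ ℝ², the principal value C(2,s) lim_{ε→0⁺} ∫_{{y : |x−y|>ε}} (u(x)−u(y))/|x−y|^{2+2s} dy exists and equals 1; that is, u solves (−Δ)^s u = 1 in B(0,1) with u = 0 outside B(0,1). -/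
open MeasureTheory Real Filter Set

lemma ftA_lint (s : ℝ) (hs0 : 0 < s) (hs1 : s < 1) :
    ∫⁻ v in Ioi (0:ℝ), ENNReal.ofReal (v ^ (s - 1) / (1 + v)) =
      ENNReal.ofReal (Real.Gamma s * Real.Gamma (1 - s)) := by
  have h1 : ∀ v ∈ Ioi (0:ℝ), ENNReal.ofReal (v ^ (s - 1) / (1 + v)) =
      ∫⁻ t in Ioi (0:ℝ), ENNReal.ofReal (v ^ (s - 1) * rexp (-((1 + v) * t))) := by
    intro v hv
    have hv' : (0:ℝ) < v := hv
    have hi := integral_rpow_mul_exp_neg_mul_Ioi (a := 1) (r := 1 + v) one_pos (by linarith)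
    have hii : IntegrableOn (fun t : ℝ => rexp (-((1 + v) * t))) (Ioi 0) := by
      have := exp_neg_integrableOn_Ioi 0 (b := 1 + v) (by linarith)
      simpa only [neg_mul] using this
    rw [← ofReal_integral_eq_lintegral_ofReal]
    · congr 1
      rw [integral_const_mul]
      have : ∫ t in Ioi (0:ℝ), rexp (-((1 + v) * t)) = 1 / (1 + v) := by
        rw [← integral_congr_ae (f := fun t : ℝ => t ^ ((1:ℝ) - 1) * rexp (-((1 + v) * t))) ?_, hi]
        · simp
        · exact Eventually.of_forall fun t => by simp
      rw [this]; ring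
    · exact hii.const_mul _
    · exact Eventually.of_forall fun t => by positivity
  rw [setLIntegral_congr_fun measurableSet_Ioi h1, lintegral_lintegral_swap]
  · have h2 : ∀ t ∈ Ioi (0:ℝ), ∫⁻ v in Ioi (0:ℝ), ENNReal.ofReal (v ^ (s - 1) * rexp (-((1 + v) * t)))
        = ENNReal.ofReal (Real.Gamma s * (rexp (-t) * t ^ ((1 - s) - 1))) := by
      intro t ht
      have ht' : (0:ℝ) < t := ht
      have hi := integral_rpow_mul_exp_neg_mul_Ioi (a := s) (r := t) hs0 ht'
      have hii : IntegrableOn (fun v : ℝ => v ^ (s - 1) * rexp (-(t * v))) (Ioi 0) := by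
        apply not_imp_comm.1 integral_undef
        rw [hi]
        have := Real.Gamma_pos_of_pos hs0
        positivity
      rw [← ofReal_integral_eq_lintegral_ofReal]
      · congr 1
        have : ∀ v : ℝ, v ^ (s - 1) * rexp (-((1 + v) * t)) = rexp (-t) * (v ^ (s - 1) * rexp (-(t * v))) := by
          intro v
          rw [show -((1 + v) * t) = -t + -(t * v) by ring, Real.exp_add]; ring
        simp_rw [this]
        rw [integral_const_mul, hi, show (1 - s) - 1 = -s by ring, Real.rpow_neg ht'.le,
          Real.div_rpow zero_le_one ht'.le, Real.one_rpow]
        ring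
      · refine (hii.const_mul (rexp (-t))).congr (Eventually.of_forall fun v => ?_)
        simp only
        rw [show -((1 + v) * t) = -t + -(t * v) by ring, Real.exp_add]; ring
      · filter_upwards [ae_restrict_mem measurableSet_Ioi] with v hv
        have hv' : (0:ℝ) < v := hv
        simp only [Pi.zero_apply]
        positivity
    rw [setLIntegral_congr_fun measurableSet_Ioi h2, ← ofReal_integral_eq_lintegral_ofReal,
      integral_const_mul, ← Real.Gamma_eq_integral (by linarith)]
    · exact (Real.GammaIntegral_convergent (by linarith)).const_mul _
    · filter_upwards [ae_restrict_mem measurableSet_Ioi] with v hv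
      have hv' : (0:ℝ) < v := hv
      have := Real.Gamma_pos_of_pos hs0
      simp only [Pi.zero_apply]
      positivity
  · apply Measurable.aemeasurable
    unfold Function.uncurry
    fun_prop

lemma ftA_integrable (s : ℝ) (hs0 : 0 < s) (hs1 : s < 1) :
    IntegrableOn (fun v : ℝ => v ^ (s - 1) / (1 + v)) (Ioi 0) := by
  refine ⟨(by fun_prop : Measurable _).aestronglyMeasurable, ?_⟩
  rw [hasFiniteIntegral_iff_ofReal, ftA_lint s hs0 hs1]
  · exact ENNReal.ofReal_lt_top
  · filter_upwards [ae_restrict_mem measurableSet_Ioi] with v hv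
    have hv' : (0:ℝ) < v := hv
    simp only [Pi.zero_apply]
    positivity

lemma ftA_integral (s : ℝ) (hs0 : 0 < s) (hs1 : s < 1) :
    ∫ v in Ioi (0:ℝ), v ^ (s - 1) / (1 + v) = Real.Gamma s * Real.Gamma (1 - s) := by
  have h := Real.Gamma_pos_of_pos hs0
  have h' := Real.Gamma_pos_of_pos (show 0 < 1 - s by linarith)
  rw [integral_eq_lintegral_of_nonneg_ae, ftA_lint s hs0 hs1, ENNReal.toReal_ofReal (by positivity)]
  · filter_upwards [ae_restrict_mem measurableSet_Ioi] with v hv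
    have hv' : (0:ℝ) < v := hv
    simp only [Pi.zero_apply]
    positivity
  · exact (by fun_prop : Measurable _).aestronglyMeasurable

noncomputable def ftB (s V : ℝ) : ℝ := ∫ v in (0:ℝ)..V, v ^ (s - 1) / (1 + v)

lemma ftB_tendsto (s : ℝ) (hs0 : 0 < s) (hs1 : s < 1) :
    Tendsto (ftB s) atTop (nhds (Real.Gamma s * Real.Gamma (1 - s))) := by
  rw [← ftA_integral s hs0 hs1]
  exact intervalIntegral_tendsto_integral_Ioi 0 (ftA_integrable s hs0 hs1) tendsto_id

lemma ftB_mono (s : ℝ) (hs0 : 0 < s) (hs1 : s < 1) {V W : ℝ} (hV : 0 ≤ V) (h : V ≤ W) :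
    ftB s V ≤ ftB s W := by
  unfold ftB
  rw [intervalIntegral.integral_of_le hV, intervalIntegral.integral_of_le (hV.trans h)]
  apply setIntegral_mono_set
  · exact (ftA_integrable s hs0 hs1).mono_set Ioc_subset_Ioi_self
  · filter_upwards [ae_restrict_mem measurableSet_Ioc] with v hv
    have hv' : (0:ℝ) < v := hv.1
    simp only [Pi.zero_apply]
    positivity
  · exact (Ioc_subset_Ioc_right h).eventuallyLE

lemma ftB_le (s : ℝ) (hs0 : 0 < s) (hs1 : s < 1) {V : ℝ} (hV : 0 ≤ V) :
    ftB s V ≤ Real.Gamma s * Real.Gamma (1 - s) := by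
  apply ge_of_tendsto (ftB_tendsto s hs0 hs1)
  filter_upwards [eventually_ge_atTop V] with W hW
  exact ftB_mono s hs0 hs1 hV hW

/-- integral identity -/
lemma ftPhi (s : ℝ) (hs0 : 0 < s) (hs1 : s < 1) {V : ℝ} (hV : 0 ≤ V) :
    ∫ v in (0:ℝ)..V, v ^ s / (1 + v) = V ^ s / s - ftB s V := by
  have h1 : ∫ v in (0:ℝ)..V, v ^ (s - 1) = V ^ s / s := by
    rw [integral_rpow (Or.inl (by linarith))]
    simp [Real.zero_rpow hs0.ne']
  rw [← h1, ftB, ← intervalIntegral.integral_sub]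
  · rw [intervalIntegral.integral_of_le hV, intervalIntegral.integral_of_le hV]
    apply setIntegral_congr_fun measurableSet_Ioc
    intro v hv
    have hv' : (0:ℝ) < v := hv.1
    simp only
    rw [Real.rpow_sub_one hv'.ne']
    field_simp
    ring
  · exact intervalIntegral.intervalIntegrable_rpow' (by linarith)
  · rw [intervalIntegrable_iff_integrableOn_Ioc_of_le hV]
    exact (ftA_integrable s hs0 hs1).mono_set Ioc_subset_Ioi_self

noncomputable def ftk (A c v : ℝ) : ℝ := c / (2 * (1 + v) * √(4 * A * (1 + v) + c ^ 2))

lemma ftk_cont (A c s : ℝ) (hA : 0 < A) (hs0 : 0 < s) :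
    ContinuousOn (fun v => v ^ s * ftk A c v) (Ici 0) := by
  unfold ftk
  apply ContinuousOn.mul
  · exact (Real.continuous_rpow_const hs0.le).continuousOn
  · apply ContinuousOn.div (by fun_prop) (by fun_prop)
    intro v hv
    have hv' : (0:ℝ) ≤ v := hv
    have : 0 < 4 * A * (1 + v) + c ^ 2 := by positivity
    positivity

lemma ftk_cont2 (s : ℝ) (hs0 : 0 < s) :
    ContinuousOn (fun v : ℝ => v ^ s / (1 + v)) (Ici 0) := by
  apply ContinuousOn.div
  · exact (Real.continuous_rpow_const hs0.le).continuousOn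
  · fun_prop
  · intro v hv
    have hv' : (0:ℝ) ≤ v := hv
    positivity

lemma ftJ (A c s ε : ℝ) (hA : 0 < A) (hs0 : 0 < s) (hε : 0 < ε) (hV : 0 ≤ A + c * ε - ε ^ 2) :
    ∫ r in Ioi ε, max (A + c * r - r ^ 2) 0 ^ s * r ^ (-1 - 2 * s) =
      ∫ v in (0:ℝ)..((A + c * ε - ε ^ 2) / ε ^ 2), (v ^ s / (1 + v) / 2 + v ^ s * ftk A c v) := by
  set b := (c + √(c ^ 2 + 4 * A)) / 2 with hb
  have hq : √(c ^ 2 + 4 * A) ^ 2 = c ^ 2 + 4 * A := Real.sq_sqrt (by positivity)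
  have hcs : |c| < √(c ^ 2 + 4 * A) := by
    rw [← Real.sqrt_sq_eq_abs]; exact Real.sqrt_lt_sqrt (by positivity) (by linarith)
  have hb0 : 0 < b := by have := neg_abs_le c; linarith
  have hbc : 0 < b - c := by have := le_abs_self c; linarith
  have hfac : ∀ r, A + c * r - r ^ 2 = (b - r) * (r + (b - c)) := by
    intro r; rw [hb]; nlinarith [hq]
  have hεb : ε ≤ b := by
    rw [hfac] at hV
    by_contra hcon
    push Not at hcon
    nlinarith [mul_pos (sub_pos.2 hcon) (add_pos hε hbc)]
  have hpos : ∀ r ∈ Icc ε b, 0 < r ∧ 0 ≤ A + c * r - r ^ 2 := by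
    intro r hr
    have hr0 : 0 < r := lt_of_lt_of_le hε hr.1
    refine ⟨hr0, ?_⟩
    rw [hfac]
    exact mul_nonneg (by linarith [hr.2]) (by linarith)
  have hstep1 : ∫ r in Ioi ε, max (A + c * r - r ^ 2) 0 ^ s * r ^ (-1 - 2 * s) =
      ∫ r in ε..b, max (A + c * r - r ^ 2) 0 ^ s * r ^ (-1 - 2 * s) := by
    rw [intervalIntegral.integral_of_le hεb]
    apply setIntegral_eq_of_subset_of_forall_sdiff_eq_zero measurableSet_Ioi Ioc_subset_Ioi_self
    intro r hr
    have hr1 : ε < r := hr.1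
    have hr2 : b < r := by
      by_contra hcon
      exact hr.2 ⟨hr1, not_lt.1 hcon⟩
    have : A + c * r - r ^ 2 ≤ 0 := by
      rw [hfac]
      exact mul_nonpos_of_nonpos_of_nonneg (by linarith) (by linarith)
    rw [max_eq_right this, Real.zero_rpow hs0.ne', zero_mul]
  rw [hstep1]
  set f : ℝ → ℝ := fun r => (A + c * r - r ^ 2) / r ^ 2 with hf
  set f' : ℝ → ℝ := fun r => -(2 * A + c * r) / r ^ 3 with hf'
  set g : ℝ → ℝ := fun v => v ^ s / (1 + v) / 2 + v ^ s * ftk A c v with hg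
  have hgc : ContinuousOn g (Ici 0) := ((ftk_cont2 s hs0).div_const 2).add (ftk_cont A c s hA hs0)
  have hsub : ∫ r in ε..b, (g ∘ f) r * f' r = ∫ u in f ε..f b, g u := by
    apply intervalIntegral.integral_comp_mul_deriv''
    · rw [uIcc_of_le hεb]
      apply ContinuousOn.div (by fun_prop) (by fun_prop)
      intro r hr
      have := (hpos r hr).1
      positivity
    · rw [min_eq_left hεb, max_eq_right hεb]
      intro r hr
      have hr0 := (hpos r (Ioo_subset_Icc_self hr)).1
      have h1 : HasDerivAt (fun r : ℝ => A + c * r - r ^ 2) (c - 2 * r) r := by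
        have := HasDerivAt.fun_sub (((hasDerivAt_id r).const_mul c).const_add A) (hasDerivAt_pow 2 r)
        simpa using this
      have h2 : HasDerivAt (fun r : ℝ => r ^ 2) (2 * r) r := by
        simpa using hasDerivAt_pow 2 r
      have h3 := (HasDerivAt.fun_div h1 h2 (by positivity)).hasDerivWithinAt (s := Ioi r)
      refine h3.congr_deriv (Eq.symm ?_)
      change -(2 * A + c * r) / r ^ 3 = _
      field_simp
      ring
    · rw [uIcc_of_le hεb]
      apply ContinuousOn.div (by fun_prop) (by fun_prop)
      intro r hr
      have := (hpos r hr).1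
      positivity
    · rw [uIcc_of_le hεb]
      apply hgc.mono
      rintro _ ⟨r, hr, rfl⟩
      have := hpos r hr
      exact div_nonneg this.2 (by positivity)
  have hfb : f b = 0 := by
    simp only [hf]; rw [hfac]; simp
  rw [hfb, intervalIntegral.integral_symm 0 (f ε)] at hsub
  rw [show (A + c * ε - ε ^ 2) / ε ^ 2 = f ε from rfl, ← neg_neg (∫ u in (0:ℝ)..f ε, g u), ← hsub,
    ← intervalIntegral.integral_neg]
  apply intervalIntegral.integral_congr
  rw [uIcc_of_le hεb]
  intro r hr
  obtain ⟨hr0, hr1⟩ := hpos r hr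
  have hAc : 0 < A + c * r := by have : 0 < r ^ 2 := by positivity
                                 linarith
  have h2A : 0 < 2 * A + c * r := by linarith
  have h1f : 1 + f r = (A + c * r) / r ^ 2 := by simp only [hf]; field_simp; ring
  have hsq : √(4 * A * (1 + f r) + c ^ 2) = (2 * A + c * r) / r := by
    rw [h1f, show 4 * A * ((A + c * r) / r ^ 2) + c ^ 2 = ((2 * A + c * r) / r) ^ 2 by
      field_simp; ring]
    exact Real.sqrt_sq (by positivity)
  have hfs : f r ^ s = (A + c * r - r ^ 2) ^ s * r ^ (-1 - 2 * s) * r := by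
    simp only [hf]
    rw [Real.div_rpow hr1 (by positivity), mul_assoc, ← Real.rpow_add_one hr0.ne',
      show -1 - 2 * s + 1 = -(2 * s) by ring, Real.rpow_neg hr0.le, Real.rpow_mul hr0.le]
    norm_num [div_eq_mul_inv]
  simp only [Function.comp, hg, ftk, hf']
  rw [hsq, h1f, hfs, max_eq_left hr1]
  have e1 := h2A.ne'
  have e2 := hAc.ne'
  have e3 : 2 * A + r * c ≠ 0 := by rwa [mul_comm r c]
  have e5 : A * 2 + r * c ≠ 0 := by rwa [mul_comm r c, mul_comm A 2]
  have e4 : A + r * c ≠ 0 := by rwa [mul_comm r c]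
  generalize (A + c * r - r ^ 2) ^ s = X
  generalize r ^ (-1 - 2 * s) = Y
  field_simp
  ring

noncomputable def fth (A s c ε : ℝ) : ℝ :=
  ∫ r in Ioi ε, r * ((A ^ s - max (A + c * r - r ^ 2) 0 ^ s) / r ^ ((2:ℝ) + 2 * s))

lemma fth_eq (A c s ε : ℝ) (hA : 0 < A) (hs0 : 0 < s) (hs1 : s < 1) (hε : 0 < ε)
    (hV : 0 ≤ A + c * ε - ε ^ 2) :
    fth A s c ε = A ^ s * ε ^ (-2 * s) / (2 * s) -
      ((((A + c * ε - ε ^ 2) / ε ^ 2) ^ s / s - ftB s ((A + c * ε - ε ^ 2) / ε ^ 2)) / 2 +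
        ∫ v in (0:ℝ)..((A + c * ε - ε ^ 2) / ε ^ 2), v ^ s * ftk A c v) := by
  have hVV : 0 ≤ (A + c * ε - ε ^ 2) / ε ^ 2 := div_nonneg hV (by positivity)
  have hI : IntegrableOn (fun r : ℝ => r ^ (-1 - 2 * s)) (Ioi ε) :=
    integrableOn_Ioi_rpow_of_lt (by linarith) hε
  have h1 : fth A s c ε = (∫ r in Ioi ε, A ^ s * r ^ (-1 - 2 * s)) -
      ∫ r in Ioi ε, max (A + c * r - r ^ 2) 0 ^ s * r ^ (-1 - 2 * s) := by
    rw [fth, ← integral_sub]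
    · apply setIntegral_congr_fun measurableSet_Ioi
      intro r hr
      have hr0 : 0 < r := hε.trans hr
      simp only
      rw [← sub_mul, show (-1 - 2 * s) = -(2 + 2 * s) + 1 by ring, Real.rpow_add_one hr0.ne',
        Real.rpow_neg hr0.le]
      ring
    · exact hI.const_mul _
    · refine (hI.const_mul ((A + c ^ 2 / 4) ^ s)).mono' ?_ ?_
      · exact (by fun_prop : Measurable _).aestronglyMeasurable
      · filter_upwards [ae_restrict_mem measurableSet_Ioi] with r hr
        have hr0 : 0 < r := hε.trans hr
        rw [Real.norm_of_nonneg (by positivity)]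
        gcongr
        apply max_le
        · nlinarith [sq_nonneg (r - c / 2)]
        · positivity
  rw [h1, ftJ A c s ε hA hs0 hε hV, integral_const_mul, integral_Ioi_rpow_of_lt (by linarith) hε,
    intervalIntegral.integral_add, intervalIntegral.integral_div, ftPhi s hs0 hs1 hVV]
  · rw [show -1 - 2 * s + 1 = -2 * s by ring]
    field_simp
  · apply ContinuousOn.intervalIntegrable
    rw [uIcc_of_le hVV]
    exact ((ftk_cont2 s hs0).div_const 2).mono Icc_subset_Ici_self
  · apply ContinuousOn.intervalIntegrable
    rw [uIcc_of_le hVV]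
    exact (ftk_cont A c s hA hs0).mono Icc_subset_Ici_self

/-- Two-sided Bernoulli. -/
lemma ft_bern (s x : ℝ) (hs0 : 0 < s) (hs1 : s < 1) (hx : 0 < x) :
    |x ^ s - (1 + s * (x - 1))| ≤ (x - 1) ^ 2 := by
  have h1 : x ^ s ≤ 1 + s * (x - 1) := by
    have := rpow_one_add_le_one_add_mul_self (s := x - 1) (by linarith) hs0.le hs1.le
    simpa using this
  have h2 : x ^ (1 - s) ≤ 1 + (1 - s) * (x - 1) := by
    have := rpow_one_add_le_one_add_mul_self (s := x - 1) (p := 1 - s) (by linarith) (by linarith)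
      (by linarith)
    simpa using this
  have hx1 : 0 < x ^ s := by positivity
  have hx2 : 0 < x ^ (1 - s) := by positivity
  have hm : x ^ s * x ^ (1 - s) = x := by
    rw [← Real.rpow_add hx]; simp
  have hD : 0 < 1 + (1 - s) * (x - 1) := by linarith
  have h3 : x ≤ x ^ s * (1 + (1 - s) * (x - 1)) := by
    calc x = x ^ s * x ^ (1 - s) := hm.symm
      _ ≤ _ := by gcongr
  rw [abs_le]
  constructor
  · skip
    have h4 : x * (1 - (1 - s) * (x - 1)) ≤ x ^ s := by
      by_contra hcon
      push Not at hcon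
      have h5 : x ^ s * (1 + (1 - s) * (x - 1)) <
          x * (1 - (1 - s) * (x - 1)) * (1 + (1 - s) * (x - 1)) :=
        mul_lt_mul_of_pos_right hcon hD
      have h6 : x * (1 - (1 - s) * (x - 1)) * (1 + (1 - s) * (x - 1)) ≤ x := by
        have : 0 ≤ x * ((1 - s) * (x - 1)) ^ 2 := by positivity
        nlinarith
      linarith
    have : 0 ≤ s * (x - 1) ^ 2 := by positivity
    nlinarith
  · have : 0 ≤ (x - 1) ^ 2 := by positivity
    linarith

lemma ftk_neg (A c v : ℝ) : ftk A (-c) v = - ftk A c v := by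
  unfold ftk; rw [neg_sq, neg_div]

lemma ftk_bound (A c s W v : ℝ) (hA : 0 < A) (hs1 : s < 1) (hc : |c| ≤ 2)
    (hW : 0 < W) (hv : W ≤ v) : ‖v ^ s * ftk A c v‖ ≤ W ^ (s - 1) / (2 * √(A * W)) := by
  have hv0 : 0 < v := hW.trans_le hv
  unfold ftk
  have h1 : √(4 * A * (1 + v) + c ^ 2) ≥ 2 * √(A * W) := by
    have : √(4 * (A * W)) = 2 * √(A * W) := by
      rw [Real.sqrt_mul (by norm_num)]
      congr 1
      rw [show (4:ℝ) = 2 ^ 2 by norm_num]; exact Real.sqrt_sq (by norm_num)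
    rw [← this]
    apply Real.sqrt_le_sqrt
    nlinarith [mul_le_mul_of_nonneg_left hv hA.le, sq_nonneg c]
  have hAW : 0 < √(A * W) := by positivity
  have hq : 0 < √(4 * A * (1 + v) + c ^ 2) := by linarith
  rw [norm_mul, norm_div, Real.norm_eq_abs c, Real.norm_of_nonneg (by positivity),
    Real.norm_of_nonneg (by positivity)]
  calc v ^ s * (|c| / (2 * (1 + v) * √(4 * A * (1 + v) + c ^ 2)))
      ≤ v ^ s * (2 / (2 * v * (2 * √(A * W)))) := by
        gcongr
        linarith
    _ = v ^ (s - 1) / (2 * √(A * W)) := by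
        rw [Real.rpow_sub_one hv0.ne']; field_simp
    _ ≤ _ := by
        gcongr ?_ / _
        exact Real.rpow_le_rpow_of_nonpos hW hv (by linarith)

lemma ft_unif (A c s ε : ℝ) (hA : 0 < A) (hA1 : A ≤ 1) (hs0 : 0 < s) (hs1 : s < 1) (hε : 0 < ε)
    (hεA : ε ≤ A / 6) (hc : |c| ≤ 2) :
    |fth A s c ε + fth A s (-c) ε - Real.Gamma s * Real.Gamma (1 - s)| ≤
      ε ^ (2 - 2 * s) / s * (1 / A + 9 / A ^ 2) +
      (Real.Gamma s * Real.Gamma (1 - s) - ftB s (A / (2 * ε ^ 2))) +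
      4 * (A / (2 * ε ^ 2)) ^ (s - 1) / A := by
  obtain ⟨hc1, hc2⟩ := abs_le.1 hc
  have hε2 : ε ^ 2 ≤ ε := by nlinarith
  have hlow : ∀ d : ℝ, |d| ≤ 2 → A / 2 ≤ A + d * ε - ε ^ 2 := by
    intro d hd
    obtain ⟨h1, h2⟩ := abs_le.1 hd
    nlinarith
  have hcn : |(-c)| ≤ 2 := by rwa [abs_neg]
  set W := A / (2 * ε ^ 2) with hWdef
  have hW : 0 < W := by positivity
  set P := (A + c * ε - ε ^ 2) / ε ^ 2 with hP
  set Q := (A + (-c) * ε - ε ^ 2) / ε ^ 2 with hQ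
  have hWP : W ≤ P := by
    rw [hWdef, hP, ← div_div]; gcongr; exact hlow c hc
  have hWQ : W ≤ Q := by
    rw [hWdef, hQ, ← div_div]; gcongr; exact hlow _ hcn
  rw [fth_eq A c s ε hA hs0 hs1 hε (by linarith [hlow c hc]),
    fth_eq A (-c) s ε hA hs0 hs1 hε (by linarith [hlow _ hcn]), ← hP, ← hQ]
  have hII : ∀ a b : ℝ, 0 ≤ a → 0 ≤ b →
      IntervalIntegrable (fun v => v ^ s * ftk A c v) volume a b := by
    intro a b ha hb
    apply ContinuousOn.intervalIntegrable
    apply (ftk_cont A c s hA hs0).mono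
    intro v hv
    exact (le_min ha hb).trans hv.1
  have hk : (∫ v in (0:ℝ)..P, v ^ s * ftk A c v) + ∫ v in (0:ℝ)..Q, v ^ s * ftk A (-c) v =
      ∫ v in Q..P, v ^ s * ftk A c v := by
    simp_rw [ftk_neg, mul_neg]
    rw [intervalIntegral.integral_neg, ← sub_eq_add_neg,
      intervalIntegral.integral_interval_sub_left (hII _ _ le_rfl (hW.le.trans hWP))
        (hII _ _ le_rfl (hW.le.trans hWQ))]
  have hkb : |∫ v in Q..P, v ^ s * ftk A c v| ≤ 4 * W ^ (s - 1) / A := by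
    have := intervalIntegral.norm_integral_le_of_norm_le_const (a := Q) (b := P)
      (f := fun v => v ^ s * ftk A c v) (C := W ^ (s - 1) / (2 * √(A * W))) (by
        intro v hv
        apply ftk_bound A c s W v hA hs1 hc hW
        exact (le_min hWQ hWP).trans hv.1.le)
    rw [Real.norm_eq_abs] at this
    refine this.trans ?_
    have hPQ : |P - Q| ≤ 4 / ε := by
      have : P - Q = 2 * c / ε := by rw [hP, hQ]; field_simp; ring
      rw [this, abs_div, abs_mul, abs_of_pos hε]
      norm_num
      gcongr
      linarith
    have hsq : A / (2 * ε) ≤ √(A * W) := by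
      apply Real.le_sqrt_of_sq_le
      rw [hWdef]
      field_simp
      norm_num
    calc W ^ (s - 1) / (2 * √(A * W)) * |P - Q|
        ≤ W ^ (s - 1) / (2 * (A / (2 * ε))) * (4 / ε) := by gcongr
      _ = _ := by field_simp
  have hx : ∀ d : ℝ, |d| ≤ 2 → |((A + d * ε - ε ^ 2) / ε ^ 2) ^ s -
      A ^ s * ε ^ (-2 * s) * (1 + s * (d * ε - ε ^ 2) / A)| ≤
        A ^ s * ε ^ (-2 * s) * (9 * ε ^ 2 / A ^ 2) := by
    intro d hd
    have hl := hlow d hd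
    obtain ⟨h1, h2⟩ := abs_le.1 hd
    have e1 : ((A + d * ε - ε ^ 2) / ε ^ 2) ^ s =
        A ^ s * ε ^ (-2 * s) * ((A + d * ε - ε ^ 2) / A) ^ s := by
      rw [Real.div_rpow (by linarith) (by positivity), Real.div_rpow (by linarith) hA.le,
        show -2 * s = -(2 * s) by ring, Real.rpow_neg hε.le, Real.rpow_mul hε.le]
      norm_num
      have : 0 < A ^ s := by positivity
      field_simp
    have e2 : 1 + s * (d * ε - ε ^ 2) / A = 1 + s * ((A + d * ε - ε ^ 2) / A - 1) := by
      field_simp; ring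
    rw [e1, e2, ← mul_sub, abs_mul, abs_of_pos (by positivity)]
    gcongr
    refine (ft_bern s _ hs0 hs1 (div_pos (by linarith) hA)).trans ?_
    rw [show ((A + d * ε - ε ^ 2) / A - 1) ^ 2 = (d * ε - ε ^ 2) ^ 2 / A ^ 2 by field_simp; ring]
    gcongr
    rw [show 9 * ε ^ 2 = (3 * ε) ^ 2 by ring]
    apply sq_le_sq'
    · nlinarith
    · nlinarith
  have hx1 := hx c hc
  have hx2 := hx (-c) hcn
  rw [← hP] at hx1
  rw [← hQ] at hx2
  have hAs : A ^ s ≤ 1 := Real.rpow_le_one hA.le hA1 hs0.le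
  set T := A ^ s * ε ^ (-2 * s) with hT
  have hT0 : 0 < T := by positivity
  have hTε : T * ε ^ 2 ≤ ε ^ (2 - 2 * s) := by
    have : ε ^ (2 - 2 * s) = ε ^ (-2 * s) * ε ^ 2 := by
      rw [show 2 - 2 * s = -2 * s + 2 by ring, Real.rpow_add hε]; norm_num
    rw [this, hT, mul_assoc]
    have : 0 < ε ^ (-2 * s) * ε ^ 2 := by positivity
    nlinarith
  have hB1 := ftB_mono s hs0 hs1 hW.le hWP
  have hB2 := ftB_mono s hs0 hs1 hW.le hWQ
  have hB3 := ftB_le s hs0 hs1 (hW.le.trans hWP)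
  have hB4 := ftB_le s hs0 hs1 (hW.le.trans hWQ)
  have hmain : |T / s - (P ^ s + Q ^ s) / (2 * s)| ≤ ε ^ (2 - 2 * s) / s * (1 / A + 9 / A ^ 2) := by
    have e : T / s - (P ^ s + Q ^ s) / (2 * s) = (1 / (2 * s)) *
        (2 * s * (T * ε ^ 2) / A - (P ^ s - T * (1 + s * (c * ε - ε ^ 2) / A)) -
          (Q ^ s - T * (1 + s * ((-c) * ε - ε ^ 2) / A))) := by
      field_simp
      ring
    have hy : T * (9 * ε ^ 2 / A ^ 2) ≤ 9 * ε ^ (2 - 2 * s) / A ^ 2 := by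
      rw [show T * (9 * ε ^ 2 / A ^ 2) = 9 * (T * ε ^ 2) / A ^ 2 by ring]
      gcongr
    have hz : 2 * s * (T * ε ^ 2) / A ≤ 2 * ε ^ (2 - 2 * s) / A := by
      have : 2 * s * (T * ε ^ 2) ≤ 2 * 1 * ε ^ (2 - 2 * s) := by gcongr
      rw [mul_one] at this
      gcongr
    have hz0 : 0 ≤ 2 * s * (T * ε ^ 2) / A := by positivity
    rw [e, abs_mul, abs_of_pos (by positivity)]
    have hb : |2 * s * (T * ε ^ 2) / A - (P ^ s - T * (1 + s * (c * ε - ε ^ 2) / A)) -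
          (Q ^ s - T * (1 + s * ((-c) * ε - ε ^ 2) / A))| ≤
        2 * ε ^ (2 - 2 * s) / A + 2 * (9 * ε ^ (2 - 2 * s) / A ^ 2) := by
      rw [abs_le] at hx1 hx2 ⊢
      constructor <;> linarith [hx1.1, hx1.2, hx2.1, hx2.2]
    calc _ ≤ 1 / (2 * s) * (2 * ε ^ (2 - 2 * s) / A + 2 * (9 * ε ^ (2 - 2 * s) / A ^ 2)) := by gcongr
      _ = _ := by field_simp
  have efin : T / (2 * s) - ((P ^ s / s - ftB s P) / 2 + ∫ v in (0:ℝ)..P, v ^ s * ftk A c v) +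
      (T / (2 * s) - ((Q ^ s / s - ftB s Q) / 2 + ∫ v in (0:ℝ)..Q, v ^ s * ftk A (-c) v)) =
      (T / s - (P ^ s + Q ^ s) / (2 * s)) + (ftB s P + ftB s Q) / 2 -
        ∫ v in Q..P, v ^ s * ftk A c v := by
    rw [← hk]; field_simp; ring
  rw [efin]
  rw [abs_le] at hmain hkb ⊢
  constructor <;> linarith [hmain.1, hmain.2, hkb.1, hkb.2]

/-- The slope coefficient in direction `θ`. -/
noncomputable def ftc (x : EuclideanSpace ℝ (Fin 2)) (θ : ℝ) : ℝ :=
  -2 * (x 0 * Real.cos θ + x 1 * Real.sin θ)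

noncomputable def ftg (x : EuclideanSpace ℝ (Fin 2)) (A s : ℝ) (p : ℝ × ℝ) : ℝ :=
  p.1 * ((A ^ s - max (A + ftc x p.2 * p.1 - p.1 ^ 2) 0 ^ s) / p.1 ^ ((2:ℝ) + 2 * s))

lemma ftc_bound (x : EuclideanSpace ℝ (Fin 2)) (hx : ‖x‖ < 1) (θ : ℝ) : |ftc x θ| ≤ 2 := by
  have h : x 0 ^ 2 + x 1 ^ 2 = ‖x‖ ^ 2 := by
    rw [EuclideanSpace.real_norm_sq_eq]; simp
  have h1 : ‖x‖ ^ 2 ≤ 1 := by nlinarith [norm_nonneg x]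
  have h2 := Real.sin_sq_add_cos_sq θ
  apply abs_le_of_sq_le_sq _ (by norm_num)
  unfold ftc
  have h3 : (x 0 * Real.cos θ + x 1 * Real.sin θ) ^ 2 ≤ 1 := by
    have e : (x 0 * Real.cos θ + x 1 * Real.sin θ) ^ 2 =
      (x 0 ^ 2 + x 1 ^ 2) * (Real.sin θ ^ 2 + Real.cos θ ^ 2) -
        (x 0 * Real.sin θ - x 1 * Real.cos θ) ^ 2 := by ring
    rw [e, h2, h]
    nlinarith [sq_nonneg (x 0 * Real.sin θ - x 1 * Real.cos θ)]
  nlinarith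

lemma ftc_cont (x : EuclideanSpace ℝ (Fin 2)) : Continuous (ftc x) := by
  unfold ftc; fun_prop

lemma ftg_integrable (x : EuclideanSpace ℝ (Fin 2)) (hx : ‖x‖ < 1) (A s ε : ℝ) (hA : 0 < A)
    (hs0 : 0 < s) (hε : 0 < ε) :
    Integrable (ftg x A s)
      ((volume.restrict (Ioi ε)).prod (volume.restrict (Ioo (-Real.pi) Real.pi))) := by
  have hI : Integrable (fun r : ℝ => (A ^ s + (A + 1) ^ s) * r ^ (-1 - 2 * s))
      (volume.restrict (Ioi ε)) :=
    (integrableOn_Ioi_rpow_of_lt (by linarith) hε).const_mul _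
  have h1 : Integrable (fun _ : ℝ => (1:ℝ)) (volume.restrict (Ioo (-Real.pi) Real.pi)) :=
    integrable_const _
  refine (hI.mul_prod h1).mono' ?_ ?_
  · have := (ftc_cont x).measurable
    unfold ftg
    exact (by fun_prop : Measurable _).aestronglyMeasurable
  · rw [Measure.prod_restrict]
    filter_upwards [ae_restrict_mem (measurableSet_Ioi.prod measurableSet_Ioo)] with p hp
    have hr0 : 0 < p.1 := hε.trans hp.1
    have hc := ftc_bound x hx p.2
    unfold ftg
    set c := ftc x p.2
    have hmax : max (A + c * p.1 - p.1 ^ 2) 0 ^ s ≤ (A + 1) ^ s := by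
      gcongr
      apply max_le
      · have : c ^ 2 ≤ 4 := by nlinarith [abs_le.1 hc]
        nlinarith [sq_nonneg (p.1 - c / 2)]
      · positivity
    have hm0 : 0 ≤ max (A + c * p.1 - p.1 ^ 2) 0 ^ s := by positivity
    have hA0 : 0 ≤ A ^ s := by positivity
    have e : p.1 * ((A ^ s - max (A + c * p.1 - p.1 ^ 2) 0 ^ s) / p.1 ^ ((2:ℝ) + 2 * s)) =
        (A ^ s - max (A + c * p.1 - p.1 ^ 2) 0 ^ s) * p.1 ^ (-1 - 2 * s) := by
      rw [show (-1 - 2 * s) = -(2 + 2 * s) + 1 by ring, Real.rpow_add_one hr0.ne',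
        Real.rpow_neg hr0.le]
      ring
    rw [e, mul_one, norm_mul, Real.norm_of_nonneg (r := p.1 ^ (-1 - 2 * s)) (by positivity)]
    gcongr
    rw [Real.norm_eq_abs, abs_le]
    constructor <;> linarith

lemma ft_polar (x : EuclideanSpace ℝ (Fin 2)) (hx : ‖x‖ < 1) (s ε : ℝ)
    (hs0 : 0 < s) (hε : 0 < ε) :
    ∫ y in {y | ε < ‖x - y‖}, ((1 - ‖x‖ ^ 2) ^ s - max (1 - ‖y‖ ^ 2) 0 ^ s) /
        ‖x - y‖ ^ ((2:ℝ) + 2 * s) =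
      ∫ θ in Ioo (-Real.pi) Real.pi, fth (1 - ‖x‖ ^ 2) s (ftc x θ) ε := by
  set A := 1 - ‖x‖ ^ 2 with hA
  have hA0 : 0 < A := by nlinarith [norm_nonneg x]
  have hmeas : MeasurableSet {y : EuclideanSpace ℝ (Fin 2) | ε < ‖x - y‖} :=
    measurableSet_lt measurable_const (by fun_prop)
  rw [← integral_indicator hmeas, ← integral_add_left_eq_self _ x]
  have hmp : MeasurePreserving
      ((MeasurableEquiv.toLp 2 (Fin 2 → ℝ)).symm.trans MeasurableEquiv.finTwoArrow).symm
      (volume : Measure (ℝ × ℝ)) (volume : Measure (EuclideanSpace ℝ (Fin 2))) :=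
    ((EuclideanSpace.volume_preserving_symm_measurableEquiv_toLp (Fin 2)).trans
      (volume_preserving_finTwoArrow ℝ)).symm
  rw [← hmp.integral_comp', ← integral_comp_polarCoord_symm]
  have htgt : polarCoord.target = Ioi (0:ℝ) ×ˢ Ioo (-Real.pi) Real.pi := rfl
  rw [htgt]
  have hmeas2 : MeasurableSet {p : ℝ × ℝ | ε < p.1} := measurableSet_lt measurable_const measurable_fst
  have hcongr : ∀ p ∈ Ioi (0:ℝ) ×ˢ Ioo (-Real.pi) Real.pi,
      p.1 • ({y : EuclideanSpace ℝ (Fin 2) | ε < ‖x - y‖}.indicator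
        (fun y => (A ^ s - max (1 - ‖y‖ ^ 2) 0 ^ s) / ‖x - y‖ ^ ((2:ℝ) + 2 * s))
        (x + ((MeasurableEquiv.toLp 2 (Fin 2 → ℝ)).symm.trans MeasurableEquiv.finTwoArrow).symm
          (polarCoord.symm p))) =
      {p : ℝ × ℝ | ε < p.1}.indicator (ftg x A s) p := by
    intro p hp
    have hr0 : 0 < p.1 := hp.1
    set z : EuclideanSpace ℝ (Fin 2) :=
      ((MeasurableEquiv.toLp 2 (Fin 2 → ℝ)).symm.trans MeasurableEquiv.finTwoArrow).symm
          (polarCoord.symm p) with hz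
    have hz0 : z 0 = p.1 * Real.cos p.2 := rfl
    have hz1 : z 1 = p.1 * Real.sin p.2 := rfl
    have hcs := Real.sin_sq_add_cos_sq p.2
    have hzn : ‖x - (x + z)‖ = p.1 := by
      rw [sub_add_cancel_left, norm_neg]
      have : ‖z‖ ^ 2 = p.1 ^ 2 := by
        rw [EuclideanSpace.real_norm_sq_eq, Fin.sum_univ_two, hz0, hz1]
        linear_combination p.1 ^ 2 * hcs
      exact (sq_eq_sq₀ (norm_nonneg _) hr0.le).1 this
    have hxz : 1 - ‖x + z‖ ^ 2 = A + ftc x p.2 * p.1 - p.1 ^ 2 := by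
      rw [hA, EuclideanSpace.real_norm_sq_eq, EuclideanSpace.real_norm_sq_eq, Fin.sum_univ_two,
        Fin.sum_univ_two, PiLp.add_apply, PiLp.add_apply, hz0, hz1, ftc]
      linear_combination -p.1 ^ 2 * hcs
    by_cases h : ε < p.1
    · rw [indicator_of_mem (show x + z ∈ {y | ε < ‖x - y‖} by
        rw [mem_ofPred_eq, hzn]; exact h), indicator_of_mem (show p ∈ {p : ℝ × ℝ | ε < p.1} from h)]
      rw [hzn, hxz, smul_eq_mul]
      rfl
    · rw [indicator_of_notMem (show x + z ∉ {y | ε < ‖x - y‖} by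
        rw [mem_ofPred_eq, hzn]; exact h), indicator_of_notMem (show p ∉ {p : ℝ × ℝ | ε < p.1} from h)]
      simp
  rw [setIntegral_congr_fun (measurableSet_Ioi.prod measurableSet_Ioo) hcongr,
    setIntegral_indicator hmeas2]
  have hset : (Ioi (0:ℝ) ×ˢ Ioo (-Real.pi) Real.pi) ∩ {p : ℝ × ℝ | ε < p.1} =
      Ioi ε ×ˢ Ioo (-Real.pi) Real.pi := by
    ext p
    simp only [mem_inter_iff, mem_prod, mem_Ioi, mem_ofPred_eq]
    constructor
    · rintro ⟨⟨_, h2⟩, h3⟩; exact ⟨h3, h2⟩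
    · rintro ⟨h1, h2⟩; exact ⟨⟨hε.trans h1, h2⟩, h1⟩
  rw [hset, Measure.volume_eq_prod, ← Measure.prod_restrict,
    integral_prod_symm _ (ftg_integrable x hx A s ε hA0 hs0 hε)]
  rfl

lemma ft_half (x : EuclideanSpace ℝ (Fin 2)) (hx : ‖x‖ < 1) (s ε K δ : ℝ)
    (hs0 : 0 < s) (hε : 0 < ε)
    (hb : ∀ c : ℝ, |c| ≤ 2 → |fth (1 - ‖x‖ ^ 2) s c ε + fth (1 - ‖x‖ ^ 2) s (-c) ε - K| ≤ δ) :
    |(∫ θ in Ioo (-Real.pi) Real.pi, fth (1 - ‖x‖ ^ 2) s (ftc x θ) ε) - Real.pi * K| ≤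
      Real.pi * δ := by
  set A := 1 - ‖x‖ ^ 2 with hA
  have hA0 : 0 < A := by nlinarith [norm_nonneg x]
  have hpi := Real.pi_pos
  set H : ℝ → ℝ := fun θ => fth A s (ftc x θ) ε with hH
  have hanti : ∀ θ, ftc x (θ + Real.pi) = - ftc x θ := by
    intro θ; unfold ftc; rw [Real.cos_add_pi, Real.sin_add_pi]; ring
  have hper : Function.Periodic H (2 * Real.pi) := by
    intro θ
    simp only [hH]
    rw [show θ + 2 * Real.pi = θ + Real.pi + Real.pi by ring, hanti, hanti, neg_neg]
  have hHi : IntervalIntegrable H volume (-Real.pi) Real.pi := by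
    rw [intervalIntegrable_iff_integrableOn_Ioo_of_le (by linarith)]
    exact (ftg_integrable x hx A s ε hA0 hs0 hε).integral_prod_right
  have hall : ∀ a b, IntervalIntegrable H volume a b := by
    intro a b
    apply hper.intervalIntegrable (t := -Real.pi) (by positivity)
    rwa [show -Real.pi + 2 * Real.pi = Real.pi by ring]
  have hHi2 : IntervalIntegrable (fun θ => H (θ + Real.pi)) volume (-Real.pi) Real.pi := by
    have := (hall (-Real.pi + Real.pi) (Real.pi + Real.pi)).comp_add_right Real.pi
    simpa using this
  have hshift : ∫ θ in (-Real.pi)..Real.pi, H (θ + Real.pi) = ∫ θ in (-Real.pi)..Real.pi, H θ := by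
    rw [intervalIntegral.integral_comp_add_right]
    have := hper.intervalIntegral_add_eq (-Real.pi) (-Real.pi + Real.pi)
    rw [show -Real.pi + 2 * Real.pi = Real.pi by ring] at this
    rw [this]
    congr 1
    ring
  have hsum : ∫ θ in (-Real.pi)..Real.pi, (H θ + H (θ + Real.pi) - K) =
      2 * (∫ θ in (-Real.pi)..Real.pi, H θ) - 2 * Real.pi * K := by
    rw [intervalIntegral.integral_sub (hHi.add hHi2) intervalIntegrable_const,
      intervalIntegral.integral_add hHi hHi2, hshift, intervalIntegral.integral_const, smul_eq_mul]
    ring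
  have hbound := intervalIntegral.norm_integral_le_of_norm_le_const (a := -Real.pi) (b := Real.pi)
      (f := fun θ => H θ + H (θ + Real.pi) - K) (C := δ) (by
        intro θ _
        simp only [hH]
        rw [hanti]
        exact hb _ (ftc_bound x hx θ))
  rw [hsum, Real.norm_eq_abs, show Real.pi - -Real.pi = 2 * Real.pi by ring,
    abs_of_pos (by positivity : 0 < 2 * Real.pi)] at hbound
  rw [← integral_Ioc_eq_integral_Ioo, ← intervalIntegral.integral_of_le (by linarith)]
  rw [abs_le] at hbound ⊢
  constructor <;> linarith [hbound.1, hbound.2]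

lemma ft_delta (A s : ℝ) (hA : 0 < A) (hs0 : 0 < s) (hs1 : s < 1) :
    Tendsto (fun ε : ℝ => Real.pi * (ε ^ (2 - 2 * s) / s * (1 / A + 9 / A ^ 2) +
      (Real.Gamma s * Real.Gamma (1 - s) - ftB s (A / (2 * ε ^ 2))) +
      4 * (A / (2 * ε ^ 2)) ^ (s - 1) / A)) (nhdsWithin 0 (Ioi 0)) (nhds 0) := by
  have hW : Tendsto (fun ε : ℝ => A / (2 * ε ^ 2)) (nhdsWithin 0 (Ioi 0)) atTop := by
    have h1 : Tendsto (fun ε : ℝ => (2 * ε ^ 2) / A) (nhdsWithin 0 (Ioi 0)) (nhdsWithin 0 (Ioi 0)) := by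
      apply tendsto_nhdsWithin_iff.2
      constructor
      · apply tendsto_nhdsWithin_of_tendsto_nhds
        have : Continuous (fun ε : ℝ => (2 * ε ^ 2) / A) := by fun_prop
        simpa using this.tendsto 0
      · filter_upwards [self_mem_nhdsWithin] with ε hε
        have : (0:ℝ) < ε := hε
        exact mem_Ioi.2 (by positivity)
    refine (tendsto_inv_nhdsGT_zero.comp h1).congr fun ε => ?_
    simp [inv_div]
  have h1 : Tendsto (fun ε : ℝ => ε ^ (2 - 2 * s)) (nhdsWithin 0 (Ioi 0)) (nhds 0) := by
    apply tendsto_nhdsWithin_of_tendsto_nhds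
    have := (Real.continuous_rpow_const (q := 2 - 2 * s) (by linarith)).tendsto 0
    rwa [Real.zero_rpow (by linarith)] at this
  have h2 := (ftB_tendsto s hs0 hs1).comp hW
  have h3 : Tendsto (fun ε : ℝ => (A / (2 * ε ^ 2)) ^ (s - 1)) (nhdsWithin 0 (Ioi 0)) (nhds 0) := by
    have := (tendsto_rpow_neg_atTop (y := 1 - s) (by linarith)).comp hW
    rw [neg_sub] at this
    exact this
  have := ((((h1.div_const s).mul_const (1 / A + 9 / A ^ 2)).add
    (h2.const_sub (Real.Gamma s * Real.Gamma (1 - s)))).add ((h3.const_mul 4).div_const A)).const_mul Real.pi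
  simpa using this

theorem fracLap_torsion_solution (s : ℝ) (hs : s ∈ Set.Ioo (0:ℝ) 1)
    (u : EuclideanSpace ℝ (Fin 2) → ℝ)
    (hu : u = fun x => max (1 - ‖x‖ ^ 2) 0 ^ s / (2 ^ (2 * s) * Real.Gamma (1 + s) ^ 2)) :
    ∀ x ∈ Metric.ball (0 : EuclideanSpace ℝ (Fin 2)) 1,
      Tendsto
        (fun ε : ℝ =>
          (2 ^ (2 * s) * s * Real.Gamma (s + 1) / (Real.pi * Real.Gamma (1 - s))) *
            ∫ y in {y | ε < ‖x - y‖}, (u x - u y) / ‖x - y‖ ^ ((2 : ℝ) + 2 * s))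
        (nhdsWithin 0 (Set.Ioi 0)) (nhds 1) := by
  obtain ⟨hs0, hs1⟩ := hs
  intro x hx
  have hx1 : ‖x‖ < 1 := by simpa using hx
  have hA0 : 0 < 1 - ‖x‖ ^ 2 := by nlinarith [norm_nonneg x]
  have hG1 := Real.Gamma_pos_of_pos (show 0 < 1 - s by linarith)
  have hG2 := Real.Gamma_pos_of_pos hs0
  have hG3 : Real.Gamma (1 + s) = s * Real.Gamma s := by
    rw [add_comm, Real.Gamma_add_one hs0.ne']
  have hG4 : Real.Gamma (s + 1) = s * Real.Gamma s := Real.Gamma_add_one hs0.ne'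
  have hpi := Real.pi_pos
  have h2s : (0:ℝ) < 2 ^ (2 * s) := by positivity
  set N : ℝ := 2 ^ (2 * s) * Real.Gamma (1 + s) ^ 2 with hN
  have hN0 : N ≠ 0 := by rw [hN, hG3]; positivity
  have hIeq : ∀ ε : ℝ, 0 < ε →
      ∫ y in {y | ε < ‖x - y‖}, (u x - u y) / ‖x - y‖ ^ ((2 : ℝ) + 2 * s) =
      (∫ θ in Ioo (-Real.pi) Real.pi, fth (1 - ‖x‖ ^ 2) s (ftc x θ) ε) / N := by
    intro ε hε
    rw [← ft_polar x hx1 s ε hs0 hε, ← integral_div]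
    congr 1
    ext y
    rw [hu]
    simp only
    rw [max_eq_left hA0.le]
    ring
  have hlim : Tendsto (fun ε => ∫ θ in Ioo (-Real.pi) Real.pi, fth (1 - ‖x‖ ^ 2) s (ftc x θ) ε)
      (nhdsWithin 0 (Ioi 0)) (nhds (Real.pi * (Real.Gamma s * Real.Gamma (1 - s)))) := by
    rw [tendsto_iff_dist_tendsto_zero]
    refine squeeze_zero' (Eventually.of_forall fun _ => dist_nonneg) ?_
      (ft_delta (1 - ‖x‖ ^ 2) s hA0 hs0 hs1)
    filter_upwards [Ioo_mem_nhdsGT (show (0:ℝ) < (1 - ‖x‖ ^ 2) / 6 by positivity)] with ε hε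
    rw [Real.dist_eq]
    apply ft_half x hx1 s ε _ _ hs0 hε.1
    intro c hc
    exact ft_unif _ c s ε hA0 (by nlinarith [norm_nonneg x]) hs0 hs1 hε.1 hε.2.le hc
  have hfin := ((hlim.div_const N).const_mul
    (2 ^ (2 * s) * s * Real.Gamma (s + 1) / (Real.pi * Real.Gamma (1 - s))))
  have hval : (2 ^ (2 * s) * s * Real.Gamma (s + 1) / (Real.pi * Real.Gamma (1 - s))) *
      (Real.pi * (Real.Gamma s * Real.Gamma (1 - s)) / N) = 1 := by
    rw [hN, hG3, hG4]
    field_simp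
  rw [hval] at hfin
  refine hfin.congr' ?_
  filter_upwards [self_mem_nhdsWithin] with ε hε
  rw [hIeq ε hε]
end
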